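/- For a Schottky group Γ, the Hausdorff dimension of its limit set is strictly less than 1 if and only if there exists a rectifiable quasi-circle for Γ. -/

import Mathlib

open Filter Set Topology
open scoped ENNReal NNReal
noncomputable section

abbrev SL2C := Matrix.SpecialLinearGroup (Fin 2) ℂ
noncomputable instance : TopologicalSpace SL2C := instTopologicalSpaceSubtype
abbrev PSL2C := SL2C ⧸ Subgroup.center SL2C

/-- The Riemann sphere, as a type synonym for the one-point extension of `ℂ`,
equipped with (a bi-Lipschitz copy of) the chordal metric via stereographic embedding. -/
def RSphere : Type := OnePoint ℂ

namespace RSphere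

def infty : RSphere := OnePoint.infty
def ofC (z : ℂ) : RSphere := (z : OnePoint ℂ)
instance : Coe ℂ RSphere := ⟨ofC⟩

/-- Stereographic/chordal embedding of the Riemann sphere into `ℂ × ℝ`. -/
def chordalEmbed : RSphere → ℂ × ℝ := fun z =>
  OnePoint.rec ((0 : ℂ), (1 : ℝ))
    (fun w => (2 * w / (1 + ‖w‖ ^ 2), (‖w‖ ^ 2 - 1) / (‖w‖ ^ 2 + 1))) (z : OnePoint ℂ)

lemma chordalEmbed_injective : Function.Injective chordalEmbed := by
  have key : ∀ z w : ℂ, chordalEmbed (ofC z) = chordalEmbed (ofC w) → z = w := by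
    intro z w h
    have hz : (0:ℝ) < 1 + ‖z‖ ^ 2 := by positivity
    have hw : (0:ℝ) < 1 + ‖w‖ ^ 2 := by positivity
    have h1 : 2 * z / (1 + ‖z‖ ^ 2) = 2 * w / (1 + ‖w‖ ^ 2) := congrArg Prod.fst h
    have h2 : (‖z‖ ^ 2 - 1) / (‖z‖ ^ 2 + 1) = (‖w‖ ^ 2 - 1) / (‖w‖ ^ 2 + 1) := congrArg Prod.snd h
    have hnorm : ‖z‖ ^ 2 = ‖w‖ ^ 2 := by
      rw [div_eq_div_iff (by positivity) (by positivity)] at h2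
      nlinarith [h2]
    have hn : ‖z‖ = ‖w‖ := by nlinarith [norm_nonneg z, norm_nonneg w]
    rw [hn] at h1
    have hden : ((1:ℂ) + (‖w‖:ℂ) ^ 2) ≠ 0 := by
      intro hc
      have hre : (1:ℝ) + ‖w‖ ^ 2 = 0 := by exact_mod_cast hc
      nlinarith [norm_nonneg w]
    rw [div_eq_div_iff hden hden] at h1
    have h1' : (2:ℂ) * z = 2 * w := mul_right_cancel₀ hden h1
    exact mul_left_cancel₀ two_ne_zero h1'
  intro a b h
  induction a using OnePoint.rec with
  | infty =>
    induction b using OnePoint.rec with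
    | infty => rfl
    | coe w =>
      exfalso
      have h2 : (1:ℝ) = (‖w‖ ^ 2 - 1) / (‖w‖ ^ 2 + 1) := congrArg Prod.snd h
      have hw : (0:ℝ) < ‖w‖ ^ 2 + 1 := by positivity
      rw [eq_div_iff (ne_of_gt hw)] at h2
      nlinarith
  | coe z =>
    induction b using OnePoint.rec with
    | infty =>
      exfalso
      have h2 : (‖z‖ ^ 2 - 1) / (‖z‖ ^ 2 + 1) = (1:ℝ) := congrArg Prod.snd h
      have hz : (0:ℝ) < ‖z‖ ^ 2 + 1 := by positivity
      rw [div_eq_iff (ne_of_gt hz)] at h2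
      nlinarith
    | coe w => exact congrArg ofC (key z w h)

instance : MetricSpace RSphere := MetricSpace.induced chordalEmbed chordalEmbed_injective inferInstance
instance : MeasurableSpace RSphere := borel RSphere
instance : BorelSpace RSphere := ⟨rfl⟩

end RSphere

open RSphere MeasureTheory

/-- The Möbius transformation of the Riemann sphere associated to a matrix in `SL(2,ℂ)`. -/
def mobius (g : SL2C) : RSphere → RSphere := fun z =>
  OnePoint.rec
    (if g.1 1 0 = 0 then RSphere.infty else RSphere.ofC (g.1 0 0 / g.1 1 0))
    (fun w => if g.1 1 0 * w + g.1 1 1 = 0 then RSphere.infty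
      else RSphere.ofC ((g.1 0 0 * w + g.1 0 1) / (g.1 1 0 * w + g.1 1 1)))
    (z : OnePoint ℂ)

/-- The orbit of a point of the Riemann sphere under a subgroup of `PSL(2,ℂ)`
(described via arbitrary lifts to `SL(2,ℂ)`). -/
def mobiusOrbit (Γ : Subgroup PSL2C) (z : RSphere) : Set RSphere :=
  {w | ∃ g : SL2C, (g : PSL2C) ∈ Γ ∧ mobius g z = w}

/-- The limit set of a subgroup of `PSL(2,ℂ)`: the set of accumulation points of orbits. -/
def limitSet (Γ : Subgroup PSL2C) : Set RSphere :=
  {w | ∃ z : RSphere, AccPt w (Filter.principal (mobiusOrbit Γ z))}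

/-- The Hausdorff dimension of the limit set. -/
noncomputable def limitDim (Γ : Subgroup PSL2C) : ℝ≥0∞ := dimH (limitSet Γ)

/-- A Kleinian group: a finitely generated discrete subgroup of `PSL(2,ℂ)`. -/
def IsKleinian (Γ : Subgroup PSL2C) : Prop :=
  DiscreteTopology Γ ∧ Subgroup.FG Γ

/-- A conical limit point (in the dynamical, Beardon–Maskit/Bowditch sense):
there are group elements `γ n` and distinct points `a ≠ b` with `γ n • x → a` while
`γ n • y → b` for every `y ≠ x`. -/
def IsConicalLimitPoint (Γ : Subgroup PSL2C) (x : RSphere) : Prop :=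
  ∃ (γ : ℕ → SL2C) (a b : RSphere), (∀ n, (γ n : PSL2C) ∈ Γ) ∧ a ≠ b ∧
    Filter.Tendsto (fun n => mobius (γ n) x) Filter.atTop (nhds a) ∧
    ∀ y : RSphere, y ≠ x → Filter.Tendsto (fun n => mobius (γ n) y) Filter.atTop (nhds b)

/-- Convex cocompactness of a Kleinian group, via the Beardon–Maskit/Bowditch
characterization: a Kleinian group is convex cocompact (equivalently, it acts
cocompactly on the convex hull of its limit set in `ℍ³`) iff every limit point
is a conical limit point. -/
def IsConvexCocompact (Γ : Subgroup PSL2C) : Prop :=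
  IsKleinian Γ ∧ ∀ x ∈ limitSet Γ, IsConicalLimitPoint Γ x

/-- The unit circle in `ℂ`. -/
def unitCircle : Set ℂ := Metric.sphere 0 1

/-- A Jordan curve on the Riemann sphere: a homeomorphic image of the unit circle. -/
def IsJordanCurve (C : Set RSphere) : Prop :=
  ∃ f : ℂ → RSphere, ContinuousOn f unitCircle ∧ Set.InjOn f unitCircle ∧ C = f '' unitCircle

/-- A round circle on the Riemann sphere: a Euclidean circle in `ℂ`, or a
Euclidean line together with `∞`. -/
def IsRoundCircle (C : Set RSphere) : Prop :=
  (∃ (c : ℂ) (r : ℝ), 0 < r ∧ C = RSphere.ofC '' Metric.sphere c r) ∨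
  (∃ a v : ℂ, v ≠ 0 ∧ C = insert RSphere.infty (RSphere.ofC '' {z | ∃ t : ℝ, z = a + t • v}))

/-- A loxodromic element of `SL(2,ℂ)`: the trace is not a real number of absolute value `≤ 2`. -/
def IsLoxodromic (g : SL2C) : Prop :=
  ∀ t : ℝ, Matrix.trace (g.1) = (t : ℂ) → 2 < |t|

/-- Schottky data of rank `g`: free generators `gen i` together with `2g` open topological
disks with disjoint closures and Jordan curve boundaries, such that `gen i` maps the
boundary of the `i`-th disk onto the boundary of the `(i+g)`-th disk and maps the `i`-th
disk off the `(i+g)`-th disk. -/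
structure SchottkyData (g : ℕ) where
  gen : Fin g → SL2C
  D : Fin g ⊕ Fin g → Set RSphere
  isOpen : ∀ i, IsOpen (D i)
  nonempty : ∀ i, (D i).Nonempty
  jordan : ∀ i, IsJordanCurve (frontier (D i))
  disjointClosures : ∀ i j, i ≠ j → closure (D i) ∩ closure (D j) = ∅
  lox : ∀ i, IsLoxodromic (gen i)
  maps_boundary : ∀ i : Fin g, mobius (gen i) '' frontier (D (Sum.inl i)) = frontier (D (Sum.inr i))
  maps_off : ∀ i : Fin g, (mobius (gen i) '' D (Sum.inl i)) ∩ D (Sum.inr i) = ∅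

namespace SchottkyData

/-- The subgroup of `PSL(2,ℂ)` generated by the Schottky data. -/
def group {g : ℕ} (S : SchottkyData g) : Subgroup PSL2C :=
  Subgroup.closure (Set.range fun i => ((S.gen i : PSL2C)))

/-- The generators generate freely. -/
def Free {g : ℕ} (S : SchottkyData g) : Prop :=
  Function.Injective ⇑(FreeGroup.lift (fun i : Fin g => ((S.gen i : PSL2C))))

/-- Classical Schottky data: all the boundary curves are round circles. -/
def IsClassical {g : ℕ} (S : SchottkyData g) : Prop :=
  ∀ i, IsRoundCircle (frontier (S.D i))

/-- The (Schottky) fundamental domain determined by the data: the complement of the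
closed disks. -/
def domain {g : ℕ} (S : SchottkyData g) : Set RSphere :=
  (⋃ i, closure (S.D i))ᶜ

/-- The boundary of the orbit of the fundamental domain. -/
def orbitBoundary {g : ℕ} (S : SchottkyData g) : Set RSphere :=
  ⋃ γ : {γ : SL2C // (γ : PSL2C) ∈ S.group}, mobius γ.1 '' (⋃ i, frontier (S.D i))

end SchottkyData

/-- `Γ` is a Schottky group of rank `g`. -/
def IsSchottkyOfRank (Γ : Subgroup PSL2C) (g : ℕ) : Prop :=
  ∃ S : SchottkyData g, S.group = Γ ∧ S.Free ∧ IsKleinian Γ ∧ IsConvexCocompact Γ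

/-- `Γ` is a Schottky group. -/
def IsSchottky (Γ : Subgroup PSL2C) : Prop := ∃ g, IsSchottkyOfRank Γ g

/-- `Γ` is a classical Schottky group of rank `g`: some Schottky data for `Γ` has all its
defining curves round circles. -/
def IsClassicalSchottkyOfRank (Γ : Subgroup PSL2C) (g : ℕ) : Prop :=
  ∃ S : SchottkyData g, S.group = Γ ∧ S.Free ∧ S.IsClassical ∧ IsKleinian Γ ∧ IsConvexCocompact Γ

/-- `Γ` is a classical Schottky group. -/
def IsClassicalSchottky (Γ : Subgroup PSL2C) : Prop := ∃ g, IsClassicalSchottkyOfRank Γ g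

/-- A quasi-circle of `Γ`: a `Γ`-invariant Jordan curve containing the limit set. -/
def IsQuasiCircle (Γ : Subgroup PSL2C) (η : Set RSphere) : Prop :=
  IsJordanCurve η ∧ limitSet Γ ⊆ η ∧
  ∀ g : SL2C, (g : PSL2C) ∈ Γ → mobius g '' η = η

/-- A rectifiable subset of the sphere: finite 1-dimensional Hausdorff measure. -/
def Rectifiable (η : Set RSphere) : Prop := μH[1] η < ⊤

/-! ### The space `ℛ(S¹, W)` of bounded-length closed curves meeting a compact set `W ⊆ ℂ` -/

/-- The unit circle as a topological space. -/
abbrev S1 := ↥(Metric.sphere (0 : ℂ) 1)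

/-- The standard parametrization of the unit circle. -/
noncomputable def circleParam (t : ℝ) : S1 :=
  ⟨circleMap 0 1 t, circleMap_mem_sphere 0 zero_le_one t⟩

/-- The length (total variation) of a closed curve `h : S¹ → ℂ`. -/
noncomputable def curveLength (h : C(S1, ℂ)) : ℝ≥0∞ :=
  eVariationOn (fun t => h (circleParam t)) (Set.Icc 0 (2 * Real.pi))

/-- An element of `ℛ(S¹, W)`: a continuous rectifiable (bounded-length) closed curve
in `ℂ` whose image meets `W`. -/
structure RCurve (W : Set ℂ) where
  toFun : C(S1, ℂ)
  meets : (Set.range toFun ∩ W).Nonempty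
  bddLength : curveLength toFun < ⊤

/-- The Fréchet distance on `ℛ(S¹, W)`:
`d_F(h₁,h₂) = inf {sup |h₁(σ₁ t) - h₂(σ₂ t)| : σ₁, σ₂ ∈ Homeo(S¹)} + |ℓ(h₁) - ℓ(h₂)|`. -/
noncomputable def frechetDist {W : Set ℂ} (h₁ h₂ : RCurve W) : ℝ :=
  (⨅ σ : (S1 ≃ₜ S1) × (S1 ≃ₜ S1), ⨆ t : S1, dist (h₁.toFun (σ.1 t)) (h₂.toFun (σ.2 t))) +
    |(curveLength h₁.toFun).toReal - (curveLength h₂.toFun).toReal|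

/-- The subset of the Riemann sphere traced out by a curve in `ℂ`. -/
def RCurve.carrier {W : Set ℂ} (h : RCurve W) : Set RSphere :=
  RSphere.ofC '' Set.range h.toFun

/-- The collection `E_Γ` of curves in `ℛ(S¹,W)` tracing bounded-length quasi-circles of `Γ`. -/
def ECurves (W : Set ℂ) (Γ : Subgroup PSL2C) : Set (RCurve W) :=
  {h | IsQuasiCircle Γ h.carrier}

/-- Closure of a set of curves with respect to the Fréchet distance. -/
def dClosure {W : Set ℂ} (A : Set (RCurve W)) : Set (RCurve W) :=
  {h | ∀ ε : ℝ, 0 < ε → ∃ a ∈ A, frechetDist h a < ε}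

/-- Boundary (frontier) of a set of curves with respect to the Fréchet distance. -/
def dFrontier {W : Set ℂ} (A : Set (RCurve W)) : Set (RCurve W) :=
  dClosure A ∩ dClosure Aᶜ

/-! ### Generating curves for quasi-circles -/

/-- `A` is a (possibly non-simple) continuous curve from `p` to `q`. -/
def IsCurveFromTo (A : Set RSphere) (p q : RSphere) : Prop :=
  ∃ f : ℝ → RSphere, ContinuousOn f (Set.Icc 0 1) ∧ f 0 = p ∧ f 1 = q ∧
    A = f '' Set.Icc 0 1

/-- `A` is an arc (a simple continuous curve) from `p` to `q`. -/
def IsArc (A : Set RSphere) (p q : RSphere) : Prop :=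
  ∃ f : ℝ → RSphere, ContinuousOn f (Set.Icc 0 1) ∧ Set.InjOn f (Set.Icc 0 1) ∧
    f 0 = p ∧ f 1 = q ∧ A = f '' Set.Icc 0 1

/-- A (possibly singular) generating curve for Schottky data `S`: for each `i` a
curve `conn i` joining a point `p i` of the `i`-th boundary curve to a point `q i` of the
`(i+g)`-th boundary curve, together with a curve `bnd i` on the `(i+g)`-th boundary curve
joining `q i` to the image `gen i ∙ p i`. -/
structure PreGenCurve {g : ℕ} (S : SchottkyData g) where
  conn : Fin g → Set RSphere
  bnd : Fin g → Set RSphere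
  p : Fin g → RSphere
  q : Fin g → RSphere
  p_mem : ∀ i, p i ∈ frontier (S.D (Sum.inl i))
  q_mem : ∀ i, q i ∈ frontier (S.D (Sum.inr i))
  conn_curve : ∀ i, IsCurveFromTo (conn i) (p i) (q i)
  bnd_curve : ∀ i, IsCurveFromTo (bnd i) (q i) (mobius (S.gen i) (p i))
  bnd_sub : ∀ i, bnd i ⊆ frontier (S.D (Sum.inr i))

namespace PreGenCurve

variable {g : ℕ} {S : SchottkyData g}

/-- The underlying set of a generating curve. -/
def carrier (ζ : PreGenCurve S) : Set RSphere := ⋃ i, (ζ.conn i ∪ ζ.bnd i)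

/-- A generating curve is simple if its constituent curves are disjoint arcs (meeting
only at the prescribed endpoints). -/
def IsSimple (ζ : PreGenCurve S) : Prop :=
  (∀ i, IsArc (ζ.conn i) (ζ.p i) (ζ.q i)) ∧
  (∀ i, IsArc (ζ.bnd i) (ζ.q i) (mobius (S.gen i) (ζ.p i))) ∧
  (∀ i, ζ.conn i ∩ ζ.bnd i = {ζ.q i}) ∧
  ∀ i j, i ≠ j → (ζ.conn i ∪ ζ.bnd i) ∩ (ζ.conn j ∪ ζ.bnd j) = ∅

end PreGenCurve

/-- The `Γ`-invariant closed set generated by a set `ζ`: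
`Λ_Γ ∪ ⋃_{γ ∈ Γ} γ(ζ)`. -/
def generatedBy (Γ : Subgroup PSL2C) (ζ : Set RSphere) : Set RSphere :=
  limitSet Γ ∪ ⋃ γ : {γ : SL2C // (γ : PSL2C) ∈ Γ}, mobius γ.1 '' ζ

/-- `η` is generated by a (simple) generating curve of `Γ`. -/
def IsGeneratedByGenCurve (Γ : Subgroup PSL2C) (η : Set RSphere) : Prop :=
  ∃ (g : ℕ) (S : SchottkyData g), S.group = Γ ∧
    ∃ ζ : PreGenCurve S, ζ.IsSimple ∧ generatedBy Γ ζ.carrier = η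

/-- A trivial singular curve: a closed curve generated by some non-simple generating curve. -/
def IsTrivialSingular (Γ : Subgroup PSL2C) (η : Set RSphere) : Prop :=
  ∃ (g : ℕ) (S : SchottkyData g), S.group = Γ ∧
    ∃ ζ : PreGenCurve S, ¬ζ.IsSimple ∧ generatedBy Γ ζ.carrier = η

/-- The set `Ψ_Γ` associated to a sequence `Γ_n → Γ`: the boundary of the closure of
`⋃ n, E_{Γ_n}` in `(ℛ(S¹,W), d_F)`, with the trivial singular curves removed. -/
def PsiSet (W : Set ℂ) (Γseq : ℕ → Subgroup PSL2C) (Γ : Subgroup PSL2C) : Set (RCurve W) :=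
  dFrontier (dClosure (⋃ n, ECurves W (Γseq n))) \ {h | IsTrivialSingular Γ h.carrier}

/-! ### Linear and transverse quasi-circles -/

/-- A linear quasi-circle: off the limit set, the curve consists of points and
circular/linear arcs (each connected component of `η \ Λ_Γ` lies on a round circle). -/
def IsLinearQC (Γ : Subgroup PSL2C) (η : Set RSphere) : Prop :=
  IsQuasiCircle Γ η ∧
  ∀ x ∈ η \ limitSet Γ, ∃ C : Set RSphere, IsRoundCircle C ∧
    connectedComponentIn (η \ limitSet Γ) x ⊆ C

/-- Two subsets of the sphere meet orthogonally at a (finite) point `x`: there are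
differentiable local parametrizations of the two sets through `x` whose (nonzero) tangent
vectors are orthogonal. -/
def MeetsOrthogonallyAt (A B : Set RSphere) (x : RSphere) : Prop :=
  ∃ (z u v : ℂ) (f h : ℝ → ℂ), x = RSphere.ofC z ∧ u ≠ 0 ∧ v ≠ 0 ∧
    HasDerivAt f u 0 ∧ HasDerivAt h v 0 ∧ f 0 = z ∧ h 0 = z ∧
    (∀ᶠ t in nhds (0 : ℝ), RSphere.ofC (f t) ∈ A) ∧
    (∀ᶠ t in nhds (0 : ℝ), RSphere.ofC (h t) ∈ B) ∧
    (u * (starRingEnd ℂ) v).re = 0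

/-- A transverse quasi-circle: it meets the boundary of the orbit of some fundamental
domain orthogonally, and contains no parallel arc (no nondegenerate arc inside that
boundary). -/
def IsTransverseQC (Γ : Subgroup PSL2C) (η : Set RSphere) : Prop :=
  IsQuasiCircle Γ η ∧
  ∃ (g : ℕ) (S : SchottkyData g), S.group = Γ ∧
    (∀ x ∈ η ∩ S.orbitBoundary, MeetsOrthogonallyAt η S.orbitBoundary x) ∧
    ¬∃ (A : Set RSphere) (p q : RSphere), p ≠ q ∧ IsArc A p q ∧ A ⊆ η ∩ S.orbitBoundary

/-! ### Good sequences -/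

/-- A good sequence of quasi-circles for `Γ_n → Γ`: quasi-circles `η_n` of `Γ_n`
converging in the Fréchet metric to a quasi-circle `η_∞` of `Γ`. -/
def IsGoodSequence {W : Set ℂ} (Γseq : ℕ → Subgroup PSL2C) (Γ : Subgroup PSL2C)
    (hn : ℕ → RCurve W) (h : RCurve W) : Prop :=
  (∀ n, IsQuasiCircle (Γseq n) (hn n).carrier) ∧
  Filter.Tendsto (fun n => frechetDist (hn n) h) Filter.atTop (nhds 0) ∧
  IsQuasiCircle Γ h.carrier

/-! ### Quasiconformal maps -/

/-- A quasiconformal homeomorphism of the Riemann sphere (metric definition: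
uniformly bounded circular distortion). -/
def IsQuasiconformal (f : RSphere ≃ₜ RSphere) : Prop :=
  ∃ K : ℝ, ∀ x : RSphere,
    Filter.limsup (fun r : ℝ =>
        (⨆ y ∈ Metric.sphere x r, dist (f x) (f y)) /
          (⨅ y ∈ Metric.sphere x r, dist (f x) (f y)))
      (nhdsWithin 0 (Set.Ioi 0)) ≤ K

/-- `f` conjugates the subgroup `Γ` of `PSL(2,ℂ)` onto the subgroup `Γ'`, i.e.
`Γ' = f Γ f⁻¹` as groups of transformations of the sphere. -/
def ConjugatesBy (f : RSphere ≃ₜ RSphere) (Γ Γ' : Subgroup PSL2C) : Prop :=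
  (∀ g : SL2C, (g : PSL2C) ∈ Γ → ∃ g' : SL2C, (g' : PSL2C) ∈ Γ' ∧
    ∀ z : RSphere, mobius g' (f z) = f (mobius g z)) ∧
  (∀ g' : SL2C, (g' : PSL2C) ∈ Γ' → ∃ g : SL2C, (g : PSL2C) ∈ Γ ∧
    ∀ z : RSphere, mobius g' (f z) = f (mobius g z))

/-! ### Schottky space -/

/-- The subgroup generated by a tuple in `PSL(2,ℂ)`. -/
def tupleGroup {g : ℕ} (γ : Fin g → PSL2C) : Subgroup PSL2C :=
  Subgroup.closure (Set.range γ)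

/-- The subgroup generated by a tuple of matrices in `SL(2,ℂ)`. -/
def groupOfGens {g : ℕ} (γ : Fin g → SL2C) : Subgroup PSL2C :=
  Subgroup.closure (Set.range fun i => ((γ i : PSL2C)))

/-- A marked rank-`g` Schottky group: a tuple of free Schottky generators in `PSL(2,ℂ)`. -/
abbrev MarkedSchottky (g : ℕ) :=
  {γ : Fin g → PSL2C // ∃ S : SchottkyData g, (∀ i, ((S.gen i : PSL2C)) = γ i) ∧
    S.Free ∧ IsKleinian S.group ∧ IsConvexCocompact S.group}

/-- Conjugacy of marked Schottky groups. -/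
def schottkyRel (g : ℕ) : Setoid (MarkedSchottky g) where
  r a b := ∃ h : PSL2C, ∀ i, b.1 i = h * a.1 i * h⁻¹
  iseqv := by
    refine ⟨fun a => ⟨1, fun i => by simp⟩, ?_, ?_⟩
    · rintro a b ⟨h, e⟩
      exact ⟨h⁻¹, fun i => by rw [e i]; group⟩
    · rintro a b c ⟨h, e⟩ ⟨h', e'⟩
      exact ⟨h' * h, fun i => by rw [e' i, e i]; group⟩

/-- The rank-`g` Schottky space `𝔍_g`: marked rank-`g` Schottky groups up to conjugacy in
`PSL(2,ℂ)`, with the quotient topology. -/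
def SchottkySpace (g : ℕ) : Type := Quotient (schottkyRel g)

instance (g : ℕ) : TopologicalSpace (SchottkySpace g) := by
  unfold SchottkySpace; infer_instance

namespace SchottkySpace

/-- The Hausdorff dimension of (the limit set of) a point of Schottky space. -/
noncomputable def dim {g : ℕ} (x : SchottkySpace g) : ℝ≥0∞ :=
  ⨅ γ : {γ : MarkedSchottky g // Quotient.mk (schottkyRel g) γ = x},
    limitDim (tupleGroup γ.1.1)

/-- The open subset `𝔍_g¹` of Schottky space: points of Hausdorff dimension `< 1`. -/
def J1 (g : ℕ) : Set (SchottkySpace g) := {x | dim x < 1}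

/-- The subset `𝔍_{g,o}` of classical Schottky groups in Schottky space. -/
def classicalLocus (g : ℕ) : Set (SchottkySpace g) :=
  {x | ∃ γ : MarkedSchottky g, Quotient.mk (schottkyRel g) γ = x ∧
    IsClassicalSchottky (tupleGroup γ.1)}

end SchottkySpace

/-- An `SL(2,ℂ)`-level tuple of free Schottky generators. -/
def IsSchottkyTuple {g : ℕ} (γ : Fin g → SL2C) : Prop :=
  ∃ S : SchottkyData g, S.gen = γ ∧ S.Free ∧ IsKleinian S.group ∧ IsConvexCocompact S.group


section
open Filter Set Topology RSphere MeasureTheory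
open scoped ENNReal NNReal
noncomputable section
namespace QC

/-! ### M1: Moebius maps and the chordal metric -/

lemma le_of_sq' {a b : ℝ} (h : a ^ 2 ≤ b ^ 2) (hb : 0 ≤ b) : a ≤ b := by
  by_contra hc
  push Not at hc
  nlinarith

/-- denominator of a Moebius map -/
def den (g : SL2C) (z : ℂ) : ℂ := g.1 1 0 * z + g.1 1 1
/-- Moebius map on the plane (junk at the pole) -/
def mob (g : SL2C) (z : ℂ) : ℂ := (g.1 0 0 * z + g.1 0 1) / den g z

lemma det_eq (g : SL2C) : g.1 0 0 * g.1 1 1 - g.1 0 1 * g.1 1 0 = 1 := by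
  have := g.2; rwa [Matrix.det_fin_two] at this

lemma mobius_ofC (g : SL2C) (z : ℂ) :
    mobius g (ofC z) = if den g z = 0 then infty else ofC (mob g z) := rfl

lemma mobius_ofC_of_ne (g : SL2C) (z : ℂ) (h : den g z ≠ 0) :
    mobius g (ofC z) = ofC (mob g z) := by rw [mobius_ofC, if_neg h]

lemma mobius_infty (g : SL2C) :
    mobius g infty = if g.1 1 0 = 0 then infty else ofC (g.1 0 0 / g.1 1 0) := rfl

/-- homogeneous coordinates -/
def toSph (u v : ℂ) : RSphere := if v = 0 then infty else ofC (u / v)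

lemma ofC_eq_toSph (z : ℂ) : ofC z = toSph z 1 := by simp [toSph]
lemma infty_eq_toSph : infty = toSph 1 0 := by simp [toSph]

lemma sph_cases (x : RSphere) : x = infty ∨ ∃ z, x = ofC z := by
  induction x using OnePoint.rec with
  | infty => left; rfl
  | coe z => right; exact ⟨z, rfl⟩

lemma exists_toSph (x : RSphere) : ∃ u v : ℂ, (u ≠ 0 ∨ v ≠ 0) ∧ x = toSph u v := by
  rcases sph_cases x with rfl | ⟨z, rfl⟩
  · exact ⟨1, 0, by simp, infty_eq_toSph⟩
  · exact ⟨z, 1, by simp, ofC_eq_toSph z⟩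

lemma ofC_injective : Function.Injective ofC := fun a b h => by
  have : (a : OnePoint ℂ) = (b : OnePoint ℂ) := h
  exact OnePoint.coe_injective this

lemma ofC_ne_infty (z : ℂ) : ofC z ≠ infty := fun h => OnePoint.coe_ne_infty z h

lemma mat_nondeg (g : SL2C) {u v : ℂ} (h : u ≠ 0 ∨ v ≠ 0) :
    (g.1 0 0 * u + g.1 0 1 * v ≠ 0) ∨ (g.1 1 0 * u + g.1 1 1 * v ≠ 0) := by
  by_contra hc
  push Not at hc
  obtain ⟨h1, h2⟩ := hc
  have hd := det_eq g
  have hu : u = 0 := by linear_combination g.1 1 1 * h1 - g.1 0 1 * h2 - u * hd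
  have hv : v = 0 := by linear_combination g.1 0 0 * h2 - g.1 1 0 * h1 - v * hd
  tauto

lemma mobius_toSph (g : SL2C) {u v : ℂ} (h : u ≠ 0 ∨ v ≠ 0) :
    mobius g (toSph u v) = toSph (g.1 0 0 * u + g.1 0 1 * v) (g.1 1 0 * u + g.1 1 1 * v) := by
  by_cases hv : v = 0
  · subst hv
    have hu : u ≠ 0 := by simpa using h
    simp only [toSph, if_true, mobius_infty, mul_zero, add_zero, mul_eq_zero, hu, or_false]
    split_ifs
    · rfl
    · congr 1; field_simp
  · have e : g.1 1 0 * u + g.1 1 1 * v = den g (u / v) * v := by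
      unfold den; field_simp
    simp only [toSph, hv, if_false, mobius_ofC, e, mul_eq_zero, or_false]
    split_ifs with h1
    · rfl
    · congr 1; unfold mob; field_simp

lemma mobius_mul (g h : SL2C) (x : RSphere) : mobius (g * h) x = mobius g (mobius h x) := by
  obtain ⟨u, v, huv, rfl⟩ := exists_toSph x
  rw [mobius_toSph _ huv, mobius_toSph _ huv, mobius_toSph _ (mat_nondeg h huv)]
  have : ∀ i j, (g * h).1 i j = g.1 i 0 * h.1 0 j + g.1 i 1 * h.1 1 j := by
    intro i j
    rw [show (g * h).1 = g.1 * h.1 from rfl, Matrix.mul_apply, Fin.sum_univ_two]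
  simp only [this]
  congr 1 <;> ring

lemma mul_entry (g h : SL2C) (i j) : (g * h).1 i j = g.1 i 0 * h.1 0 j + g.1 i 1 * h.1 1 j := by
  rw [show (g * h).1 = g.1 * h.1 from rfl, Matrix.mul_apply, Fin.sum_univ_two]

lemma one_entry (i j) : (1 : SL2C).1 i j = if i = j then 1 else 0 := by
  rw [show (1 : SL2C).1 = 1 from rfl, Matrix.one_apply]

lemma mobius_one (x : RSphere) : mobius 1 x = x := by
  obtain ⟨u, v, huv, rfl⟩ := exists_toSph x
  rw [mobius_toSph _ huv]
  simp [one_entry]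

lemma inv_entries (g : SL2C) : (g⁻¹).1 0 0 = g.1 1 1 ∧ (g⁻¹).1 0 1 = - g.1 0 1 ∧
    (g⁻¹).1 1 0 = - g.1 1 0 ∧ (g⁻¹).1 1 1 = g.1 0 0 := by
  have h : (g⁻¹).1 = Matrix.adjugate g.1 := by
    exact Matrix.SpecialLinearGroup.coe_inv g
  rw [h, Matrix.adjugate_fin_two]
  simp

lemma mobius_inv_apply (g : SL2C) (x : RSphere) : mobius g⁻¹ (mobius g x) = x := by
  rw [← mobius_mul, inv_mul_cancel, mobius_one]
lemma mobius_apply_inv (g : SL2C) (x : RSphere) : mobius g (mobius g⁻¹ x) = x := by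
  rw [← mobius_mul, mul_inv_cancel, mobius_one]

lemma mobius_injective (g : SL2C) : Function.Injective (mobius g) :=
  Function.LeftInverse.injective (mobius_inv_apply g)

lemma mobius_center {g : SL2C} (hg : g ∈ Subgroup.center SL2C) (x : RSphere) : mobius g x = x := by
  rw [Matrix.SpecialLinearGroup.mem_center_iff] at hg
  obtain ⟨r, hr, h⟩ := hg
  obtain ⟨u, v, huv, rfl⟩ := exists_toSph x
  rw [mobius_toSph _ huv]
  have hr0 : r ≠ 0 := by rintro rfl; simp at hr
  have e : ∀ i j, g.1 i j = if i = j then r else 0 := by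
    intro i j; rw [← h]; simp [Matrix.scalar_apply, Matrix.diagonal_apply]
  simp only [e]
  simp only [toSph]
  simp [hr0]
  split_ifs
  · rfl
  · congr 1; field_simp

lemma mobius_congr {g h : SL2C} (e : (g : PSL2C) = (h : PSL2C)) (x : RSphere) :
    mobius g x = mobius h x := by
  have : g⁻¹ * h ∈ Subgroup.center SL2C := QuotientGroup.eq.1 e
  have h2 := mobius_center this x
  rw [mobius_mul] at h2
  have h3 := congrArg (mobius g) h2
  rw [mobius_apply_inv] at h3
  exact h3.symm

/-- squared euclidean chordal distance -/
def q (x y : RSphere) : ℝ := ‖(chordalEmbed x).1 - (chordalEmbed y).1‖ ^ 2 +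
  ((chordalEmbed x).2 - (chordalEmbed y).2) ^ 2

lemma dist_sq_le_q (x y : RSphere) : dist x y ^ 2 ≤ q x y := by
  have h : dist x y = max (dist (chordalEmbed x).1 (chordalEmbed y).1)
    (dist (chordalEmbed x).2 (chordalEmbed y).2) := rfl
  rw [h, dist_eq_norm, Real.dist_eq]
  unfold q
  rcases max_choice ‖(chordalEmbed x).1 - (chordalEmbed y).1‖
    |(chordalEmbed x).2 - (chordalEmbed y).2| with h | h <;> rw [h]
  · nlinarith [sq_nonneg ((chordalEmbed x).2 - (chordalEmbed y).2)]
  · rw [sq_abs]; nlinarith [sq_nonneg ‖(chordalEmbed x).1 - (chordalEmbed y).1‖]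

lemma q_le_dist_sq (x y : RSphere) : q x y ≤ 2 * dist x y ^ 2 := by
  have h : dist x y = max (dist (chordalEmbed x).1 (chordalEmbed y).1)
    (dist (chordalEmbed x).2 (chordalEmbed y).2) := rfl
  rw [dist_eq_norm, Real.dist_eq] at h
  have h1 : ‖(chordalEmbed x).1 - (chordalEmbed y).1‖ ≤ dist x y := h ▸ le_max_left _ _
  have h2 : |(chordalEmbed x).2 - (chordalEmbed y).2| ≤ dist x y := h ▸ le_max_right _ _
  have h3 : ‖(chordalEmbed x).1 - (chordalEmbed y).1‖ ^ 2 ≤ dist x y ^ 2 := by gcongr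
  have h4 : |(chordalEmbed x).2 - (chordalEmbed y).2| ^ 2 ≤ dist x y ^ 2 := by gcongr
  rw [sq_abs] at h4
  unfold q; linarith

lemma chordal_ofC (z : ℂ) : chordalEmbed (ofC z) =
    (2 * z / (1 + ‖z‖ ^ 2), (‖z‖ ^ 2 - 1) / (‖z‖ ^ 2 + 1)) := rfl
lemma chordal_infty : chordalEmbed infty = (0, 1) := rfl

lemma q_ofC (z w : ℂ) : q (ofC z) (ofC w) = 4 * ‖z - w‖ ^ 2 / ((1 + ‖z‖ ^ 2) * (1 + ‖w‖ ^ 2)) := by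
  unfold q
  rw [chordal_ofC, chordal_ofC]
  have hz : (1 + ‖z‖ ^ 2 : ℝ) ≠ 0 := by positivity
  have hw : (1 + ‖w‖ ^ 2 : ℝ) ≠ 0 := by positivity
  have hzc : (1 + (‖z‖:ℂ) ^ 2) = ((1 + ‖z‖ ^ 2 : ℝ) : ℂ) := by push_cast; ring
  have hwc : (1 + (‖w‖:ℂ) ^ 2) = ((1 + ‖w‖ ^ 2 : ℝ) : ℂ) := by push_cast; ring
  simp only [hzc, hwc]
  have e : 2 * z / ((1 + ‖z‖ ^ 2 : ℝ) : ℂ) - 2 * w / ((1 + ‖w‖ ^ 2 : ℝ) : ℂ) =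
     (((2 / (1 + ‖z‖ ^ 2) : ℝ) : ℂ) * z - ((2 / (1 + ‖w‖ ^ 2) : ℝ) : ℂ) * w) := by
    push_cast; ring
  rw [e]
  set a := (1 + ‖z‖ ^ 2 : ℝ) with ha
  set b := (1 + ‖w‖ ^ 2 : ℝ) with hb
  have hz2 : ‖z‖ ^ 2 = a - 1 := by rw [ha]; ring
  have hw2 : ‖w‖ ^ 2 = b - 1 := by rw [hb]; ring
  rw [hz2, hw2]
  rw [← Complex.normSq_eq_norm_sq, ← Complex.normSq_eq_norm_sq] at *
  have hz3 : z.re * z.re + z.im * z.im = a - 1 := hz2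
  have hw3 : w.re * w.re + w.im * w.im = b - 1 := hw2
  clear_value a b
  simp only [Complex.normSq_apply, Complex.sub_re, Complex.sub_im, Complex.re_ofReal_mul,
    Complex.im_ofReal_mul]
  have e1 : a - 1 + 1 = a := by ring
  have e2 : b - 1 + 1 = b := by ring
  rw [e1, e2]
  field_simp
  linear_combination (4 * (b^2 - a * b)) * hz3 + (4 * (a ^ 2 - a * b)) * hw3

lemma q_infty (z : ℂ) : q (ofC z) infty = 4 / (1 + ‖z‖ ^ 2) := by
  unfold q
  rw [chordal_ofC, chordal_infty]
  have hz : (0:ℝ) < 1 + ‖z‖ ^ 2 := by positivity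
  have hzc : (1 + (‖z‖:ℂ) ^ 2) = ((1 + ‖z‖ ^ 2 : ℝ) : ℂ) := by push_cast; ring
  simp only [hzc, sub_zero, norm_div, norm_mul, Complex.norm_real, Real.norm_of_nonneg hz.le]
  rw [add_comm (‖z‖ ^ 2) 1]
  have : ‖(2:ℂ)‖ = 2 := by simp
  rw [this]
  field_simp
  ring

lemma q_comm (x y : RSphere) : q x y = q y x := by
  unfold q; rw [norm_sub_rev]; ring

lemma q_self (x : RSphere) : q x x = 0 := by simp [q]

lemma q_toSph {u v s t : ℂ} (h : u ≠ 0 ∨ v ≠ 0) (h' : s ≠ 0 ∨ t ≠ 0) :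
    q (toSph u v) (toSph s t) =
      4 * ‖u * t - v * s‖ ^ 2 / ((‖u‖ ^ 2 + ‖v‖ ^ 2) * (‖s‖ ^ 2 + ‖t‖ ^ 2)) := by
  unfold toSph
  by_cases hv : v = 0 <;> by_cases ht : t = 0
  · simp [hv, ht, q_self]
  · subst hv
    have hu : u ≠ 0 := by simpa using h
    have := norm_pos_iff.2 hu
    have := norm_pos_iff.2 ht
    rw [if_pos rfl, if_neg ht, q_comm, q_infty]
    simp only [norm_div, norm_mul, norm_zero, zero_mul, sub_zero]
    field_simp
    ring
  · subst ht
    have hs : s ≠ 0 := by simpa using h'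
    have := norm_pos_iff.2 hs
    have := norm_pos_iff.2 hv
    rw [if_pos rfl, if_neg hv, q_infty]
    simp only [norm_div, norm_mul, norm_zero, mul_zero, zero_sub, norm_neg]
    field_simp
    ring
  · have := norm_pos_iff.2 ht
    have := norm_pos_iff.2 hv
    rw [if_neg hv, if_neg ht, q_ofC, div_sub_div _ _ hv ht]
    simp only [norm_div, norm_mul]
    field_simp
    ring

/-- size of a matrix -/
def msz (g : SL2C) : ℝ := ‖g.1 0 0‖ + ‖g.1 0 1‖ + ‖g.1 1 0‖ + ‖g.1 1 1‖

lemma msz_nonneg (g : SL2C) : 0 ≤ msz g := by unfold msz; positivity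

lemma sq_norm_le (g : SL2C) (u v : ℂ) :
    ‖g.1 0 0 * u + g.1 0 1 * v‖ ^ 2 + ‖g.1 1 0 * u + g.1 1 1 * v‖ ^ 2 ≤
      4 * msz g ^ 2 * (‖u‖ ^ 2 + ‖v‖ ^ 2) := by
  have k : ∀ a b : ℂ, ‖a‖ ≤ msz g → ‖b‖ ≤ msz g →
      ‖a * u + b * v‖ ^ 2 ≤ 2 * msz g ^ 2 * (‖u‖ ^ 2 + ‖v‖ ^ 2) := by
    intro a b ha hb
    have h1 : ‖a * u + b * v‖ ≤ msz g * (‖u‖ + ‖v‖) := by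
      refine (norm_add_le _ _).trans ?_
      rw [norm_mul, norm_mul, mul_add]; gcongr
    have h2 : ‖a * u + b * v‖ ^ 2 ≤ (msz g * (‖u‖ + ‖v‖)) ^ 2 := by gcongr
    refine h2.trans ?_
    nlinarith [mul_nonneg (sq_nonneg (msz g)) (sq_nonneg (‖u‖ - ‖v‖))]
  have h1 := k (g.1 0 0) (g.1 0 1) (by unfold msz; linarith [norm_nonneg (g.1 0 1), norm_nonneg (g.1 1 0), norm_nonneg (g.1 1 1)])
    (by unfold msz; linarith [norm_nonneg (g.1 0 0), norm_nonneg (g.1 1 0), norm_nonneg (g.1 1 1)])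
  have h2 := k (g.1 1 0) (g.1 1 1) (by unfold msz; linarith [norm_nonneg (g.1 0 1), norm_nonneg (g.1 0 0), norm_nonneg (g.1 1 1)])
    (by unfold msz; linarith [norm_nonneg (g.1 0 0), norm_nonneg (g.1 1 0), norm_nonneg (g.1 0 1)])
  linarith

lemma le_sq_norm (g : SL2C) (u v : ℂ) : ‖u‖ ^ 2 + ‖v‖ ^ 2 ≤
    4 * msz g⁻¹ ^ 2 * (‖g.1 0 0 * u + g.1 0 1 * v‖ ^ 2 + ‖g.1 1 0 * u + g.1 1 1 * v‖ ^ 2) := by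
  have h := sq_norm_le g⁻¹ (g.1 0 0 * u + g.1 0 1 * v) (g.1 1 0 * u + g.1 1 1 * v)
  obtain ⟨e1, e2, e3, e4⟩ := inv_entries g
  rw [e1, e2, e3, e4] at h
  have hd := det_eq g
  have hu : g.1 1 1 * (g.1 0 0 * u + g.1 0 1 * v) + -g.1 0 1 * (g.1 1 0 * u + g.1 1 1 * v) = u := by
    linear_combination u * hd
  have hv : -g.1 1 0 * (g.1 0 0 * u + g.1 0 1 * v) + g.1 0 0 * (g.1 1 0 * u + g.1 1 1 * v) = v := by
    linear_combination v * hd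
  rwa [hu, hv] at h

lemma sq_pos_of {u v : ℂ} (h : u ≠ 0 ∨ v ≠ 0) : 0 < ‖u‖ ^ 2 + ‖v‖ ^ 2 := by
  rcases h with h | h
  · have := norm_pos_iff.2 h; positivity
  · have := norm_pos_iff.2 h; positivity

lemma q_mobius_le (g : SL2C) (x y : RSphere) :
    q (mobius g x) (mobius g y) ≤ (4 * msz g⁻¹ ^ 2) ^ 2 * q x y := by
  obtain ⟨u, v, h, rfl⟩ := exists_toSph x
  obtain ⟨s, t, h', rfl⟩ := exists_toSph y
  rw [mobius_toSph _ h, mobius_toSph _ h', q_toSph h h', q_toSph (mat_nondeg g h) (mat_nondeg g h')]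
  have hd := det_eq g
  have e : (g.1 0 0 * u + g.1 0 1 * v) * (g.1 1 0 * s + g.1 1 1 * t) -
      (g.1 1 0 * u + g.1 1 1 * v) * (g.1 0 0 * s + g.1 0 1 * t) = u * t - v * s := by
    linear_combination (u * t - v * s) * hd
  rw [e]
  have p1 := sq_pos_of h
  have p2 := sq_pos_of h'
  have p3 := sq_pos_of (mat_nondeg g h)
  have p4 := sq_pos_of (mat_nondeg g h')
  have l1 := le_sq_norm g u v
  have l2 := le_sq_norm g s t
  rw [← mul_div_assoc, div_le_div_iff₀ (by positivity) (by positivity)]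
  have := mul_le_mul l1 l2 p2.le (by positivity)
  have n0 : 0 ≤ 4 * ‖u * t - v * s‖ ^ 2 := by positivity
  calc _ ≤ 4 * ‖u * t - v * s‖ ^ 2 * _ := mul_le_mul_of_nonneg_left this n0
    _ = _ := by ring

lemma lipschitz_mobius (g : SL2C) : ∃ K : ℝ≥0, LipschitzWith K (mobius g) := by
  refine ⟨⟨2 * (4 * msz g⁻¹ ^ 2), by positivity⟩, LipschitzWith.of_dist_le_mul fun x y => ?_⟩
  have h1 := dist_sq_le_q (mobius g x) (mobius g y)
  have h2 := q_mobius_le g x y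
  have h3 := q_le_dist_sq x y
  apply le_of_sq' _ (mul_nonneg (NNReal.coe_nonneg _) dist_nonneg)
  calc dist (mobius g x) (mobius g y) ^ 2 ≤ (4 * msz g⁻¹ ^ 2) ^ 2 * (2 * dist x y ^ 2) := by
        refine h1.trans (h2.trans ?_); gcongr
    _ ≤ _ := by
        show _ ≤ (2 * (4 * msz g⁻¹ ^ 2) * dist x y) ^ 2
        nlinarith [mul_nonneg (sq_nonneg (4 * msz g⁻¹ ^ 2)) (sq_nonneg (dist x y))]

lemma continuous_mobius (g : SL2C) : Continuous (mobius g) := by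
  obtain ⟨K, h⟩ := lipschitz_mobius g; exact h.continuous

/-- Moebius maps as homeomorphisms -/
def mobiusHomeo (g : SL2C) : RSphere ≃ₜ RSphere where
  toFun := mobius g
  invFun := mobius g⁻¹
  left_inv := mobius_inv_apply g
  right_inv := mobius_apply_inv g
  continuous_toFun := continuous_mobius g
  continuous_invFun := continuous_mobius g⁻¹

lemma lipschitz_ofC : LipschitzWith 2 ofC := by
  refine LipschitzWith.of_dist_le_mul fun z w => ?_
  have h1 := dist_sq_le_q (ofC z) (ofC w)
  rw [q_ofC] at h1
  apply le_of_sq' _ (by positivity)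
  refine h1.trans ?_
  rw [div_le_iff₀ (by positivity), dist_eq_norm]
  show _ ≤ (2 * ‖z - w‖) ^ 2 * _
  have : 1 ≤ (1 + ‖z‖ ^ 2) * (1 + ‖w‖ ^ 2) := by
    nlinarith [sq_nonneg ‖z‖, sq_nonneg ‖w‖, mul_nonneg (sq_nonneg ‖z‖) (sq_nonneg ‖w‖)]
  nlinarith [mul_nonneg (sq_nonneg ‖z - w‖) (sub_nonneg.2 this)]

lemma continuous_ofC : Continuous ofC := lipschitz_ofC.continuous

/-- the finite part of a point of the sphere -/
def toC (x : RSphere) : ℂ := Option.getD (α := ℂ) x 0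
lemma toC_ofC (z : ℂ) : toC (ofC z) = z := rfl
lemma ofC_toC {x : RSphere} (h : x ≠ infty) : ofC (toC x) = x := by
  rcases sph_cases x with rfl | ⟨z, rfl⟩
  · exact absurd rfl h
  · rfl

lemma dist_le_dist_ofC {R : ℝ} {z w : ℂ} (hz : ‖z‖ ≤ R) (hw : ‖w‖ ≤ R) :
    dist z w ≤ (1 + R ^ 2) * dist (ofC z) (ofC w) := by
  have h := q_le_dist_sq (ofC z) (ofC w)
  rw [q_ofC, div_le_iff₀ (by positivity)] at h
  have hR : 0 ≤ R := (norm_nonneg z).trans hz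
  apply le_of_sq' _ (by positivity)
  have h1 : ‖z‖ ^ 2 ≤ R ^ 2 := by gcongr
  have h2 : ‖w‖ ^ 2 ≤ R ^ 2 := by gcongr
  have h3 : (1 + ‖z‖ ^ 2) * (1 + ‖w‖ ^ 2) ≤ (1 + R ^ 2) * (1 + R ^ 2) := by gcongr
  rw [dist_eq_norm]
  have h4 := mul_le_mul_of_nonneg_left h3 (sq_nonneg (dist (ofC z) (ofC w)))
  nlinarith [sq_nonneg ‖z - w‖, mul_nonneg (sq_nonneg (dist (ofC z) (ofC w))) (sq_nonneg (1 + R^2))]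

lemma lipschitzOn_toC (R : ℝ) : ∃ K : ℝ≥0, LipschitzOnWith K toC (ofC '' Metric.closedBall 0 R) := by
  refine ⟨⟨1 + R ^ 2, by positivity⟩, LipschitzOnWith.of_dist_le_mul ?_⟩
  rintro _ ⟨z, hz, rfl⟩ _ ⟨w, hw, rfl⟩
  rw [toC_ofC, toC_ofC]
  exact dist_le_dist_ofC (by simpa using hz) (by simpa using hw)

end QC
end
end

section
open Filter Set Topology RSphere MeasureTheory
open scoped ENNReal NNReal
noncomputable section
namespace QC

lemma continuous_chordal : Continuous chordalEmbed := by
  have h : Isometry chordalEmbed := Isometry.of_dist_eq fun x y => rfl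
  exact h.continuous

lemma toC_eq (x : RSphere) :
    toC x = (chordalEmbed x).1 / ((1 - (chordalEmbed x).2 : ℝ) : ℂ) := by
  rcases sph_cases x with rfl | ⟨z, rfl⟩
  · rw [chordal_infty]; simp; rfl
  · rw [chordal_ofC, toC_ofC]
    have hz : (1 + ‖z‖ ^ 2 : ℝ) ≠ 0 := by positivity
    have hzc : (1 + (‖z‖:ℂ) ^ 2) = ((1 + ‖z‖ ^ 2 : ℝ) : ℂ) := by push_cast; ring
    have hzc' : ((1 + ‖z‖ ^ 2 : ℝ) : ℂ) ≠ 0 := by exact_mod_cast hz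
    have e : (1 - (‖z‖ ^ 2 - 1) / (‖z‖ ^ 2 + 1) : ℝ) = 2 / (1 + ‖z‖ ^ 2) := by
      have : (‖z‖ ^ 2 + 1 : ℝ) ≠ 0 := by positivity
      field_simp; ring
    simp only [hzc, e]
    rw [Complex.ofReal_div]
    field_simp
    simp

lemma snd_ne_one {x : RSphere} (h : x ≠ infty) : 1 - (chordalEmbed x).2 ≠ 0 := by
  rcases sph_cases x with rfl | ⟨z, rfl⟩
  · exact absurd rfl h
  · rw [chordal_ofC]
    have : (‖z‖ ^ 2 + 1 : ℝ) ≠ 0 := by positivity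
    have e : (1 - (‖z‖ ^ 2 - 1) / (‖z‖ ^ 2 + 1) : ℝ) = 2 / (‖z‖ ^ 2 + 1) := by
      field_simp; ring
    rw [e]; positivity

lemma continuousOn_toC : ContinuousOn toC {infty}ᶜ := by
  have : ContinuousOn (fun x => (chordalEmbed x).1 / ((1 - (chordalEmbed x).2 : ℝ) : ℂ)) {infty}ᶜ := by
    apply ContinuousOn.div
    · exact (continuous_fst.comp continuous_chordal).continuousOn
    · exact (Complex.continuous_ofReal.comp
        (continuous_const.sub (continuous_snd.comp continuous_chordal))).continuousOn
    · intro x hx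
      exact_mod_cast snd_ne_one hx
  exact this.congr fun x _ => toC_eq x

lemma isOpenMap_ofC : IsOpenMap ofC := by
  intro U hU
  have : ofC '' U = {infty}ᶜ ∩ toC ⁻¹' U := by
    ext x
    constructor
    · rintro ⟨z, hz, rfl⟩; exact ⟨ofC_ne_infty z, hz⟩
    · rintro ⟨h1, h2⟩; exact ⟨toC x, h2, ofC_toC h1⟩
  rw [this]
  exact continuousOn_toC.isOpen_inter_preimage isOpen_compl_singleton hU

lemma isOpenEmbedding_ofC : IsOpenEmbedding ofC :=
  IsOpenEmbedding.of_continuous_injective_isOpenMap continuous_ofC ofC_injective isOpenMap_ofC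

lemma nhds_infty {U : Set RSphere} (hU : U ∈ 𝓝 infty) : ∃ R : ℝ, 0 < R ∧ ∀ z : ℂ, R < ‖z‖ → ofC z ∈ U := by
  obtain ⟨ε, hε, h⟩ := Metric.mem_nhds_iff.1 hU
  refine ⟨2 / ε, by positivity, fun z hz => h ?_⟩
  rw [Metric.mem_ball]
  have h1 := dist_sq_le_q (ofC z) infty
  rw [q_infty] at h1
  have h0 : 0 < ‖z‖ := lt_trans (by positivity) hz
  by_contra hc
  push Not at hc
  have h2 : ε ^ 2 ≤ dist (ofC z) infty ^ 2 := by gcongr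
  have h3 := h2.trans h1
  rw [le_div_iff₀ (by positivity)] at h3
  rw [div_lt_iff₀ hε] at hz
  nlinarith [sq_nonneg ε]

lemma tendsto_ofC_infty : Tendsto ofC (cocompact ℂ) (𝓝 infty) := by
  intro U hU
  obtain ⟨R, hR, h⟩ := nhds_infty hU
  rw [mem_map, mem_cocompact]
  refine ⟨Metric.closedBall 0 R, isCompact_closedBall _ _, fun z hz => h z ?_⟩
  simpa using hz

lemma isCompact_preimage {K : Set RSphere} (hK : IsClosed K) (h : infty ∉ K) :
    IsCompact (ofC ⁻¹' K) := by
  obtain ⟨R, hR, h'⟩ := nhds_infty (hK.isOpen_compl.mem_nhds h)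
  apply Metric.isCompact_of_isClosed_isBounded (hK.preimage continuous_ofC)
  refine (Metric.isBounded_closedBall (x := (0:ℂ)) (r := R)).subset fun z hz => ?_
  by_contra hc
  exact h' z (by simpa using hc) hz

lemma image_preimage_ofC {K : Set RSphere} (h : infty ∉ K) : ofC '' (ofC ⁻¹' K) = K := by
  ext x
  constructor
  · rintro ⟨z, hz, rfl⟩; exact hz
  · intro hx
    have : x ≠ infty := fun e => h (e ▸ hx)
    refine ⟨toC x, ?_, ofC_toC this⟩
    rw [mem_preimage, ofC_toC this]; exact hx

lemma closure_range_ofC : closure (range ofC) = univ := by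
  rw [eq_univ_iff_forall]
  intro x
  rcases sph_cases x with rfl | ⟨z, rfl⟩
  · exact mem_closure_of_tendsto tendsto_ofC_infty (Eventually.of_forall fun z => ⟨z, rfl⟩)
  · exact subset_closure ⟨z, rfl⟩

instance sphereConnected : PreconnectedSpace RSphere where
  isPreconnected_univ := by
    rw [← closure_range_ofC]
    exact (isPreconnected_range continuous_ofC).closure

lemma isClosedEmb_compact {K : Set ℂ} (hK : IsCompact K) : IsClosed (ofC '' K) :=
  (hK.image continuous_ofC).isClosed

end QC
end
end

section
open Filter Set Topology RSphere MeasureTheory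
open scoped ENNReal NNReal
noncomputable section
set_option linter.all false
set_option linter.deprecated false
namespace QC

/-! ### M2: planar topology via continuous logarithms -/

lemma exists_log {A : Type} [TopologicalSpace A] [SimplyConnectedSpace A]
    [LocallyPathConnectedSpace A] (h : A → ℂ) (hc : Continuous h) (h0 : ∀ a, h a ≠ 0) :
    ∃ g : A → ℂ, Continuous g ∧ ∀ a, Complex.exp (g a) = h a := by
  obtain ⟨a₀⟩ : Nonempty A := inferInstance
  let f : C(A, {z : ℂ // z ≠ 0}) := ⟨fun a => ⟨h a, h0 a⟩, by fun_prop⟩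
  obtain ⟨F, ⟨_, hF⟩, _⟩ := Complex.isCoveringMap_exp.existsUnique_continuousMap_lifts f a₀
    (Complex.log (h a₀)) (Subtype.ext (Complex.exp_log (h0 a₀)))
  refine ⟨F, F.continuous, fun a => ?_⟩
  exact congrArg Subtype.val (congrFun hF a)

lemma log_unique {A : Type} [TopologicalSpace A] [PreconnectedSpace A] {g1 g2 : A → ℂ}
    (h1 : Continuous g1) (h2 : Continuous g2) (he : ∀ a, Complex.exp (g1 a) = Complex.exp (g2 a))
    (a : A) (ha : g1 a = g2 a) : g1 = g2 :=
  Complex.isCoveringMap_exp.eq_of_comp_eq h1 h2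
    (by funext a; exact Subtype.ext (he a)) a ha

/-- two logs on a connected space differ by a constant -/
lemma log_diff {A : Type} [TopologicalSpace A] [PreconnectedSpace A] {g1 g2 : A → ℂ}
    (h1 : Continuous g1) (h2 : Continuous g2) (he : ∀ a, Complex.exp (g1 a) = Complex.exp (g2 a))
    (a b : A) : g1 b - g2 b = g1 a - g2 a := by
  have := log_unique (g1 := g1) (g2 := fun x => g2 x + (g1 a - g2 a)) h1 (by fun_prop)
    (fun x => by rw [Complex.exp_add, Complex.exp_sub, he a, div_self (Complex.exp_ne_zero _), mul_one, he])
    a (by ring)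
  have h := congrFun this b
  rw [h]; ring

lemma no_log {m : ℤ} (hm : m ≠ 0) (a : ℂ) {R : ℝ} (hR : 0 < R) {g : ℂ → ℂ} (hg : Continuous g)
    (h : ∀ z, ‖z - a‖ = R → Complex.exp (g z) = (z - a) ^ m) : False := by
  let p : ℝ → ℂ := fun t => a + R * Complex.exp (t * Complex.I)
  have hp : Continuous p := by fun_prop
  have hR' : (R : ℂ) ≠ 0 := by exact_mod_cast hR.ne'
  have e1 : ∀ t, Complex.exp (g (p t)) = Complex.exp (m * (Real.log R + t * Complex.I)) := by
    intro t
    rw [h (p t)]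
    · simp only [p, add_sub_cancel_left]
      rw [Complex.exp_int_mul, Complex.exp_add, ← Complex.ofReal_exp, Real.exp_log hR]
    · simp [p, Complex.norm_exp, abs_of_pos hR]
  have := log_diff (g1 := fun t => g (p t)) (g2 := fun t : ℝ => m * (Real.log R + t * Complex.I))
    (by fun_prop) (by fun_prop) e1 0 (2 * Real.pi)
  have hpp : p (2 * Real.pi) = p 0 := by
    simp only [p]; push_cast
    rw [Complex.exp_two_pi_mul_I]; simp
  simp only [hpp] at this
  have h2 : (m : ℂ) * (2 * Real.pi * Complex.I) = 0 := by
    have h3 := sub_right_injective this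
    push_cast at h3
    linear_combination h3
  rw [mul_eq_zero] at h2
  rcases h2 with h2 | h2
  · exact hm (by exact_mod_cast h2)
  · exact Complex.two_pi_I_ne_zero h2

/-- the basic gluing contradiction -/
lemma glue_false {V : Set ℂ} (hV : IsOpen V) (hb : Bornology.IsBounded V) {a : ℂ} (ha : a ∈ V)
    {m : ℤ} (hm : m ≠ 0) {F : ℂ → ℂ} (hF : ContinuousOn F (closure V))
    (hF0 : ∀ z ∈ closure V, F z ≠ 0) (hag : ∀ z ∈ frontier V, F z = (z - a) ^ m) : False := by
  classical
  let H : ℂ → ℂ := V.piecewise F (fun z => (z - a) ^ m)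
  have hne : ∀ z, z ∉ V → z - a ≠ 0 := fun z hz e => hz (by rwa [sub_eq_zero.1 e])
  have hH : Continuous H := by
    apply continuous_piecewise
    · intro z hz; exact hag z hz
    · exact hF
    · rw [hV.isClosed_compl.closure_eq]
      apply ContinuousOn.zpow₀ (by fun_prop)
      intro z hz
      left; exact hne z hz
  have hH0 : ∀ z, H z ≠ 0 := by
    intro z
    by_cases hz : z ∈ V
    · simp only [H, piecewise_eq_of_mem _ _ _ hz]; exact hF0 z (subset_closure hz)
    · simp only [H, piecewise_eq_of_notMem _ _ _ hz]; exact zpow_ne_zero _ (hne z hz)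
  obtain ⟨g, hg, hgH⟩ := exists_log H hH hH0
  obtain ⟨R, hR⟩ := hb.subset_ball a
  have hR0 : 0 < R := by
    have := hR ha
    simpa using this
  refine no_log hm a hR0 hg fun z hz => ?_
  rw [hgH z]
  have : z ∉ V := fun hz' => by
    have := hR hz'
    rw [Metric.mem_ball, dist_eq_norm, hz] at this
    exact lt_irrefl _ this
  simp only [H, piecewise_eq_of_notMem _ _ _ this]

/-- `h` has a continuous logarithm on `K` -/
def HasLog (K : Set ℂ) (h : ℂ → ℂ) : Prop :=
  ∃ g : ℂ → ℂ, ContinuousOn g K ∧ ∀ z ∈ K, Complex.exp (g z) = h z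

lemma HasLog.extend {K : Set ℂ} (hK : IsClosed K) {h : ℂ → ℂ} (H : HasLog K h) :
    ∃ g : ℂ → ℂ, Continuous g ∧ ∀ z ∈ K, Complex.exp (g z) = h z := by
  obtain ⟨g, hg, hgh⟩ := H
  obtain ⟨G, hG⟩ := ContinuousMap.exists_restrict_eq hK (⟨K.domRestrict g, hg.domRestrict⟩ : C(K, ℂ))
  refine ⟨G, G.continuous, fun z hz => ?_⟩
  rw [← hgh z hz]
  congr 1
  exact congrArg (fun f : C(K, ℂ) => f ⟨z, hz⟩) hG

lemma HasLog.congr {K : Set ℂ} {h h' : ℂ → ℂ} (H : HasLog K h) (e : ∀ z ∈ K, h z = h' z) :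
    HasLog K h' := by
  obtain ⟨g, hg, hgh⟩ := H
  exact ⟨g, hg, fun z hz => (hgh z hz).trans (e z hz)⟩

lemma HasLog.mul {K : Set ℂ} {h h' : ℂ → ℂ} (H : HasLog K h) (H' : HasLog K h') :
    HasLog K (fun z => h z * h' z) := by
  obtain ⟨g, hg, hgh⟩ := H
  obtain ⟨g', hg', hgh'⟩ := H'
  exact ⟨fun z => g z + g' z, hg.add hg', fun z hz => by rw [Complex.exp_add, hgh z hz, hgh' z hz]⟩

lemma HasLog.of_ball {K : Set ℂ} {h : ℂ → ℂ} (hc : ContinuousOn h K) (hb : ∀ z ∈ K, ‖h z - 1‖ < 1) :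
    HasLog K h := by
  have hs : ∀ z ∈ K, h z ∈ Complex.slitPlane := fun z hz =>
    Complex.ball_one_subset_slitPlane (by rw [Metric.mem_ball, dist_eq_norm]; exact hb z hz)
  refine ⟨fun z => Complex.log (h z), hc.clog hs, fun z hz => ?_⟩
  exact Complex.exp_log (Complex.slitPlane_ne_zero (hs z hz))

lemma HasLog.const (K : Set ℂ) {c : ℂ} (hc : c ≠ 0) : HasLog K (fun _ => c) :=
  ⟨fun _ => Complex.log c, continuousOn_const, fun _ _ => Complex.exp_log hc⟩

/-- all `z - a`, `a ∉ K`, have logs on `K` -/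
def Good (K : Set ℂ) : Prop := ∀ a, a ∉ K → HasLog K (fun z => z - a)

lemma hasLog_near {K : Set ℂ} {a b : ℂ} (h : HasLog K (fun z => z - a))
    (hab : ∀ z ∈ K, ‖a - b‖ < ‖z - a‖) : HasLog K (fun z => z - b) := by
  have hne : ∀ z ∈ K, z - a ≠ 0 := fun z hz => norm_pos_iff.1 (lt_of_le_of_lt (norm_nonneg _) (hab z hz))
  have : HasLog K (fun z => (z - b) / (z - a)) := by
    apply HasLog.of_ball
    · exact ContinuousOn.div (by fun_prop) (by fun_prop) hne
    · intro z hz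
      have e : (z - b) / (z - a) - 1 = (a - b) / (z - a) := by
        have := hne z hz; field_simp; ring
      rw [e, norm_div, div_lt_one (norm_pos_iff.2 (hne z hz))]
      exact hab z hz
  exact (h.mul this).congr fun z hz => by have := hne z hz; field_simp

lemma good_of_compl {K : Set ℂ} (hK : IsCompact K) (hc : IsPreconnected Kᶜ) : Good K := by
  intro a ha
  -- nearby points
  have near : ∀ a ∉ K, ∃ δ > 0, ∀ z ∈ K, δ ≤ ‖z - a‖ := by
    intro a ha
    rcases K.eq_empty_or_nonempty with rfl | hne
    · exact ⟨1, one_pos, by simp⟩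
    · refine ⟨Metric.infDist a K, (hK.isClosed.notMem_iff_infDist_pos hne).1 ha, fun z hz => ?_⟩
      rw [← dist_eq_norm, dist_comm]; exact Metric.infDist_le_dist_of_mem hz
  obtain ⟨R, hR⟩ := hK.isBounded.subset_closedBall 0
  let u := {a | a ∉ K ∧ HasLog K (fun z => z - a)}
  let v := {a | a ∉ K ∧ ¬ HasLog K (fun z => z - a)}
  have key : ∀ a ∉ K, ∃ δ > 0, ∀ b, ‖a - b‖ < δ → b ∉ K ∧
      (HasLog K (fun z => z - a) ↔ HasLog K (fun z => z - b)) := by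
    intro a ha
    obtain ⟨δ, h0, hδ⟩ := near a ha
    refine ⟨δ / 2, by positivity, fun b hb => ⟨?_, ?_, ?_⟩⟩
    · intro hbK
      have := hδ b hbK
      rw [norm_sub_rev] at this; linarith
    · intro h; exact hasLog_near h fun z hz => by linarith [hδ z hz]
    · intro h
      refine hasLog_near h fun z hz => ?_
      have h1 := hδ z hz
      have h2 : ‖z - a‖ ≤ ‖z - b‖ + ‖b - a‖ := by
        simpa using norm_add_le (z - b) (b - a)
      rw [norm_sub_rev b a] at h2
      rw [norm_sub_rev b a]
      linarith
  have hu : IsOpen u := by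
    rw [Metric.isOpen_iff]
    rintro a ⟨ha, hl⟩
    obtain ⟨δ, h0, h⟩ := key a ha
    refine ⟨δ, h0, fun b hb => ?_⟩
    rw [Metric.mem_ball, dist_comm, dist_eq_norm] at hb
    exact ⟨(h b hb).1, (h b hb).2.1 hl⟩
  have hv : IsOpen v := by
    rw [Metric.isOpen_iff]
    rintro a ⟨ha, hl⟩
    obtain ⟨δ, h0, h⟩ := key a ha
    refine ⟨δ, h0, fun b hb => ?_⟩
    rw [Metric.mem_ball, dist_comm, dist_eq_norm] at hb
    exact ⟨(h b hb).1, fun hh => hl ((h b hb).2.2 hh)⟩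
  by_contra hna
  have hcov : Kᶜ ⊆ u ∪ v := fun b hb => by
    by_cases hh : HasLog K (fun z => z - b)
    · exact Or.inl ⟨hb, hh⟩
    · exact Or.inr ⟨hb, hh⟩
  let b : ℂ := ((|R| + 1 : ℝ) : ℂ)
  have hbn : ‖b‖ = |R| + 1 := by
    simp only [b, Complex.norm_real]; rw [Real.norm_of_nonneg (by positivity)]
  have hzb : ∀ z ∈ K, ‖z‖ < ‖b‖ := fun z hz => by
    have := hR hz
    simp at this
    rw [hbn]; linarith [le_abs_self R]
  have hbK : b ∉ K := fun h => lt_irrefl _ (hzb b h)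
  have hb0 : b ≠ 0 := norm_pos_iff.1 (by rw [hbn]; positivity)
  have hbu : b ∈ u := by
    refine ⟨hbK, ?_⟩
    have : HasLog K (fun z => 1 - z / b) := by
      apply HasLog.of_ball (by fun_prop)
      intro z hz
      rw [sub_sub_cancel_left, norm_neg, norm_div, div_lt_one (norm_pos_iff.2 hb0)]
      exact hzb z hz
    exact ((HasLog.const K (neg_ne_zero.2 hb0)).mul this).congr fun z _ => by field_simp; ring
  obtain ⟨x, hx, ⟨_, h1⟩, ⟨_, h2⟩⟩ := hc u v hu hv hcov ⟨b, hbK, hbu⟩ ⟨a, ha, ha, hna⟩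
  exact h2 h1

lemma isPreconnected_outside (R : ℝ) : IsPreconnected {z : ℂ | R < ‖z‖} := by
  rcases lt_or_ge R 0 with hR | hR
  · have : {z : ℂ | R < ‖z‖} = univ := eq_univ_of_forall fun z => hR.trans_le (norm_nonneg z)
    rw [this]; exact isPreconnected_univ
  rcases hR.eq_or_lt with rfl | hR
  · have : {z : ℂ | 0 < ‖z‖} = Complex.exp '' univ := by
      ext z; simp
    rw [this]; exact isPreconnected_univ.image _ Complex.continuous_exp.continuousOn
  · have : {z : ℂ | R < ‖z‖} = Complex.exp '' {w | Real.log R < w.re} := by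
      ext z
      simp only [mem_ofPred_eq, mem_image]
      constructor
      · intro h
        have hz : 0 < ‖z‖ := hR.trans h
        refine ⟨Complex.log z, ?_, Complex.exp_log (norm_pos_iff.1 hz)⟩
        rw [Complex.log_re]; exact Real.log_lt_log hR h
      · rintro ⟨w, hw, rfl⟩
        rw [Complex.norm_exp]
        rwa [← Real.log_lt_iff_lt_exp hR]
    rw [this]
    exact (convex_halfSpace_re_gt _).isPreconnected.image _ Complex.continuous_exp.continuousOn

lemma isPreconnected_punctured (p : ℂ) (r : ℝ) : IsPreconnected (Metric.ball p r \ {p}) := by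
  rcases le_or_gt r 0 with hr | hr
  · rw [Metric.ball_eq_empty.2 hr]; simp [isPreconnected_empty]
  · have : Metric.ball p r \ {p} = (fun w => p + Complex.exp w) '' {w | w.re < Real.log r} := by
      ext z
      simp only [mem_ofPred_eq, mem_image, Set.mem_sdiff, mem_singleton_iff, Metric.mem_ball, dist_eq_norm]
      constructor
      · rintro ⟨h, hne⟩
        have hz : 0 < ‖z - p‖ := norm_pos_iff.2 (sub_ne_zero.2 hne)
        refine ⟨Complex.log (z - p), ?_, ?_⟩
        · rw [Complex.log_re]; exact Real.log_lt_log hz h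
        · rw [Complex.exp_log (sub_ne_zero.2 hne)]; ring
      · rintro ⟨w, hw, rfl⟩
        simp only [add_sub_cancel_left, Complex.norm_exp]
        refine ⟨by rwa [← Real.lt_log_iff_exp_lt hr], ?_⟩
        simp [Complex.exp_ne_zero]
    rw [this]
    exact (convex_halfSpace_re_lt _).isPreconnected.image _ (by fun_prop)

lemma compl_of_good {K : Set ℂ} (hK : IsCompact K) (hg : Good K) : IsPreconnected Kᶜ := by
  obtain ⟨R, hR⟩ := hK.isBounded.subset_closedBall 0
  have hE : {z : ℂ | R < ‖z‖} ⊆ Kᶜ := fun z hz hzK => by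
    have := hR hzK
    simp at this
    exact absurd hz (not_lt.2 this)
  let b : ℂ := ((|R| + 1 : ℝ) : ℂ)
  have hbE : R < ‖b‖ := by
    simp only [b, Complex.norm_real]; rw [Real.norm_of_nonneg (by positivity)]
    linarith [le_abs_self R]
  have hall : ∀ a ∈ Kᶜ, b ∈ connectedComponentIn Kᶜ a := by
    intro a ha
    by_contra hb
    set V := connectedComponentIn Kᶜ a with hV
    have hVo : IsOpen V := hK.isClosed.isOpen_compl.connectedComponentIn
    have haV : a ∈ V := mem_connectedComponentIn ha
    have hdis : ∀ z ∈ V, ‖z‖ ≤ R := by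
      intro z hz
      by_contra hc
      push Not at hc
      apply hb
      have h1 : {z : ℂ | R < ‖z‖} ⊆ connectedComponentIn Kᶜ z :=
        (isPreconnected_outside R).subset_connectedComponentIn hc hE
      rw [hV, connectedComponentIn_eq hz]
      exact h1 hbE
    have hVb : Bornology.IsBounded V :=
      (Metric.isBounded_closedBall (x := (0:ℂ)) (r := R)).subset fun z hz => by simpa using hdis z hz
    have hfr : frontier V ⊆ K := by
      intro z hz
      by_contra hzK
      rw [frontier, hVo.interior_eq] at hz
      have ho : IsOpen (connectedComponentIn Kᶜ z) := hK.isClosed.isOpen_compl.connectedComponentIn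
      obtain ⟨w, hw1, hw2⟩ := mem_closure_iff.1 hz.1 _ ho (mem_connectedComponentIn hzK)
      apply hz.2
      rw [hV, connectedComponentIn_eq hw2, ← connectedComponentIn_eq hw1]
      exact mem_connectedComponentIn hzK
    obtain ⟨g, hgc, hge⟩ := (hg a ha).extend hK.isClosed
    refine glue_false hVo hVb haV one_ne_zero (F := fun z => Complex.exp (g z))
      (by fun_prop) (fun z _ => Complex.exp_ne_zero _) fun z hz => ?_
    rw [zpow_one]; exact hge z (hfr hz)
  apply isPreconnected_of_forall b
  intro a ha
  exact ⟨connectedComponentIn Kᶜ a, connectedComponentIn_subset _ _, hall a ha,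
    mem_connectedComponentIn ha, isPreconnected_connectedComponentIn⟩

lemma Good.union {K1 K2 : Set ℂ} (h1 : IsClosed K1) (h2 : IsClosed K2) (g1 : Good K1) (g2 : Good K2)
    (hs : (K1 ∩ K2).Subsingleton) : Good (K1 ∪ K2) := by
  classical
  intro a ha
  obtain ⟨l1, hl1, he1⟩ := g1 a (fun h => ha (Or.inl h))
  obtain ⟨l2, hl2, he2⟩ := g2 a (fun h => ha (Or.inr h))
  obtain ⟨c, hc1, hc⟩ : ∃ c : ℂ, Complex.exp c = 1 ∧ ∀ z ∈ K1 ∩ K2, l1 z = l2 z + c := by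
    rcases (K1 ∩ K2).eq_empty_or_nonempty with he | ⟨p, hp⟩
    · exact ⟨0, Complex.exp_zero, by rw [he]; simp⟩
    · refine ⟨l1 p - l2 p, ?_, fun z hz => ?_⟩
      · rw [Complex.exp_sub, he1 p hp.1, he2 p hp.2, ← he1 p hp.1, div_self (Complex.exp_ne_zero _)]
      · rw [hs hz hp]; ring
  let l := K1.piecewise l1 (fun z => l2 z + c)
  have e1 : EqOn l l1 K1 := piecewise_eqOn _ _ _
  have e2 : EqOn l (fun z => l2 z + c) K2 := by
    intro z hz
    by_cases hz1 : z ∈ K1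
    · rw [e1 hz1]; exact hc z ⟨hz1, hz⟩
    · exact piecewise_eq_of_notMem _ _ _ hz1
  refine ⟨l, ContinuousOn.union_of_isClosed (hl1.congr e1) ((hl2.add continuousOn_const).congr e2) h1 h2, ?_⟩
  rintro z (hz | hz)
  · rw [e1 hz]; exact he1 z hz
  · rw [e2 hz, Complex.exp_add, hc1, mul_one]; exact he2 z hz

/-- descend a function through a continuous map of a compact set -/
lemma descend {S : Set ℝ} (hS : IsCompact S) {f θ : ℝ → ℂ} (hf : ContinuousOn f S)
    (hθ : ContinuousOn θ S) (hfac : ∀ s ∈ S, ∀ t ∈ S, f s = f t → θ s = θ t) :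
    ∃ g : ℂ → ℂ, ContinuousOn g (f '' S) ∧ ∀ s ∈ S, g (f s) = θ s := by
  classical
  have : CompactSpace S := isCompact_iff_compactSpace.1 hS
  let F : S → f '' S := fun s => ⟨f s, s, s.2, rfl⟩
  have hFc : Continuous F := by
    apply Continuous.subtype_mk; exact hf.domRestrict
  have hFs : Function.Surjective F := by
    rintro ⟨_, s, hs, rfl⟩; exact ⟨⟨s, hs⟩, rfl⟩
  have hq : IsQuotientMap F := hFc.isClosedMap.isQuotientMap hFc hFs
  let g : ℂ → ℂ := fun z => if h : z ∈ f '' S then θ h.choose else 0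
  have hg : ∀ s ∈ S, g (f s) = θ s := by
    intro s hs
    have h : f s ∈ f '' S := ⟨s, hs, rfl⟩
    simp only [g, dif_pos h]
    exact hfac _ h.choose_spec.1 _ hs h.choose_spec.2
  refine ⟨g, ?_, hg⟩
  rw [continuousOn_iff_continuous_domRestrict, hq.continuous_iff]
  have : (f '' S).domRestrict g ∘ F = S.domRestrict θ := by
    funext s; exact hg s s.2
  rw [this]; exact hθ.domRestrict

lemma arc_good {f : ℝ → ℂ} (hf : ContinuousOn f (Icc 0 1)) (hi : InjOn f (Icc 0 1)) :
    Good (f '' Icc 0 1) := by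
  intro a ha
  let h : ℝ → ℂ := fun t => f (projIcc 0 1 zero_le_one t) - a
  have hc : Continuous h := by
    have : Continuous fun t => f (projIcc (0:ℝ) 1 zero_le_one t) :=
      hf.domRestrict.comp continuous_projIcc
    exact this.sub continuous_const
  have h0 : ∀ t, h t ≠ 0 := fun t e => ha ⟨_, (projIcc (0:ℝ) 1 zero_le_one t).2, sub_eq_zero.1 e⟩
  obtain ⟨θ, hθ, he⟩ := exists_log h hc h0
  obtain ⟨g, hg, hgf⟩ := descend isCompact_Icc hf hθ.continuousOn (fun s hs t ht e => by rw [hi hs ht e])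
  refine ⟨g, hg, ?_⟩
  rintro _ ⟨s, hs, rfl⟩
  rw [hgf s hs, he s]
  simp only [h]
  rw [projIcc_of_mem _ hs]

/-- Lemma J: a closed curve bounds at most one region -/
lemma jordan_one {γ : ℝ → ℂ} (hγ : ContinuousOn γ (Icc 0 1)) (hcl : γ 0 = γ 1)
    (hi : ∀ s ∈ Icc (0:ℝ) 1, ∀ t ∈ Icc (0:ℝ) 1, γ s = γ t → s = t ∨ (s = 0 ∧ t = 1) ∨ (s = 1 ∧ t = 0))
    {V1 V2 : Set ℂ} (o1 : IsOpen V1) (o2 : IsOpen V2) (b1 : Bornology.IsBounded V1)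
    (b2 : Bornology.IsBounded V2) (n1 : V1.Nonempty) (n2 : V2.Nonempty) (hd : Disjoint V1 V2)
    (f1 : frontier V1 ⊆ γ '' Icc 0 1) (f2 : frontier V2 ⊆ γ '' Icc 0 1)
    (h1 : Disjoint V1 (γ '' Icc 0 1)) (h2 : Disjoint V2 (γ '' Icc 0 1)) : False := by
  set J := γ '' Icc 0 1 with hJ
  have hJc : IsClosed J := (isCompact_Icc.image_of_continuousOn hγ).isClosed
  have lift : ∀ a ∉ J, ∃ θ : ℝ → ℂ, ∃ k : ℤ, Continuous θ ∧
      (∀ t ∈ Icc (0:ℝ) 1, Complex.exp (θ t) = γ t - a) ∧ θ 1 = θ 0 + k * (2 * Real.pi * Complex.I) := by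
    intro a ha
    let h : ℝ → ℂ := fun t => γ (projIcc 0 1 zero_le_one t) - a
    have hc : Continuous h := by
      have : Continuous fun t => γ (projIcc (0:ℝ) 1 zero_le_one t) :=
        hγ.domRestrict.comp continuous_projIcc
      exact this.sub continuous_const
    have h0 : ∀ t, h t ≠ 0 := fun t e => ha ⟨_, (projIcc (0:ℝ) 1 zero_le_one t).2, sub_eq_zero.1 e⟩
    obtain ⟨θ, hθ, he⟩ := exists_log h hc h0
    have he' : ∀ t ∈ Icc (0:ℝ) 1, Complex.exp (θ t) = γ t - a := fun t ht => by
      rw [he t]; simp only [h]; rw [projIcc_of_mem _ ht]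
    obtain ⟨k, hk⟩ := Complex.exp_eq_exp_iff_exists_int.1
      (show Complex.exp (θ 1) = Complex.exp (θ 0) by
        rw [he' 1 (by simp), he' 0 (by simp), hcl])
    exact ⟨θ, k, hθ, he', hk⟩
  -- main step
  have main : ∀ (V : Set ℂ) (a b : ℂ) (m n : ℤ), IsOpen V → Bornology.IsBounded V → a ∈ V →
      b ∉ closure V → frontier V ⊆ J → m ≠ 0 → HasLog J (fun z => (z - a) ^ m * (z - b) ^ n) → False := by
    intro V a b m n hV hVb ha hb hfr hm hl
    obtain ⟨g, hg, hge⟩ := hl.extend hJc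
    have hbne : ∀ z ∈ closure V, z - b ≠ 0 := fun z hz e => hb (by rwa [← sub_eq_zero.1 e])
    refine glue_false hV hVb ha hm (F := fun z => Complex.exp (g z) * (z - b) ^ (-n)) ?_ ?_ ?_
    · apply ContinuousOn.mul (by fun_prop)
      exact ContinuousOn.zpow₀ (by fun_prop) _ fun z hz => Or.inl (hbne z hz)
    · intro z hz
      exact mul_ne_zero (Complex.exp_ne_zero _) (zpow_ne_zero _ (hbne z hz))
    · intro z hz
      have := hbne z (frontier_subset_closure hz)
      rw [hge z (hfr hz), mul_assoc, ← zpow_add₀ this]; simp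
  obtain ⟨a, ha⟩ := n1
  obtain ⟨b, hb⟩ := n2
  have haJ : a ∉ J := fun h => disjoint_left.1 h1 ha h
  have hbJ : b ∉ J := fun h => disjoint_left.1 h2 hb h
  have hbV : b ∉ closure V1 := fun h => by
    obtain ⟨w, hw1, hw2⟩ := mem_closure_iff.1 h V2 o2 hb
    exact disjoint_left.1 hd hw2 hw1
  have haV : a ∉ closure V2 := fun h => by
    obtain ⟨w, hw1, hw2⟩ := mem_closure_iff.1 h V1 o1 ha
    exact disjoint_left.1 hd hw1 hw2
  obtain ⟨θa, ka, cθa, ea, pa⟩ := lift a haJ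
  obtain ⟨θb, kb, cθb, eb, pb⟩ := lift b hbJ
  have comb : ∀ m n : ℤ, m * ka + n * kb = 0 → HasLog J (fun z => (z - a) ^ m * (z - b) ^ n) := by
    intro m n hmn
    have e01 : (m:ℂ) * θa 1 + n * θb 1 = m * θa 0 + n * θb 0 := by
      rw [pa, pb]
      have : (m : ℂ) * ka + n * kb = 0 := by exact_mod_cast hmn
      linear_combination (2 * Real.pi * Complex.I) * this
    obtain ⟨g, hg, hge⟩ := descend isCompact_Icc hγ (θ := fun t => m * θa t + n * θb t)
      (by fun_prop) (by
        intro s hs t ht e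
        rcases hi s hs t ht e with rfl | ⟨rfl, rfl⟩ | ⟨rfl, rfl⟩
        · rfl
        · exact e01.symm
        · exact e01)
    refine ⟨g, hg, ?_⟩
    rintro _ ⟨t, ht, rfl⟩
    rw [hge t ht, Complex.exp_add, Complex.exp_int_mul, Complex.exp_int_mul, ea t ht, eb t ht]
  by_cases hk : kb = 0
  · -- swap
    refine main V2 b a 1 0 o2 b2 hb haV f2 one_ne_zero ?_
    have := comb 0 1 (by rw [hk]; ring)
    exact this.congr fun z _ => by simp
  · exact main V1 a b kb (-ka) o1 b1 ha hbV f1 hk (comb kb (-ka) (by ring))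

lemma preconnected_diff_singleton {U : Set ℂ} (ho : IsOpen U) (hc : IsPreconnected U) (p : ℂ) :
    IsPreconnected (U \ {p}) := by
  by_cases hp : p ∈ U
  swap
  · rwa [sdiff_singleton_eq_self hp]
  obtain ⟨r, hr, hball⟩ := Metric.isOpen_iff.1 ho p hp
  have hpb := isPreconnected_punctured p r
  rw [isPreconnected_iff_subset_of_disjoint] at hpb ⊢
  intro u v hu hv hcov hdis
  have key : ∀ u v : Set ℂ, IsOpen u → IsOpen v → U \ {p} ⊆ u ∪ v → (U \ {p}) ∩ (u ∩ v) = ∅ →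
      Metric.ball p r \ {p} ⊆ u → (U \ {p} ⊆ u ∨ U \ {p} ⊆ v) := by
    intro u v hu hv hcov hdis hb
    rw [isPreconnected_iff_subset_of_disjoint] at hc
    have := hc (u ∪ Metric.ball p r) (v \ {p}) (hu.union Metric.isOpen_ball)
      (hv.sdiff isClosed_singleton) ?_ ?_
    · rcases this with h | h
      · left
        rintro z ⟨hz, hzp⟩
        rcases h hz with h | h
        · exact h
        · exact hb ⟨h, hzp⟩
      · exact absurd rfl (h hp).2
    · intro z hz
      by_cases hzp : z = p
      · left; right; rw [hzp]; exact Metric.mem_ball_self hr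
      · rcases hcov ⟨hz, hzp⟩ with h | h
        · left; left; exact h
        · right; exact ⟨h, hzp⟩
    · rw [eq_empty_iff_forall_notMem] at hdis ⊢
      rintro z ⟨hz, h1 | h1, h2, h3⟩
      · exact hdis z ⟨⟨hz, h3⟩, h1, h2⟩
      · exact hdis z ⟨⟨hz, h3⟩, hb ⟨h1, h3⟩, h2⟩
  have hsub : Metric.ball p r \ {p} ⊆ U \ {p} := sdiff_subset_sdiff_left hball
  rcases hpb u v hu hv (hsub.trans hcov) (by
    rw [eq_empty_iff_forall_notMem] at hdis ⊢
    exact fun z hz => hdis z ⟨hsub hz.1, hz.2⟩) with h | h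
  · exact key u v hu hv hcov hdis h
  · rw [union_comm] at hcov
    rw [inter_comm u v] at hdis
    exact (key v u hv hu hcov hdis h).symm

end QC
end
end

section
open Filter Set Topology RSphere MeasureTheory
open scoped ENNReal NNReal
noncomputable section
set_option linter.all false
namespace QC

/-! ### M3: rectifiable arcs -/

/-- `f` parametrizes a rectifiable arc in `S` from `a` to `b` -/
structure IsArcP (S : Set ℂ) (a b : ℂ) (f : ℝ → ℂ) : Prop where
  cont : ContinuousOn f (Icc 0 1)
  inj : InjOn f (Icc 0 1)
  src : f 0 = a
  tgt : f 1 = b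
  sub : ∀ t ∈ Icc (0:ℝ) 1, f t ∈ S
  fin : μH[1] (f '' Icc 0 1) < ⊤

/-- there is a rectifiable arc in `S` from `a` to `b` -/
def ArcIn (S : Set ℂ) (a b : ℂ) : Prop := ∃ f, IsArcP S a b f

lemma ArcIn.mono {S T : Set ℂ} {a b : ℂ} (h : ArcIn S a b) (hST : S ⊆ T) : ArcIn T a b := by
  obtain ⟨f, hf⟩ := h
  exact ⟨f, hf.cont, hf.inj, hf.src, hf.tgt, fun t ht => hST (hf.sub t ht), hf.fin⟩

lemma ArcIn.segment {S : Set ℂ} {a b : ℂ} (hab : a ≠ b) (h : _root_.segment ℝ a b ⊆ S) : ArcIn S a b := by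
  have him : (fun t : ℝ => AffineMap.lineMap a b t) '' Icc (0:ℝ) 1 = _root_.segment ℝ a b :=
    (segment_eq_image_lineMap ℝ a b).symm
  refine ⟨fun t => AffineMap.lineMap a b t, ?_, ?_, by simp, by simp, ?_, ?_⟩
  · exact AffineMap.lineMap_continuous.continuousOn
  · exact (AffineMap.lineMap_injective ℝ hab).injOn
  · intro t ht; exact h (him ▸ ⟨t, ht, rfl⟩)
  · rw [him, MeasureTheory.hausdorffMeasure_segment]; exact edist_lt_top _ _

lemma IsArcP.subarc {S : Set ℂ} {a b : ℂ} {f : ℝ → ℂ} (h : IsArcP S a b f) {s t : ℝ}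
    (hs : s ∈ Icc (0:ℝ) 1) (ht : t ∈ Icc (0:ℝ) 1) (hst : s ≠ t) :
    IsArcP (f '' uIcc s t) (f s) (f t) (fun u => f (s + u * (t - s))) := by
  have hm : ∀ u ∈ Icc (0:ℝ) 1, s + u * (t - s) ∈ uIcc s t := by
    intro u hu
    rw [mem_uIcc]
    rcases le_total s t with h | h
    · left; constructor <;> nlinarith [hu.1, hu.2]
    · right; constructor <;> nlinarith [hu.1, hu.2]
  have hsub : uIcc s t ⊆ Icc (0:ℝ) 1 := uIcc_subset_Icc hs ht
  refine ⟨?_, ?_, by simp, by simp, ?_, ?_⟩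
  · exact h.cont.comp (by fun_prop) fun u hu => hsub (hm u hu)
  · intro u hu v hv e
    have := h.inj (hsub (hm u hu)) (hsub (hm v hv)) e
    have h2 : (u - v) * (t - s) = 0 := by linarith
    rcases mul_eq_zero.1 h2 with h2 | h2
    · linarith
    · exact absurd (by linarith) hst
  · intro u hu; exact ⟨_, hm u hu, rfl⟩
  · refine lt_of_le_of_lt (measure_mono ?_) h.fin
    rintro _ ⟨u, hu, rfl⟩
    exact ⟨_, hsub (hm u hu), rfl⟩

lemma ArcIn.symm {S : Set ℂ} {a b : ℂ} (h : ArcIn S a b) : ArcIn S b a := by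
  obtain ⟨f, hf⟩ := h
  have := hf.subarc (s := 1) (t := 0) (by simp) (by simp) one_ne_zero
  rw [hf.src, hf.tgt] at this
  refine ArcIn.mono ⟨_, this⟩ ?_
  rintro _ ⟨t, ht, rfl⟩
  exact hf.sub t (uIcc_subset_Icc (by simp) (by simp) ht)

lemma ArcIn.concat0 {S : Set ℂ} {a b c : ℂ} {f g : ℝ → ℂ} (hf : IsArcP S a b f) (hg : IsArcP S b c g)
    (hd : ∀ s ∈ Icc (0:ℝ) 1, ∀ t ∈ Icc (0:ℝ) 1, f s = g t → s = 1 ∧ t = 0) : ArcIn S a c := by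
  classical
  let k : ℝ → ℂ := fun t => if t ≤ 1 / 2 then f (2 * t) else g (2 * t - 1)
  have k1 : ∀ t ≤ (1/2:ℝ), k t = f (2 * t) := fun t ht => by simp only [k]; rw [if_pos ht]
  have k2 : ∀ t ≥ (1/2:ℝ), k t = g (2 * t - 1) := fun t ht => by
    rcases eq_or_lt_of_le ht with h | h
    · rw [k1 t h.symm.le, ← h]; norm_num; rw [hf.tgt, hg.src]
    · simp only [k]; rw [if_neg (not_le.2 h)]
  have hI : Icc (0:ℝ) 1 = Icc 0 (1/2) ∪ Icc (1/2) 1 := (Icc_union_Icc_eq_Icc (by norm_num) (by norm_num)).symm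
  have c1 : ContinuousOn k (Icc 0 (1/2)) := by
    refine ContinuousOn.congr (f := fun t => f (2 * t)) (hf.cont.comp (by fun_prop) ?_) fun t ht => k1 t ht.2
    intro t ht; constructor <;> linarith [ht.1, ht.2]
  have c2 : ContinuousOn k (Icc (1/2) 1) := by
    refine ContinuousOn.congr (f := fun t => g (2 * t - 1)) (hg.cont.comp (by fun_prop) ?_) fun t ht => k2 t ht.1
    intro t ht; constructor <;> linarith [ht.1, ht.2]
  have mix : ∀ s ∈ Icc (0:ℝ) 1, ∀ t ∈ Icc (0:ℝ) 1, s ≤ 1/2 → 1/2 ≤ t → k s = k t → s = t := by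
    intro s hs t ht h1 h2 e
    rw [k1 s h1, k2 t h2] at e
    have := hd (2 * s) ⟨by linarith [hs.1], by linarith⟩ (2 * t - 1) ⟨by linarith, by linarith [ht.2]⟩ e
    linarith [this.1, this.2]
  refine ⟨k, ?_, ?_, ?_, ?_, ?_, ?_⟩
  · rw [hI]; exact c1.union_of_isClosed c2 isClosed_Icc isClosed_Icc
  · intro s hs t ht e
    rcases le_total s (1/2) with h1 | h1 <;> rcases le_total t (1/2) with h2 | h2
    · rw [k1 s h1, k1 t h2] at e
      have := hf.inj ⟨by linarith [hs.1], by linarith⟩ ⟨by linarith [ht.1], by linarith⟩ e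
      linarith
    · exact mix s hs t ht h1 h2 e
    · exact (mix t ht s hs h2 h1 e.symm).symm
    · rw [k2 s h1, k2 t h2] at e
      have := hg.inj ⟨by linarith, by linarith [hs.2]⟩ ⟨by linarith, by linarith [ht.2]⟩ e
      linarith
  · rw [k1 0 (by norm_num)]; simpa using hf.src
  · rw [k2 1 (by norm_num)]; norm_num; exact hg.tgt
  · intro t ht
    rcases le_total t (1/2) with h1 | h1
    · rw [k1 t h1]; exact hf.sub _ ⟨by linarith [ht.1], by linarith⟩
    · rw [k2 t h1]; exact hg.sub _ ⟨by linarith, by linarith [ht.2]⟩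
  · refine lt_of_le_of_lt (measure_mono (t := f '' Icc 0 1 ∪ g '' Icc 0 1) ?_)
      (lt_of_le_of_lt (measure_union_le _ _) (ENNReal.add_lt_top.2 ⟨hf.fin, hg.fin⟩))
    rintro _ ⟨t, ht, rfl⟩
    rcases le_total t (1/2) with h1 | h1
    · left; rw [k1 t h1]; exact ⟨_, ⟨by linarith [ht.1], by linarith⟩, rfl⟩
    · right; rw [k2 t h1]; exact ⟨_, ⟨by linarith, by linarith [ht.2]⟩, rfl⟩

lemma IsArcP.mono {S T : Set ℂ} {a b : ℂ} {f : ℝ → ℂ} (hf : IsArcP S a b f) (hST : S ⊆ T) :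
    IsArcP T a b f := ⟨hf.cont, hf.inj, hf.src, hf.tgt, fun t ht => hST (hf.sub t ht), hf.fin⟩

lemma ArcIn.trans {S : Set ℂ} {a b c : ℂ} (h1 : ArcIn S a b) (h2 : ArcIn S b c) (hac : a ≠ c) :
    ArcIn S a c := by
  obtain ⟨f, hf⟩ := h1
  obtain ⟨g, hg⟩ := h2
  have hGc : IsClosed (g '' Icc 0 1) := (isCompact_Icc.image_of_continuousOn hg.cont).isClosed
  have hTc : IsCompact (Icc (0:ℝ) 1 ∩ f ⁻¹' (g '' Icc 0 1)) :=
    isCompact_Icc.of_isClosed_subset (hf.cont.preimage_isClosed_of_isClosed isClosed_Icc hGc)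
      inter_subset_left
  obtain ⟨t0, ⟨ht0, s0, hs0, he⟩, hmin⟩ := hTc.exists_isLeast
    ⟨1, by simp, 0, by simp, by rw [hf.tgt, hg.src]⟩
  have fsub : ∀ t ∈ Icc (0:ℝ) 1, ∀ s ∈ Icc (0:ℝ) 1, f '' uIcc s t ⊆ S := by
    rintro t ht s hs _ ⟨u, hu, rfl⟩
    exact hf.sub u (uIcc_subset_Icc hs ht hu)
  have gsub : ∀ t ∈ Icc (0:ℝ) 1, ∀ s ∈ Icc (0:ℝ) 1, g '' uIcc s t ⊆ S := by
    rintro t ht s hs _ ⟨u, hu, rfl⟩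
    exact hg.sub u (uIcc_subset_Icc hs ht hu)
  by_cases h0 : t0 = 0
  · have hs1 : s0 ≠ 1 := by
      rintro rfl
      rw [h0, hf.src, hg.tgt] at he
      exact hac he.symm
    have := hg.subarc hs0 (t := 1) (by simp) hs1
    rw [he, h0, hf.src, hg.tgt] at this
    exact ⟨_, this.mono (gsub _ (by simp) _ hs0)⟩
  have F := hf.subarc (s := 0) (by simp) ht0 (Ne.symm h0)
  rw [hf.src] at F
  have F' := F.mono (fsub _ ht0 _ (by simp))
  by_cases h1 : s0 = 1
  · rw [h1, hg.tgt] at he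
    rw [← he] at F'
    exact ⟨_, F'⟩
  have G := hg.subarc hs0 (t := 1) (by simp) h1
  rw [he, hg.tgt] at G
  have G' := G.mono (gsub _ (by simp) _ hs0)
  refine ArcIn.concat0 F' G' ?_
  intro s hs t ht e
  simp only [zero_add, sub_zero] at e
  have hst : s * t0 ∈ Icc (0:ℝ) 1 := ⟨by nlinarith [hs.1, ht0.1], by nlinarith [hs.1, ht0.1, hs.2, ht0.2]⟩
  have htt : s0 + t * (1 - s0) ∈ Icc (0:ℝ) 1 :=
    ⟨by nlinarith [ht.1, hs0.1, hs0.2], by nlinarith [ht.1, ht.2, hs0.1, hs0.2]⟩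
  have hle := hmin ⟨hst, _, htt, e.symm⟩
  have hpos : 0 < t0 := lt_of_le_of_ne ht0.1 (Ne.symm h0)
  have hs1 : s = 1 := by nlinarith [hs.2]
  subst hs1
  refine ⟨rfl, ?_⟩
  rw [one_mul, ← he] at e
  have := hg.inj hs0 htt e
  have h3 : t * (1 - s0) = 0 := by linarith
  rcases mul_eq_zero.1 h3 with h | h
  · exact h
  · exact absurd (by linarith) h1

lemma arc_of_connected {U : Set ℂ} (ho : IsOpen U) (hc : IsPreconnected U) {a b : ℂ} (ha : a ∈ U)
    (hb : b ∈ U) (hab : a ≠ b) : ArcIn U a b := by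
  let P : ℂ → Prop := fun x => x = a ∨ ArcIn U a x
  have key : ∀ x ∈ U, ∃ r > 0, Metric.ball x r ⊆ U ∧ ∀ y ∈ Metric.ball x r, (P x ↔ P y) := by
    intro x hx
    obtain ⟨r, hr, hball⟩ := Metric.isOpen_iff.1 ho x hx
    have step : ∀ y ∈ Metric.ball x r, ∀ w ∈ Metric.ball x r, P y → P w := by
      intro y hy w hw h
      by_cases hyw : y = w
      · rwa [← hyw]
      by_cases hwa : w = a
      · exact Or.inl hwa
      have seg : ArcIn U y w := ArcIn.segment hyw
        (((convex_ball x r).segment_subset hy hw).trans hball)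
      rcases h with rfl | h
      · exact Or.inr seg
      · exact Or.inr (h.trans seg (Ne.symm hwa))
    have hxx := Metric.mem_ball_self (x := x) hr
    exact ⟨r, hr, hball, fun y hy => ⟨step x hxx y hy, step y hy x hxx⟩⟩
  have hu : IsOpen {x | x ∈ U ∧ P x} := by
    rw [Metric.isOpen_iff]
    rintro x ⟨hx, hp⟩
    obtain ⟨r, hr, hb, h⟩ := key x hx
    exact ⟨r, hr, fun y hy => ⟨hb hy, (h y hy).1 hp⟩⟩
  have hv : IsOpen {x | x ∈ U ∧ ¬ P x} := by
    rw [Metric.isOpen_iff]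
    rintro x ⟨hx, hp⟩
    obtain ⟨r, hr, hb, h⟩ := key x hx
    exact ⟨r, hr, fun y hy => ⟨hb hy, fun h' => hp ((h y hy).2 h')⟩⟩
  by_contra hcon
  have hnb : ¬ P b := by
    rintro (h | h)
    · exact hab h.symm
    · exact hcon h
  obtain ⟨x, _, ⟨_, h1⟩, ⟨_, h2⟩⟩ := hc _ _ hu hv (fun x hx => by
    by_cases h : P x
    · exact Or.inl ⟨hx, h⟩
    · exact Or.inr ⟨hx, h⟩) ⟨a, ha, ha, Or.inl rfl⟩ ⟨b, hb, hb, hnb⟩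
  exact h2 h1

/-- `y` is accessible from `U` by rectifiable arcs -/
def Acc (U : Set ℂ) (y : ℂ) : Prop :=
  ∀ ε > 0, ∃ y' ∈ U, ArcIn ((U ∩ Metric.ball y ε) ∪ {y}) y y'

lemma Acc.join {U : Set ℂ} (ho : IsOpen U) (hc : IsPreconnected U) {y1 y2 : ℂ} (h1 : Acc U y1)
    (h2 : Acc U y2) (n1 : y1 ∉ U) (n2 : y2 ∉ U) (h12 : y1 ≠ y2) : ArcIn (U ∪ {y1, y2}) y1 y2 := by
  obtain ⟨x1, hx1, a1⟩ := h1 1 one_pos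
  obtain ⟨x2, hx2, a2⟩ := h2 1 one_pos
  have b1 : ArcIn (U ∪ {y1, y2}) y1 x1 := a1.mono (by
    rintro z (⟨hz, _⟩ | hz)
    · exact Or.inl hz
    · right; left; exact hz)
  have b2 : ArcIn (U ∪ {y1, y2}) x2 y2 := (a2.mono (by
    rintro z (⟨hz, _⟩ | hz)
    · exact Or.inl hz
    · right; right; exact hz)).symm
  by_cases hx : x1 = x2
  · subst hx; exact b1.trans b2 h12
  · have b3 : ArcIn (U ∪ {y1, y2}) x1 x2 := (arc_of_connected ho hc hx1 hx2 hx).mono subset_union_left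
    exact (b1.trans b3 (fun e => n1 (e ▸ hx2))).trans b2 h12

lemma Acc.diff {U K : Set ℂ} {y : ℂ} (h : Acc U y) (hK : IsClosed K) (hy : y ∉ K) : Acc (U \ K) y := by
  intro ε hε
  obtain ⟨r, hr, hb⟩ := Metric.isOpen_iff.1 hK.isOpen_compl y hy
  obtain ⟨y', hy', f, hf⟩ := h (min ε r) (lt_min hε hr)
  have hsub : (U ∩ Metric.ball y (min ε r)) ∪ {y} ⊆ (U \ K ∩ Metric.ball y ε) ∪ {y} := by
    rintro z (⟨hz, hzb⟩ | hz)
    · left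
      exact ⟨⟨hz, hb (Metric.ball_subset_ball (min_le_right _ _) hzb)⟩,
        Metric.ball_subset_ball (min_le_left _ _) hzb⟩
    · exact Or.inr hz
  refine ⟨y', ⟨hy', ?_⟩, f, hf.mono hsub⟩
  have := hsub (hf.sub 1 (by simp))
  rw [hf.tgt] at this
  rcases this with h | h
  · exact h.1.2
  · rw [h]; exact hy

lemma ArcIn.map {S : Set ℂ} {a b : ℂ} (h : ArcIn S a b) {φ : ℂ → ℂ} (hi : InjOn φ S) {K : ℝ≥0}
    (hl : LipschitzOnWith K φ S) : ArcIn (φ '' S) (φ a) (φ b) := by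
  obtain ⟨f, hf⟩ := h
  refine ⟨φ ∘ f, hl.continuousOn.comp hf.cont hf.sub, hi.comp hf.inj hf.sub, by simp [hf.src],
    by simp [hf.tgt], fun t ht => ⟨_, hf.sub t ht, rfl⟩, ?_⟩
  rw [image_comp]
  have hsub : f '' Icc 0 1 ⊆ S := by rintro _ ⟨t, ht, rfl⟩; exact hf.sub t ht
  refine lt_of_le_of_lt ((hl.mono hsub).hausdorffMeasure_image_le zero_le_one) ?_
  simp only [ENNReal.rpow_one]
  exact ENNReal.mul_lt_top ENNReal.coe_lt_top hf.fin

lemma Acc.map {U U' N : Set ℂ} {y : ℂ} (h : Acc U y) (hN : N ∈ 𝓝 y) {φ : ℂ → ℂ} (hi : InjOn φ N)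
    {K : ℝ≥0} (hl : LipschitzOnWith K φ N) (hm : ∀ x ∈ U ∩ N, φ x ∈ U') (hy : y ∉ U) :
    Acc U' (φ y) := by
  intro ε hε
  have hcy : ContinuousAt φ y := hl.continuousOn.continuousAt hN
  have : N ∩ φ ⁻¹' (Metric.ball (φ y) ε) ∈ 𝓝 y :=
    inter_mem hN (hcy (Metric.ball_mem_nhds _ hε))
  obtain ⟨r, hr, hb⟩ := Metric.mem_nhds_iff.1 this
  obtain ⟨y', hy', harc⟩ := h r hr
  have hsub : (U ∩ Metric.ball y r) ∪ {y} ⊆ N := by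
    rintro z (⟨_, hz⟩ | hz)
    · exact (hb hz).1
    · rw [hz]; exact (hb (Metric.mem_ball_self hr)).1
  have hy'N : y' ∈ U ∩ N := by
    refine ⟨hy', ?_⟩
    obtain ⟨f, hf⟩ := harc
    have := hf.sub 1 (by simp)
    rw [hf.tgt] at this
    exact hsub this
  refine ⟨φ y', hm _ hy'N, (harc.map (hi.mono hsub) (hl.mono hsub)).mono ?_⟩
  rintro _ ⟨z, hz | hz, rfl⟩
  · left; exact ⟨hm z ⟨hz.1, (hb hz.2).1⟩, (hb hz.2).2⟩
  · right; rw [hz]; rfl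

lemma Acc.mono {U U' : Set ℂ} {y : ℂ} (h : Acc U y) (hs : U ⊆ U') : Acc U' y := by
  intro ε hε
  obtain ⟨y', hy', ha⟩ := h ε hε
  exact ⟨y', hs hy', ha.mono (union_subset_union_left _ (inter_subset_inter_left _ hs))⟩

/-- radial accessibility: small segments -/
lemma Acc.of_segment {U : Set ℂ} {y v : ℂ} (hv : v ≠ 0) {δ : ℝ} (hδ : 0 < δ)
    (h : ∀ t : ℝ, 0 < t → t < δ → y + t * v ∈ U) : Acc U y := by
  intro ε hε
  have hv' : 0 < ‖v‖ := norm_pos_iff.2 hv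
  let t0 : ℝ := min (δ / 2) (ε / (2 * ‖v‖))
  have ht0 : 0 < t0 := lt_min (by positivity) (by positivity)
  have h1 : t0 ≤ δ / 2 := min_le_left _ _
  have h2 : t0 ≤ ε / (2 * ‖v‖) := min_le_right _ _
  rw [le_div_iff₀ (by positivity)] at h2
  refine ⟨y + t0 * v, h t0 ht0 (by linarith), ArcIn.segment ?_ ?_⟩
  · intro e
    have : (t0 : ℂ) * v = 0 := by linear_combination -e
    rcases mul_eq_zero.1 this with h | h
    · exact ht0.ne' (by exact_mod_cast h)
    · exact hv h
  · rw [segment_eq_image']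
    rintro _ ⟨s, hs, rfl⟩
    have e : y + s • (y + t0 * v - y) = y + ((s * t0 : ℝ) : ℂ) * v := by
      simp; ring
    simp only [e]
    rcases eq_or_lt_of_le hs.1 with h0 | h0
    · right; rw [← h0]; simp
    · left
      have hle : s * t0 ≤ t0 := by nlinarith [hs.2]
      refine ⟨h _ (by positivity) (by linarith), ?_⟩
      rw [Metric.mem_ball, dist_eq_norm, add_sub_cancel_left, norm_mul, Complex.norm_real,
        Real.norm_of_nonneg (by positivity)]
      nlinarith

end QC
end
end

section
open Filter Set Topology RSphere MeasureTheory
open scoped ENNReal NNReal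
noncomputable section
set_option linter.all false
namespace QC

/-! ### M4: ping-pong systems -/

/-- A ping-pong system on the sphere. -/
structure PP (L : Type) where
  inv : L → L
  inv_inv : ∀ a, inv (inv a) = a
  inv_ne : ∀ a, inv a ≠ a
  M : L → SL2C
  M_inv : ∀ a, M (inv a) = (M a)⁻¹
  A : L → Set RSphere
  closed : ∀ a, IsClosed (A a)
  inf_nmem : ∀ a, infty ∉ A a
  disj : ∀ a b, a ≠ b → Disjoint (A a) (A b)
  map : ∀ a x, x ∉ A (inv a) → mobius (M a) x ∈ A a

namespace PP
variable {L : Type} (P : PP L)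

/-- reduced words -/
def Red (w : List L) : Prop := w.IsChain (fun a b => b ≠ P.inv a)

/-- matrix of a word -/
def Mw (w : List L) : SL2C := (w.map P.M).prod

@[simp] lemma Mw_nil : P.Mw [] = 1 := by simp [Mw]
lemma Mw_cons (a : L) (w : List L) : P.Mw (a :: w) = P.M a * P.Mw w := by simp [Mw]
lemma Mw_append (w v : List L) : P.Mw (w ++ v) = P.Mw w * P.Mw v := by simp [Mw]
lemma Mw_single (a : L) : P.Mw [a] = P.M a := by simp [Mw]

lemma red_nil : P.Red [] := by simp [Red]
lemma red_single (a : L) : P.Red [a] := by simp [Red]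
lemma red_cons_cons {a b : L} {w : List L} : P.Red (a :: b :: w) ↔ b ≠ P.inv a ∧ P.Red (b :: w) := by
  simp [Red, List.isChain_cons_cons]
lemma Red.tail' {a : L} {w : List L} (h : P.Red (a :: w)) : P.Red w := by
  exact List.IsChain.tail h
lemma red_append {w v : List L} : P.Red (w ++ v) ↔ P.Red w ∧ P.Red v ∧
    ∀ x ∈ w.getLast?, ∀ y ∈ v.head?, y ≠ P.inv x := by
  simp [Red, List.isChain_append]

/-- point `x` is admissible for the word `w` -/
def Ok (w : List L) (x : RSphere) : Prop := ∀ a ∈ w.getLast?, x ∉ P.A (P.inv a)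

lemma Ok_cons_cons {a b : L} {w : List L} {x : RSphere} : P.Ok (a :: b :: w) x ↔ P.Ok (b :: w) x := by
  simp [Ok, List.getLast?_cons_cons]

lemma Ok_infty (w : List L) : P.Ok w infty := fun a _ => P.inf_nmem _

lemma Mw_mem {w : List L} : ∀ {a : L} {x : RSphere}, P.Red (a :: w) → P.Ok (a :: w) x →
    mobius (P.Mw (a :: w)) x ∈ P.A a := by
  induction w with
  | nil => intro a x _ h; rw [Mw_single]; exact P.map a x (h a (by simp))
  | cons b w ih =>
    intro a x hr ho
    rw [red_cons_cons] at hr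
    rw [Ok_cons_cons] at ho
    have := ih hr.2 ho
    rw [Mw_cons, mobius_mul]
    apply P.map
    exact fun h => (P.disj b (P.inv a) hr.1).le_bot ⟨this, h⟩

/-- cylinders -/
def Cyl : List L → Set RSphere
  | [] => univ
  | a :: w => P.A a ∩ mobius (P.M a)⁻¹ ⁻¹' Cyl w

@[simp] lemma Cyl_nil : P.Cyl [] = univ := rfl
lemma Cyl_cons (a : L) (w : List L) : P.Cyl (a :: w) = P.A a ∩ mobius (P.M a)⁻¹ ⁻¹' P.Cyl w := rfl
lemma mem_Cyl_cons {a : L} {w : List L} {x : RSphere} :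
    x ∈ P.Cyl (a :: w) ↔ x ∈ P.A a ∧ mobius (P.M a)⁻¹ x ∈ P.Cyl w := Iff.rfl
lemma Cyl_single (a : L) : P.Cyl [a] = P.A a := by simp [Cyl]

lemma Cyl_append (w v : List L) : P.Cyl (w ++ v) = P.Cyl w ∩ mobius (P.Mw w)⁻¹ ⁻¹' P.Cyl v := by
  induction w with
  | nil => ext x; simp [mobius_one]
  | cons a w ih =>
    ext x
    rw [List.cons_append, mem_Cyl_cons, ih, mem_inter_iff, mem_inter_iff, mem_Cyl_cons, Mw_cons,
      mul_inv_rev, mem_preimage, mem_preimage, mobius_mul, and_assoc]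

lemma isClosed_Cyl (w : List L) : IsClosed (P.Cyl w) := by
  induction w with
  | nil => simp
  | cons a w ih => exact (P.closed a).inter (ih.preimage (continuous_mobius _))

lemma Cyl_unique {w v : List L} : ∀ {x : RSphere}, w.length = v.length → x ∈ P.Cyl w → x ∈ P.Cyl v →
    w = v := by
  induction w generalizing v with
  | nil => intro x h _ _; cases v <;> simp_all
  | cons a w ih =>
    intro x h h1 h2
    cases v with
    | nil => simp at h
    | cons b v =>
      rw [mem_Cyl_cons] at h1 h2
      have hab : a = b := by
        by_contra hne
        exact (P.disj a b hne).le_bot ⟨h1.1, h2.1⟩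
      subst hab
      rw [ih (by simpa using h) h1.2 h2.2]

lemma mem_Cyl_of_Ok {w : List L} : ∀ {x : RSphere}, P.Red w → P.Ok w x →
    mobius (P.Mw w) x ∈ P.Cyl w := by
  induction w with
  | nil => intros; simp
  | cons a w ih =>
    intro x hr ho
    rw [mem_Cyl_cons]
    refine ⟨P.Mw_mem hr ho, ?_⟩
    rw [Mw_cons, mobius_mul, mobius_inv_apply]
    refine ih hr.tail' ?_
    cases w with
    | nil => intro b hb; simp at hb
    | cons b w => rwa [Ok_cons_cons] at ho

lemma mem_Cyl_snoc {w : List L} {m : L} {x : RSphere} (hr : P.Red (w ++ [m])) (hx : x ∈ P.A m) :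
    mobius (P.Mw w) x ∈ P.Cyl (w ++ [m]) := by
  rw [red_append] at hr
  rw [Cyl_append, Cyl_single]
  refine ⟨P.mem_Cyl_of_Ok hr.1 fun a ha h => ?_, by rw [mem_preimage, mobius_inv_apply]; exact hx⟩
  exact (P.disj m (P.inv a) (hr.2.2 a ha m (by simp))).le_bot ⟨hx, h⟩

lemma of_mem_Cyl_snoc {w : List L} {m : L} {x : RSphere} (hx : x ∈ P.Cyl (w ++ [m])) :
    ∃ y ∈ P.A m, x = mobius (P.Mw w) y := by
  rw [Cyl_append, Cyl_single] at hx
  exact ⟨_, hx.2, (mobius_apply_inv _ _).symm⟩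

lemma Mw_inf_mem {w : List L} (hr : P.Red w) : mobius (P.Mw w) infty ∈ P.Cyl w :=
  P.mem_Cyl_of_Ok hr (P.Ok_infty w)

/-- translates of the outside are disjoint -/
lemma translates_ne {w v : List L} (hw : P.Red w) (hv : P.Red v) (hne : w ≠ v) {x y : RSphere}
    (hx : ∀ a, x ∉ P.A a) (hy : ∀ a, y ∉ P.A a) : mobius (P.Mw w) x ≠ mobius (P.Mw v) y := by
  induction w generalizing v with
  | nil =>
    cases v with
    | nil => exact absurd rfl hne
    | cons b v =>
      intro e
      rw [Mw_nil, mobius_one] at e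
      exact hx b (e ▸ P.Mw_mem hv fun _ _ => hy _)
  | cons a w ih =>
    cases v with
    | nil =>
      intro e
      rw [Mw_nil, mobius_one] at e
      exact hy a (e ▸ P.Mw_mem hw fun _ _ => hx _)
    | cons b v =>
      intro e
      have h1 := P.Mw_mem hw fun _ _ => hx _
      have h2 := P.Mw_mem hv fun _ _ => hy _
      have hab : a = b := by
        by_contra hne
        exact (P.disj a b hne).le_bot ⟨h1, e ▸ h2⟩
      subst hab
      rw [Mw_cons, Mw_cons, mobius_mul, mobius_mul] at e
      exact ih hw.tail' hv.tail' (fun h => hne (by rw [h])) (mobius_injective _ e)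

/-- union of level n cylinders -/
def Lev (n : ℕ) : Set RSphere := {x | ∃ w, P.Red w ∧ w.length = n ∧ x ∈ P.Cyl w}

/-- the limit set of the system -/
def Lam : Set RSphere := {x | ∀ n, x ∈ P.Lev n}

lemma isClosed_Lev [Finite L] (n : ℕ) : IsClosed (P.Lev n) := by
  have : P.Lev n = ⋃ w ∈ {w : List L | w.length = n ∧ P.Red w}, P.Cyl w := by
    ext x; simp only [Lev, mem_setOf_eq, mem_iUnion, exists_prop]
    constructor
    · rintro ⟨w, h1, h2, h3⟩; exact ⟨w, ⟨h2, h1⟩, h3⟩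
    · rintro ⟨w, ⟨h2, h1⟩, h3⟩; exact ⟨w, h1, h2, h3⟩
  rw [this]
  refine Set.Finite.isClosed_biUnion ?_ fun w _ => P.isClosed_Cyl w
  exact (List.finite_length_eq L n).subset fun w h => h.1

lemma isClosed_Lam [Finite L] : IsClosed P.Lam := by
  have : P.Lam = ⋂ n, P.Lev n := by ext; simp [Lam]
  rw [this]; exact isClosed_iInter fun n => P.isClosed_Lev n

lemma Lev_anti {n m : ℕ} (h : n ≤ m) : P.Lev m ⊆ P.Lev n := by
  rintro x ⟨w, hr, hl, hx⟩
  refine ⟨w.take n, hr.take n, by simp [hl, h], ?_⟩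
  rw [← List.take_append_drop n w, Cyl_append] at hx
  exact hx.1

lemma Lam_sub_A {x : RSphere} (hx : x ∈ P.Lam) : ∃ a, x ∈ P.A a := by
  obtain ⟨w, hr, hl, h⟩ := hx 1
  obtain ⟨a, rfl⟩ := List.length_eq_one_iff.1 hl
  rw [Cyl_single] at h
  exact ⟨a, h⟩

lemma inf_nmem_Lam : infty ∉ P.Lam := fun h => by
  obtain ⟨a, ha⟩ := P.Lam_sub_A h
  exact P.inf_nmem a ha

/-- invariance of Λ under a letter -/
lemma Lam_inv {x : RSphere} (hx : x ∈ P.Lam) (a : L) : mobius (P.M a) x ∈ P.Lam := by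
  intro n
  refine P.Lev_anti (Nat.le_succ n) ?_
  obtain ⟨w, hr, hl, h⟩ := hx (n + 2)
  obtain ⟨b, w', rfl⟩ : ∃ b w', w = b :: w' := by
    cases w with
    | nil => simp at hl
    | cons b w' => exact ⟨b, w', rfl⟩
  by_cases hb : b = P.inv a
  · subst hb
    refine ⟨w', hr.tail', by simpa using hl, ?_⟩
    rw [mem_Cyl_cons, P.M_inv, _root_.inv_inv] at h
    exact h.2
  · refine P.Lev_anti (Nat.le_add_right (n+1) 2) ⟨a :: b :: w', P.red_cons_cons.2 ⟨hb, hr⟩, by simpa using hl, ?_⟩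
    rw [mem_Cyl_cons, mobius_inv_apply]
    refine ⟨P.map a x ?_, h⟩
    exact fun h' => (P.disj _ _ hb).le_bot ⟨h.1, h'⟩

lemma Lam_inv_w {x : RSphere} (hx : x ∈ P.Lam) (w : List L) : mobius (P.Mw w) x ∈ P.Lam := by
  induction w with
  | nil => simpa [mobius_one] using hx
  | cons a w ih => rw [Mw_cons, mobius_mul]; exact P.Lam_inv ih a

/-- every point is either in Λ or in the orbit of a point that is pushed into cylinders -/
lemma dichotomy (z : RSphere) : z ∈ P.Lam ∨ ∃ v, ∀ w, P.Red w →
    mobius (P.Mw w) (mobius (P.Mw v)⁻¹ z) ∈ P.Cyl w := by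
  classical
  by_cases hz : z ∈ P.Lam
  · exact Or.inl hz
  right
  have hex : ∃ n, z ∉ P.Lev n := by
    by_contra h; push Not at h; exact hz h
  set n := Nat.find hex with hn
  have hn0 : n ≠ 0 := by
    intro h0
    have := Nat.find_spec hex
    rw [← hn, h0] at this
    exact this ⟨[], P.red_nil, rfl, by simp⟩
  obtain ⟨k, hk⟩ := Nat.exists_eq_succ_of_ne_zero hn0
  have hk1 : z ∈ P.Lev k := by
    by_contra h
    have := Nat.find_min' hex h
    omega
  have hk2 : z ∉ P.Lev (k + 1) := by
    have := Nat.find_spec hex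
    rwa [← hn, hk] at this
  obtain ⟨v, hvr, hvl, hzv⟩ := hk1
  refine ⟨v, fun w hw => ?_⟩
  set z0 := mobius (P.Mw v)⁻¹ z with hz0
  have key : ∀ m, z0 ∈ P.A m → ∃ a ∈ v.getLast?, m = P.inv a := by
    intro m hm
    by_contra hcon
    push Not at hcon
    apply hk2
    refine ⟨v ++ [m], P.red_append.2 ⟨hvr, P.red_single m, ?_⟩, by simp [hvl], ?_⟩
    · intro x hx y hy
      simp at hy; subst hy
      exact hcon x hx
    · rw [Cyl_append, Cyl_single]; exact ⟨hzv, hm⟩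
  by_cases hok : P.Ok w z0
  · exact P.mem_Cyl_of_Ok hw hok
  unfold Ok at hok
  push Not at hok
  obtain ⟨a, ha, hza⟩ := hok
  obtain ⟨a', ha', he⟩ := key _ hza
  have haa : a = a' := by rw [← P.inv_inv a, he, P.inv_inv]
  subst haa
  obtain ⟨u, rfl⟩ : ∃ u, w = u ++ [a] := by
    rw [Option.mem_def, List.getLast?_eq_some_iff] at ha; exact ha
  obtain ⟨v', rfl⟩ : ∃ v', v = v' ++ [a] := by
    rw [Option.mem_def, List.getLast?_eq_some_iff] at ha'; exact ha'
  rw [Mw_append, mobius_mul, Mw_single]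
  refine P.mem_Cyl_snoc hw ?_
  rw [Cyl_append, Cyl_single] at hzv
  have : mobius (P.M a) z0 = mobius (P.Mw v')⁻¹ z := by
    rw [hz0, Mw_append, Mw_single, mul_inv_rev, mobius_mul, mobius_apply_inv]
  rw [this]; exact hzv.2

/-- `P` generates `Γ` -/
def Gen (Γ : Subgroup PSL2C) : Prop :=
  (∀ a, (P.M a : PSL2C) ∈ Γ) ∧
  ∀ g : SL2C, (g : PSL2C) ∈ Γ → ∃ w, P.Red w ∧ ∀ x, mobius g x = mobius (P.Mw w) x

lemma Gen.Mw_mem {Γ : Subgroup PSL2C} (h : P.Gen Γ) (w : List L) : (P.Mw w : PSL2C) ∈ Γ := by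
  induction w with
  | nil => simpa using Γ.one_mem
  | cons a w ih => rw [Mw_cons]; exact Γ.mul_mem (h.1 a) ih

lemma limitSet_sub_Lam [Finite L] {Γ : Subgroup PSL2C} (h : P.Gen Γ) : limitSet Γ ⊆ P.Lam := by
  rintro x ⟨z, hz⟩
  rcases P.dichotomy z with hL | ⟨v, hv⟩
  · have hsub : mobiusOrbit Γ z ⊆ P.Lam := by
      rintro _ ⟨g, hg, rfl⟩
      obtain ⟨w, _, e⟩ := h.2 g hg
      rw [e]; exact P.Lam_inv_w hL w
    have : x ∈ closure (mobiusOrbit Γ z) := mem_closure_iff_clusterPt.2 hz.clusterPt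
    exact closure_minimal hsub P.isClosed_Lam this
  · set z0 := mobius (P.Mw v)⁻¹ z with hz0
    have horb : ∀ y ∈ mobiusOrbit Γ z, ∃ w, P.Red w ∧ y = mobius (P.Mw w) z0 := by
      rintro _ ⟨g, hg, rfl⟩
      have hgv : ((g * P.Mw v : SL2C) : PSL2C) ∈ Γ := Γ.mul_mem hg (Gen.Mw_mem P h v)
      obtain ⟨w, hw, e⟩ := h.2 _ hgv
      refine ⟨w, hw, ?_⟩
      rw [← e, mobius_mul, hz0, mobius_apply_inv]
    intro n
    let F : Set RSphere := (fun w => mobius (P.Mw w) z0) '' {w : List L | w.length < n}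
    have hF : F.Finite := (List.finite_length_lt L n).image _
    have hsub : mobiusOrbit Γ z ⊆ F ∪ P.Lev n := by
      intro y hy
      obtain ⟨w, hw, rfl⟩ := horb y hy
      by_cases hl : w.length < n
      · exact Or.inl ⟨w, hl, rfl⟩
      · right
        exact P.Lev_anti (not_lt.1 hl) ⟨w, hw, rfl, hv w hw⟩
    have h1 : AccPt x (𝓟 (F ∪ P.Lev n)) := hz.mono (principal_mono.2 hsub)
    rw [← sup_principal, accPt_sup] at h1
    rcases h1 with h1 | h1
    · exfalso
      have hc : (F \ {x})ᶜ ∈ 𝓝 x := (hF.subset sdiff_subset).isClosed.isOpen_compl.mem_nhds (by simp)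
      obtain ⟨y, ⟨hy1, hy2⟩, hy3⟩ := accPt_iff_nhds.1 h1 _ hc
      exact hy1 ⟨hy2, hy3⟩
    · have : x ∈ closure (P.Lev n) := mem_closure_iff_clusterPt.2 h1.clusterPt
      rwa [(P.isClosed_Lev n).closure_eq] at this

end PP
end QC
end
end

section
open Filter Set Topology RSphere MeasureTheory
open scoped ENNReal NNReal
noncomputable section
set_option linter.all false
namespace QC

/-- pole -/
def pole (g : SL2C) : ℂ := - g.1 1 1 / g.1 1 0
/-- image of infinity -/
def inft (g : SL2C) : ℂ := g.1 0 0 / g.1 1 0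
/-- radius of isometric circle squared -/
def rr (g : SL2C) : ℝ := (‖g.1 1 0‖ ^ 2)⁻¹

lemma den_eq {g : SL2C} (hc : g.1 1 0 ≠ 0) (x : ℂ) : den g x = g.1 1 0 * (x - pole g) := by
  unfold den pole; field_simp; ring

lemma den_ne {g : SL2C} (hc : g.1 1 0 ≠ 0) {x : ℂ} (hx : x ≠ pole g) : den g x ≠ 0 := by
  rw [den_eq hc]; exact mul_ne_zero hc (sub_ne_zero.2 hx)

lemma rr_nonneg (g : SL2C) : 0 ≤ rr g := by unfold rr; positivity
lemma rr_pos {g : SL2C} (hc : g.1 1 0 ≠ 0) : 0 < rr g := by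
  have : 0 < ‖g.1 1 0‖ := norm_pos_iff.2 hc
  unfold rr; positivity

lemma mobius_inft {g : SL2C} (hc : g.1 1 0 ≠ 0) : mobius g infty = ofC (inft g) := by
  rw [mobius_infty, if_neg hc]; rfl

lemma mobius_inv_inft {g : SL2C} (hc : g.1 1 0 ≠ 0) : mobius g⁻¹ infty = ofC (pole g) := by
  obtain ⟨h1, h2, h3, h4⟩ := inv_entries g
  rw [mobius_infty, h3, if_neg (neg_ne_zero.2 hc), h1]
  unfold pole; congr 1; rw [div_neg, neg_div]

lemma mob_sub {g : SL2C} (hc : g.1 1 0 ≠ 0) {x y : ℂ} (hx : x ≠ pole g) (hy : y ≠ pole g) :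
    mob g x - mob g y = (x - y) / (den g x * den g y) := by
  have h1 := den_ne hc hx
  have h2 := den_ne hc hy
  unfold mob
  rw [div_sub_div _ _ h1 h2]
  congr 1
  unfold den
  linear_combination (x - y) * det_eq g

lemma norm_mob_sub {g : SL2C} (hc : g.1 1 0 ≠ 0) {x y : ℂ} (hx : x ≠ pole g) (hy : y ≠ pole g) :
    ‖mob g x - mob g y‖ * (‖x - pole g‖ * ‖y - pole g‖) = rr g * ‖x - y‖ := by
  rw [mob_sub hc hx hy, den_eq hc, den_eq hc, norm_div, norm_mul, norm_mul, norm_mul]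
  have h1 : ‖x - pole g‖ ≠ 0 := norm_ne_zero_iff.2 (sub_ne_zero.2 hx)
  have h2 : ‖y - pole g‖ ≠ 0 := norm_ne_zero_iff.2 (sub_ne_zero.2 hy)
  have h3 : ‖g.1 1 0‖ ≠ 0 := norm_ne_zero_iff.2 hc
  unfold rr
  field_simp

lemma norm_mob_sub_inft {g : SL2C} (hc : g.1 1 0 ≠ 0) {x : ℂ} (hx : x ≠ pole g) :
    ‖mob g x - inft g‖ * ‖x - pole g‖ = rr g := by
  have h1 := den_ne hc hx
  have : mob g x - inft g = - 1 / (g.1 1 0 * den g x) := by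
    unfold mob inft
    rw [div_sub_div _ _ h1 hc, mul_comm (den g x) (g.1 1 0)]
    congr 1
    unfold den
    linear_combination -det_eq g
  rw [this, den_eq hc, norm_div, norm_mul, norm_mul, norm_neg, norm_one]
  have h1 : ‖x - pole g‖ ≠ 0 := norm_ne_zero_iff.2 (sub_ne_zero.2 hx)
  have h3 : ‖g.1 1 0‖ ≠ 0 := norm_ne_zero_iff.2 hc
  unfold rr
  field_simp

lemma rr_mul {g h : SL2C} (hg : g.1 1 0 ≠ 0) (hh : h.1 1 0 ≠ 0) {κ : ℝ} (hκ : 0 < κ)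
    (hd : κ ≤ ‖inft h - pole g‖) : rr (g * h) ≤ (κ⁻¹) ^ 2 * rr g * rr h := by
  have e : (g * h).1 1 0 = g.1 1 0 * h.1 1 0 * (inft h - pole g) := by
    rw [mul_entry]; unfold inft pole; field_simp; ring
  have h1 : 0 < ‖g.1 1 0‖ := norm_pos_iff.2 hg
  have h3 : 0 < ‖h.1 1 0‖ := norm_pos_iff.2 hh
  unfold rr
  rw [e, norm_mul, norm_mul, ← inv_pow, ← inv_pow, ← inv_pow, mul_inv, mul_inv, mul_pow, mul_pow]
  have : ‖inft h - pole g‖⁻¹ ≤ κ⁻¹ := inv_anti₀ hκ hd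
  have h5 : (‖inft h - pole g‖⁻¹) ^ 2 ≤ (κ⁻¹) ^ 2 := by gcongr
  calc _ ≤ ‖g.1 1 0‖⁻¹ ^ 2 * ‖h.1 1 0‖⁻¹ ^ 2 * (κ⁻¹) ^ 2 := by gcongr
    _ = _ := by ring

namespace PP
variable {L : Type} (P : PP L)

/-- separation constants -/
structure Cst (κ R : ℝ) : Prop where
  κ_pos : 0 < κ
  κ_le : κ ≤ 1
  R_ge : 1 ≤ R
  bd : ∀ a z, ofC z ∈ P.A a → ‖z‖ ≤ R
  sep : ∀ a b, a ≠ b → ∀ z w, ofC z ∈ P.A a → ofC w ∈ P.A b → κ ≤ ‖z - w‖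

lemma isCompact_AC (a : L) : IsCompact (ofC ⁻¹' P.A a) := isCompact_preimage (P.closed a) (P.inf_nmem a)

lemma exists_Cst [Finite L] : ∃ κ R, P.Cst κ R := by
  have hb : ∃ R : ℝ, ∀ a z, ofC z ∈ P.A a → ‖z‖ ≤ R := by
    have : Bornology.IsBounded (⋃ a, ofC ⁻¹' P.A a) :=
      (Bornology.isBounded_iUnion).2 fun a => (P.isCompact_AC a).isBounded
    obtain ⟨R, hR⟩ := this.exists_norm_le
    exact ⟨R, fun a z h => hR z (mem_iUnion.2 ⟨a, h⟩)⟩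
  obtain ⟨R, hR⟩ := hb
  have hs : ∀ p : L × L, ∃ r : ℝ, 0 < r ∧ (p.1 ≠ p.2 → ∀ z w, ofC z ∈ P.A p.1 → ofC w ∈ P.A p.2 → r ≤ ‖z - w‖) := by
    rintro ⟨a, b⟩
    by_cases hab : a = b
    · exact ⟨1, one_pos, fun h => absurd hab h⟩
    obtain ⟨r, hr, h⟩ := Metric.exists_pos_forall_lt_edist (P.isCompact_AC a) (P.isCompact_AC b).isClosed
      ((P.disj a b hab).preimage ofC)
    refine ⟨r, by exact_mod_cast hr, fun _ z w hz hw => ?_⟩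
    have := h z hz w hw
    rw [edist_dist, ← ENNReal.ofReal_coe_nnreal, ENNReal.ofReal_lt_ofReal_iff_of_nonneg (by positivity)] at this
    rw [← dist_eq_norm]; exact this.le
  choose r hr h using hs
  cases nonempty_fintype L
  by_cases hne : Nonempty L
  · obtain ⟨p, -, hp⟩ := Finset.exists_min_image (Finset.univ : Finset (L × L)) r Finset.univ_nonempty
    refine ⟨min 1 (r p), max 1 R, lt_min one_pos (hr p), min_le_left _ _, le_max_left _ _,
      fun a z hz => (hR a z hz).trans (le_max_right _ _), fun a b hab z w hz hw => ?_⟩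
    exact (min_le_right _ _).trans ((hp (a, b) (Finset.mem_univ _)).trans (h (a, b) hab z w hz hw))
  · rw [not_nonempty_iff] at hne
    exact ⟨1, 1, one_pos, le_rfl, le_rfl, fun a => (hne.false a).elim, fun a => (hne.false a).elim⟩

variable {P}

lemma c_ne {w : List L} (hr : P.Red w) (hw : w ≠ []) : (P.Mw w).1 1 0 ≠ 0 := by
  obtain ⟨a, v, rfl⟩ := List.exists_cons_of_ne_nil hw
  intro h
  have := P.Mw_mem hr (P.Ok_infty _)
  rw [mobius_infty, if_pos h] at this
  exact P.inf_nmem a this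

lemma inft_mem {a : L} {w : List L} (hr : P.Red (a :: w)) : ofC (inft (P.Mw (a :: w))) ∈ P.A a := by
  rw [← mobius_inft (c_ne hr (by simp))]
  exact P.Mw_mem hr (P.Ok_infty _)

lemma pole_mem {w : List L} (hr : P.Red w) {a : L} (ha : a ∈ w.getLast?) :
    ofC (pole (P.Mw w)) ∈ P.A (P.inv a) := by
  have hw : w ≠ [] := by rintro rfl; simp at ha
  rw [← mobius_inv_inft (c_ne hr hw)]
  by_contra h
  obtain ⟨b, v, rfl⟩ := List.exists_cons_of_ne_nil hw
  have : P.Ok (b :: v) (mobius (P.Mw (b :: v))⁻¹ infty) := by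
    intro a' ha'
    have : a = a' := Option.mem_unique ha ha'
    subst this; exact h
  have := P.Mw_mem hr this
  rw [mobius_apply_inv] at this
  exact P.inf_nmem b this

lemma last_exists {w : List L} (hw : w ≠ []) : ∃ a, a ∈ w.getLast? :=
  ⟨w.getLast hw, by simp [List.getLast?_eq_getLast_of_ne_nil hw]⟩

variable (P) in
/-- weight of a word -/
def rho (κ : ℝ) (w : List L) : ℝ :=
  open Classical in if P.Red w then (if w = [] then 1 else (κ⁻¹) ^ 2 * rr (P.Mw w)) else 0

lemma rho_nil (κ : ℝ) : P.rho κ [] = 1 := by simp [rho, P.red_nil]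
lemma rho_red {κ : ℝ} {w : List L} (hr : P.Red w) (hw : w ≠ []) :
    P.rho κ w = (κ⁻¹) ^ 2 * rr (P.Mw w) := by simp [rho, hr, hw]
lemma rho_nred {κ : ℝ} {w : List L} (hr : ¬ P.Red w) : P.rho κ w = 0 := by simp [rho, hr]
lemma rho_nonneg (κ : ℝ) (w : List L) : 0 ≤ P.rho κ w := by
  unfold rho
  split_ifs
  · exact zero_le_one
  · have := rr_nonneg (P.Mw w); positivity
  · exact le_rfl
lemma rho_pos {κ : ℝ} (hκ : 0 < κ) {w : List L} (hr : P.Red w) : 0 < P.rho κ w := by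
  by_cases hw : w = []
  · rw [hw, rho_nil]; exact one_pos
  · rw [rho_red hr hw]; have := rr_pos (c_ne hr hw); positivity

lemma rho_append {κ R : ℝ} (C : P.Cst κ R) (w v : List L) : P.rho κ (w ++ v) ≤ P.rho κ w * P.rho κ v := by
  by_cases hr : P.Red (w ++ v)
  swap
  · rw [rho_nred hr]; exact mul_nonneg (rho_nonneg _ _) (rho_nonneg _ _)
  by_cases hw : w = []
  · subst hw; simp [rho_nil]
  by_cases hv : v = []
  · subst hv; simp [rho_nil]
  have hr' := P.red_append.1 hr
  rw [rho_red hr (by simp [hw]), rho_red hr'.1 hw, rho_red hr'.2.1 hv, P.Mw_append]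
  obtain ⟨a, ha⟩ := last_exists hw
  obtain ⟨b, v', rfl⟩ := List.exists_cons_of_ne_nil hv
  have := rr_mul (c_ne hr'.1 hw) (c_ne hr'.2.1 hv) C.κ_pos
    (C.sep b (P.inv a) (hr'.2.2 a ha b (by simp)) _ _ (inft_mem hr'.2.1) (pole_mem hr'.1 ha))
  have hκ : 0 ≤ (κ⁻¹) ^ 2 := by positivity
  calc _ ≤ (κ⁻¹) ^ 2 * ((κ⁻¹) ^ 2 * rr (P.Mw w) * rr (P.Mw (b :: v'))) := by gcongr
    _ = _ := by ring

/-- coordinates for a point of a cylinder -/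
lemma cyl_coord {κ R : ℝ} (C : P.Cst κ R) {w : List L} (hw : w ≠ []) {m : L} (hr : P.Red (w ++ [m]))
    {z : ℂ} (hz : ofC z ∈ P.Cyl (w ++ [m])) : ∃ y, ofC y ∈ P.A m ∧ z = mob (P.Mw w) y ∧
      κ ≤ ‖y - pole (P.Mw w)‖ ∧ ‖y - pole (P.Mw w)‖ ≤ 2 * R ∧ y ≠ pole (P.Mw w) := by
  obtain ⟨y', hy', e⟩ := P.of_mem_Cyl_snoc hz
  have hne : y' ≠ infty := fun h => P.inf_nmem m (h ▸ hy')
  obtain ⟨y, rfl⟩ := (sph_cases y').resolve_left hne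
  have hr' := P.red_append.1 hr
  obtain ⟨a, ha⟩ := last_exists hw
  have hp := pole_mem hr'.1 ha
  have h1 := C.sep m (P.inv a) (hr'.2.2 a ha m (by simp)) _ _ hy' hp
  have hyp : y ≠ pole (P.Mw w) := by
    intro h
    rw [← h, sub_self, norm_zero] at h1
    linarith [C.κ_pos]
  refine ⟨y, hy', ?_, h1, ?_, hyp⟩
  · rw [mobius_ofC_of_ne _ _ (den_ne (c_ne hr'.1 hw) hyp)] at e
    exact ofC_injective e
  · have := norm_sub_le y (pole (P.Mw w))
    linarith [C.bd _ _ hy', C.bd _ _ hp]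

lemma cyl_ball {κ R : ℝ} (C : P.Cst κ R) {w : List L} (hw : w ≠ []) {m : L} (hr : P.Red (w ++ [m]))
    {z : ℂ} (hz : ofC z ∈ P.Cyl (w ++ [m])) : ‖z - inft (P.Mw w)‖ ≤ P.rho κ w := by
  obtain ⟨y, hy, rfl, h1, h2, h3⟩ := cyl_coord C hw hr hz
  have hr' := P.red_append.1 hr
  have h := norm_mob_sub_inft (c_ne hr'.1 hw) h3
  rw [rho_red hr'.1 hw]
  have hκ := C.κ_pos
  have h4 : ‖mob (P.Mw w) y - inft (P.Mw w)‖ * κ ≤ rr (P.Mw w) := by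
    rw [← h]; gcongr
  have h5 : (κ⁻¹) ^ 2 * κ * κ = 1 := by field_simp
  have h6 : 0 ≤ ‖mob (P.Mw w) y - inft (P.Mw w)‖ := norm_nonneg _
  have h8 : ‖mob (P.Mw w) y - inft (P.Mw w)‖ * κ * κ ≤ rr (P.Mw w) := by
    nlinarith [C.κ_le, mul_nonneg h6 hκ.le]
  calc ‖mob (P.Mw w) y - inft (P.Mw w)‖ = (κ⁻¹) ^ 2 * (‖mob (P.Mw w) y - inft (P.Mw w)‖ * κ * κ) := by
        linear_combination -‖mob (P.Mw w) y - inft (P.Mw w)‖ * h5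
    _ ≤ _ := by gcongr

lemma cyl_sep {κ R : ℝ} (C : P.Cst κ R) {w : List L} {m m' : L} (hmm : m ≠ m') (hr : P.Red (w ++ [m]))
    (hr2 : P.Red (w ++ [m']))
    {z z' : ℂ} (hz : ofC z ∈ P.Cyl (w ++ [m])) (hz' : ofC z' ∈ P.Cyl (w ++ [m'])) :
    κ ^ 3 / (2 * R) ^ 2 * P.rho κ w ≤ ‖z - z'‖ := by
  have hκ := C.κ_pos
  have hR := C.R_ge
  by_cases hw : w = []
  · subst hw
    rw [List.nil_append, Cyl_single] at hz hz'
    have := C.sep m m' hmm _ _ hz hz'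
    rw [rho_nil, mul_one]
    refine le_trans ?_ this
    rw [div_le_iff₀ (by positivity)]
    have h1 : κ ^ 3 ≤ κ := by nlinarith [C.κ_le, mul_pos hκ hκ]
    have h2 : 1 ≤ (2 * R) ^ 2 := by nlinarith
    nlinarith
  obtain ⟨y, hy, rfl, h1, h2, h3⟩ := cyl_coord C hw hr hz
  obtain ⟨y', hy', rfl, h1', h2', h3'⟩ := cyl_coord C hw hr2 hz'
  have hr' := P.red_append.1 hr
  have h := norm_mob_sub (c_ne hr'.1 hw) h3 h3'
  have hs := C.sep m m' hmm _ _ hy hy'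
  rw [rho_red hr'.1 hw]
  have h4 : κ ^ 3 / (2 * R) ^ 2 * ((κ⁻¹) ^ 2 * rr (P.Mw w)) = (rr (P.Mw w) * κ) / (2 * R) ^ 2 := by
    field_simp
  rw [h4, div_le_iff₀ (by positivity)]
  calc rr (P.Mw w) * κ ≤ rr (P.Mw w) * ‖y - y'‖ := by
        have := rr_nonneg (P.Mw w); gcongr
    _ = _ := h.symm
    _ ≤ ‖mob (P.Mw w) y - mob (P.Mw w) y'‖ * ((2 * R) * (2 * R)) := by gcongr
    _ = _ := by ring

end PP
end QC
end
end

section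
open Filter Set Topology RSphere MeasureTheory
open scoped ENNReal NNReal
noncomputable section
set_option linter.all false
namespace QC
namespace PP
variable {L : Type} {P : PP L}

/-- restricted weights -/
def rs (P : PP L) (t : ℝ) (w : List L) : ℝ≥0∞ :=
  open Classical in if P.Red w ∧ w ≠ [] then ENNReal.ofReal (rr (P.Mw w)) ^ t else 0

lemma rs_pos {t : ℝ} {w : List L} (h : P.Red w ∧ w ≠ []) : rs P t w = ENNReal.ofReal (rr (P.Mw w)) ^ t := by
  simp only [rs]; rw [if_pos h]
lemma rs_neg {t : ℝ} {w : List L} (h : ¬ (P.Red w ∧ w ≠ [])) : rs P t w = 0 := by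
  simp only [rs]; rw [if_neg h]

lemma mob_of_outside {w : List L} (hr : P.Red w) (hw : w ≠ []) {z : ℂ} (hz : ∀ a, ofC z ∉ P.A a) :
    z ≠ pole (P.Mw w) ∧ mobius (P.Mw w) (ofC z) = ofC (mob (P.Mw w) z) := by
  obtain ⟨a, ha⟩ := last_exists hw
  have : z ≠ pole (P.Mw w) := fun h => hz _ (h ▸ pole_mem hr ha)
  exact ⟨this, mobius_ofC_of_ne _ _ (den_ne (c_ne hr hw) this)⟩

lemma sumT [Finite L] {t : ℝ} (ht : 0 ≤ t) {K0 X : Set ℂ} (hK : IsCompact K0)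
    (hout : ∀ z ∈ K0, ∀ a, ofC z ∉ P.A a)
    (hX : ∀ w, P.Red w → w ≠ [] → ∀ z ∈ K0, mob (P.Mw w) z ∈ X)
    (hfin : μH[t] X ≠ ⊤) (hpos : μH[t] K0 ≠ 0) :
    ∑' w : List L, rs P t w ≠ ⊤ := by
  classical
  have : Countable (List L) := inferInstance
  obtain ⟨κ, R, C⟩ := P.exists_Cst
  obtain ⟨R', hR'⟩ := hK.isBounded.exists_norm_le
  let Q : ℝ := (max R' R + R)
  have hQ : 0 < Q := by have := C.R_ge; have := le_max_right R' R; simp only [Q]; linarith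
  let E : List L → Set ℂ := fun w => if P.Red w ∧ w ≠ [] then mob (P.Mw w) '' K0 else ∅
  have hE : ∀ w, P.Red w ∧ w ≠ [] → E w = mob (P.Mw w) '' K0 := fun w h => by simp only [E]; rw [if_pos h]
  have hcont : ∀ w, P.Red w ∧ w ≠ [] → ContinuousOn (mob (P.Mw w)) K0 := by
    intro w h
    unfold mob
    refine ContinuousOn.div (by fun_prop) (by unfold den; fun_prop) fun z hz => ?_
    exact den_ne (c_ne h.1 h.2) (mob_of_outside h.1 h.2 (hout z hz)).1
  have hmeas : ∀ w, MeasurableSet (E w) := by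
    intro w
    by_cases h : P.Red w ∧ w ≠ []
    · rw [hE w h]
      exact (hK.image_of_continuousOn (hcont w h)).isClosed.measurableSet
    · simp only [E]; rw [if_neg h]; exact MeasurableSet.empty
  have hdisj : Pairwise (Function.onFun Disjoint E) := by
    intro w v hne
    simp only [Function.onFun]
    by_cases hw : P.Red w ∧ w ≠ []
    swap
    · simp only [E]; rw [if_neg hw]; exact disjoint_bot_left
    by_cases hv : P.Red v ∧ v ≠ []
    swap
    · simp only [E]; rw [if_neg hv]; exact disjoint_bot_right
    rw [hE w hw, hE v hv, Set.disjoint_left]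
    rintro _ ⟨x, hx, rfl⟩ ⟨y, hy, e⟩
    refine P.translates_ne hw.1 hv.1 hne (hout x hx) (hout y hy) ?_
    rw [(mob_of_outside hw.1 hw.2 (hout x hx)).2, (mob_of_outside hv.1 hv.2 (hout y hy)).2, e]
  have hsumE : ∑' w, μH[t] (E w) ≤ μH[t] X := by
    rw [← measure_iUnion hdisj hmeas]
    refine measure_mono (iUnion_subset fun w => ?_)
    by_cases h : P.Red w ∧ w ≠ []
    · rw [hE w h]; rintro _ ⟨z, hz, rfl⟩; exact hX w h.1 h.2 z hz
    · simp only [E]; rw [if_neg h]; exact empty_subset _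
  let B : ℝ≥0∞ := (ENNReal.ofReal (Q * Q)) ^ t
  have hB : B ≠ ⊤ := ENNReal.rpow_ne_top_of_nonneg ht ENNReal.ofReal_ne_top
  have key : ∀ w, rs P t w * μH[t] K0 ≤ B * μH[t] (E w) := by
    intro w
    by_cases h : P.Red w ∧ w ≠ []
    swap
    · rw [rs_neg h, zero_mul]; exact zero_le
    rw [rs_pos h, hE w h]
    have hc := c_ne h.1 h.2
    have hrpos := rr_pos hc
    -- the inverse is Lipschitz
    have hinj : InjOn (mob (P.Mw w)) K0 := by
      intro x hx y hy e
      have h1 := (mob_of_outside h.1 h.2 (hout x hx)).2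
      have h2 := (mob_of_outside h.1 h.2 (hout y hy)).2
      rw [e, ← h2] at h1
      exact ofC_injective (mobius_injective _ h1)
    let φ := Function.invFunOn (mob (P.Mw w)) K0
    have hφ : ∀ x ∈ K0, φ (mob (P.Mw w) x) = x := fun x hx => hinj.leftInvOn_invFunOn hx
    have hlip : LipschitzOnWith (Real.toNNReal (Q * Q / rr (P.Mw w))) φ (mob (P.Mw w) '' K0) := by
      refine LipschitzOnWith.of_dist_le_mul ?_
      rintro _ ⟨x, hx, rfl⟩ _ ⟨y, hy, rfl⟩
      rw [hφ x hx, hφ y hy, dist_eq_norm, dist_eq_norm, Real.coe_toNNReal _ (by positivity)]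
      have hb : ∀ x ∈ K0, ‖x - pole (P.Mw w)‖ ≤ Q := by
        intro x hx
        obtain ⟨a, ha⟩ := last_exists h.2
        have h1 := C.bd _ _ (pole_mem h.1 ha)
        have h2 := hR' x hx
        have h3 := norm_sub_le x (pole (P.Mw w))
        have := le_max_left R' R
        simp only [Q]; linarith
      have e := norm_mob_sub hc (mob_of_outside h.1 h.2 (hout x hx)).1 (mob_of_outside h.1 h.2 (hout y hy)).1
      rw [div_mul_eq_mul_div, le_div_iff₀ hrpos, mul_comm, ← e, mul_comm]
      have := hb x hx
      have := hb y hy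
      gcongr
    have h1 := hlip.hausdorffMeasure_image_le ht
    have h2 : φ '' (mob (P.Mw w) '' K0) = K0 := by
      ext x; constructor
      · rintro ⟨_, ⟨y, hy, rfl⟩, rfl⟩; rw [hφ y hy]; exact hy
      · intro hx; exact ⟨_, ⟨x, hx, rfl⟩, hφ x hx⟩
    rw [h2] at h1
    calc _ ≤ ENNReal.ofReal (rr (P.Mw w)) ^ t * (((Q * Q / rr (P.Mw w)).toNNReal : ℝ≥0∞) ^ t * μH[t] (mob (P.Mw w) '' K0)) := by gcongr
      _ = _ := by
        rw [← mul_assoc, ← ENNReal.mul_rpow_of_nonneg _ _ ht]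
        congr 2
        change ENNReal.ofReal _ * ENNReal.ofReal _ = _
        rw [← ENNReal.ofReal_mul hrpos.le, mul_div_cancel₀ _ hrpos.ne']
  have h1 : (∑' w : List L, rs P t w) * μH[t] K0 ≤ B * μH[t] X := by
    rw [← ENNReal.tsum_mul_right]
    calc _ ≤ ∑' w, B * μH[t] (E w) := ENNReal.tsum_le_tsum key
      _ = B * ∑' w, μH[t] (E w) := ENNReal.tsum_mul_left
      _ ≤ _ := by gcongr
  intro htop
  rw [htop, ENNReal.top_mul hpos, top_le_iff] at h1
  exact ENNReal.mul_ne_top hB hfin h1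

/-- weights tend to zero -/
lemma rr_small [Finite L] {ε : ℝ} (hε : 0 < ε) : ∃ N, ∀ w, P.Red w → N ≤ w.length → w ≠ [] →
    rr (P.Mw w) < ε := by
  obtain ⟨κ, R, C⟩ := P.exists_Cst
  haveI : (μH[2] : Measure ℂ).IsAddHaarMeasure := by
    have := MeasureTheory.isAddHaarMeasure_hausdorffMeasure (E := ℂ)
    rw [Complex.finrank_real_complex] at this
    exact_mod_cast this
  let K0 : Set ℂ := Metric.closedBall ((R + 2 : ℝ) : ℂ) 1
  have hR := C.R_ge
  have hout : ∀ z ∈ K0, ∀ a, ofC z ∉ P.A a := by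
    intro z hz a ha
    have h1 := C.bd a z ha
    have h2 : ‖z - ((R + 2 : ℝ) : ℂ)‖ ≤ 1 := by rw [← dist_eq_norm]; exact hz
    have h3 := norm_sub_norm_le ((R + 2 : ℝ) : ℂ) z
    rw [norm_sub_rev, Complex.norm_real, Real.norm_of_nonneg (by linarith)] at h3
    linarith
  have := sumT (P := P) (t := 2) (by norm_num) (K0 := K0) (X := Metric.closedBall 0 R)
    (isCompact_closedBall _ _) hout ?_ ?_ ?_
  · have h2 := ENNReal.finite_const_le_of_tsum_ne_top this (ε := ENNReal.ofReal ε ^ (2:ℝ)) (by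
      simp [hε])
    obtain ⟨N, hN⟩ := (h2.image List.length).bddAbove
    refine ⟨N + 1, fun w hw hl hne => ?_⟩
    by_contra hcon
    push Not at hcon
    have : w ∈ {w : List L | ENNReal.ofReal ε ^ (2:ℝ) ≤ rs P 2 w} := by
      rw [mem_setOf_eq, rs_pos ⟨hw, hne⟩]
      exact ENNReal.rpow_le_rpow (ENNReal.ofReal_le_ofReal hcon) (by norm_num)
    have := hN ⟨w, this, rfl⟩
    omega
  · intro w hw hne z hz
    obtain ⟨a, v, rfl⟩ := List.exists_cons_of_ne_nil hne
    have := P.Mw_mem hw (x := ofC z) fun b _ => hout z hz _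
    rw [(mob_of_outside hw hne (hout z hz)).2] at this
    simpa using C.bd _ _ this
  · exact (isCompact_closedBall _ _).measure_ne_top
  · exact (Metric.measure_closedBall_pos _ _ one_pos).ne'

lemma rho_small [Finite L] {κ : ℝ} (hκ : 0 < κ) {ε : ℝ} (hε : 0 < ε) :
    ∃ N, ∀ w, N ≤ w.length → P.rho κ w < ε := by
  obtain ⟨N, hN⟩ := rr_small (P := P) (ε := ε * κ ^ 2) (by positivity)
  refine ⟨N + 1, fun w hw => ?_⟩
  by_cases hr : P.Red w
  · have hne : w ≠ [] := by rintro rfl; simp at hw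
    rw [rho_red hr hne]
    have := hN w hr (by omega) hne
    rw [inv_pow, inv_mul_lt_iff₀ (by positivity)]
    linarith
  · rw [rho_nred hr]; exact hε

lemma Lam_snoc {x : RSphere} (hx : x ∈ P.Lam) (n : ℕ) : ∃ w m, P.Red (w ++ [m]) ∧ w.length = n ∧
    x ∈ P.Cyl (w ++ [m]) := by
  obtain ⟨w, hr, hl, h⟩ := hx (n + 1)
  have hne : w ≠ [] := by rintro rfl; simp at hl
  refine ⟨w.dropLast, w.getLast hne, ?_, by simp [hl], ?_⟩ <;> rwa [List.dropLast_append_getLast]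

lemma Lam_ofC {x : RSphere} (hx : x ∈ P.Lam) : ∃ z, x = ofC z :=
  (sph_cases x).resolve_left fun h => P.inf_nmem_Lam (h ▸ hx)

lemma Lam_eq_limitSet [Finite L] {Γ : Subgroup PSL2C} (h : P.Gen Γ) : limitSet Γ = P.Lam := by
  refine subset_antisymm (P.limitSet_sub_Lam h) fun x hx => ⟨infty, ?_⟩
  obtain ⟨z, rfl⟩ := Lam_ofC hx
  obtain ⟨κ, R, C⟩ := P.exists_Cst
  rw [accPt_iff_nhds]
  intro U hU
  have hU' : ofC ⁻¹' U ∈ 𝓝 z := continuous_ofC.continuousAt.preimage_mem_nhds hU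
  obtain ⟨ε, hε, hb⟩ := Metric.mem_nhds_iff.1 hU'
  obtain ⟨N, hN⟩ := rho_small (P := P) C.κ_pos hε
  obtain ⟨w, m, hr, hl, hz⟩ := Lam_snoc hx (N + 1)
  have hne : w ≠ [] := by rintro rfl; simp at hl
  have hrw := (P.red_append.1 hr).1
  have h1 := cyl_ball C hne hr hz
  have h2 := hN w (by omega)
  refine ⟨mobius (P.Mw w) infty, ⟨?_, ⟨P.Mw w, Gen.Mw_mem P h w, rfl⟩⟩, ?_⟩
  · rw [mobius_inft (c_ne hrw hne)]
    apply hb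
    rw [Metric.mem_ball, dist_comm, dist_eq_norm]
    linarith
  · intro e
    obtain ⟨y, hy, e'⟩ := P.of_mem_Cyl_snoc hz
    rw [← e] at e'
    exact P.inf_nmem m (mobius_injective _ e' ▸ hy)

end PP
end QC
end
end

section
open Filter Set Topology RSphere MeasureTheory
open scoped ENNReal NNReal
noncomputable section
set_option linter.all false
namespace QC
namespace PP
variable {L : Type} {P : PP L}

/-- words of given length -/
def wd (L : Type) [Finite L] (n : ℕ) : Finset (List L) := (List.finite_length_eq L n).toFinset

lemma mem_wd [Finite L] {n : ℕ} {w : List L} : w ∈ wd L n ↔ w.length = n := by simp [wd]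

lemma sum_wd_add [Finite L] (n m : ℕ) (F : List L → ℝ) :
    ∑ w ∈ wd L (n + m), F w = ∑ w ∈ wd L n, ∑ v ∈ wd L m, F (w ++ v) := by
  rw [← Finset.sum_product']
  refine Finset.sum_nbij' (fun w => (w.take n, w.drop n)) (fun p => p.1 ++ p.2) ?_ ?_ ?_ ?_ ?_
  · intro w hw
    simp only [Finset.mem_product, mem_wd] at *
    simp [hw]
  · intro p hp
    simp only [Finset.mem_product, mem_wd] at *
    simp [hp.1, hp.2]
  · intro w hw; simp
  · intro p hp
    simp only [Finset.mem_product, mem_wd] at hp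
    ext1 <;> simp [← hp.1]
  · intro w hw; simp

lemma sum_rho_pow [Finite L] {κ R : ℝ} (C : P.Cst κ R) {s : ℝ} (hs : 0 < s) (n k : ℕ) :
    ∑ w ∈ wd L (k * n), P.rho κ w ^ s ≤ (∑ w ∈ wd L n, P.rho κ w ^ s) ^ k := by
  induction k with
  | zero =>
    have : wd L (0 * n) = {[]} := by ext w; simp [mem_wd]
    rw [this]; simp [rho_nil]
  | succ k ih =>
    rw [Nat.succ_mul, sum_wd_add, pow_succ]
    have h0 : ∀ w : List L, 0 ≤ P.rho κ w ^ s := fun w => Real.rpow_nonneg (rho_nonneg _ _) _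
    calc _ ≤ ∑ w ∈ wd L (k * n), ∑ v ∈ wd L n, P.rho κ w ^ s * P.rho κ v ^ s := by
          refine Finset.sum_le_sum fun w _ => Finset.sum_le_sum fun v _ => ?_
          rw [← Real.mul_rpow (rho_nonneg _ _) (rho_nonneg _ _)]
          exact Real.rpow_le_rpow (rho_nonneg _ _) (rho_append C w v) hs.le
      _ = (∑ w ∈ wd L (k * n), P.rho κ w ^ s) * ∑ v ∈ wd L n, P.rho κ v ^ s := by rw [Finset.sum_mul_sum]
      _ ≤ (∑ w ∈ wd L n, P.rho κ w ^ s) ^ k * ∑ v ∈ wd L n, P.rho κ v ^ s := by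
          gcongr
          exact Finset.sum_nonneg fun v _ => h0 v

/-- summability implies dimension less than one -/
theorem dimH_lt_of_summable [Finite L] {κ R : ℝ} (C : P.Cst κ R) (hs : Summable (P.rho κ)) :
    dimH P.Lam < 1 := by
  -- find level
  obtain ⟨n, hn0, hn⟩ : ∃ n, n ≠ 0 ∧ ∑ w ∈ wd L n, P.rho κ w < 1 := by
    obtain ⟨s, hs'⟩ := summable_iff_vanishing.1 hs (Metric.ball 0 1) (Metric.ball_mem_nhds _ one_pos)
    obtain ⟨N, hN⟩ := (s.finite_toSet.image List.length).bddAbove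
    refine ⟨N + 1, by omega, ?_⟩
    have := hs' (wd L (N + 1)) (by
      rw [Finset.disjoint_left]
      intro w hw hws
      have := hN ⟨w, hws, rfl⟩
      rw [mem_wd] at hw
      omega)
    rw [mem_ball_zero_iff, Real.norm_eq_abs] at this
    exact (le_abs_self _).trans_lt this
  obtain ⟨s, hs0, hs1, hlt⟩ : ∃ s : ℝ, 0 < s ∧ s < 1 ∧ ∑ w ∈ wd L n, P.rho κ w ^ s < 1 := by
    have hc : ContinuousAt (fun s : ℝ => ∑ w ∈ wd L n, P.rho κ w ^ s) 1 := by
      refine tendsto_finsetSum _ fun w _ => ?_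
      exact Real.continuousAt_const_rpow' one_ne_zero
    have h1 : ∀ᶠ s in 𝓝[<] (1:ℝ), ∑ w ∈ wd L n, P.rho κ w ^ s < 1 := by
      refine (hc.tendsto.mono_left nhdsWithin_le_nhds).eventually_lt_const ?_
      simpa using hn
    have h2 : ∀ᶠ s in 𝓝[<] (1:ℝ), s ∈ Ioo (0:ℝ) 1 := Ioo_mem_nhdsLT one_pos
    obtain ⟨s, h3, h4⟩ := (h1.and h2).exists
    exact ⟨s, h4.1, h4.2, h3⟩
  have hθ : 0 ≤ ∑ w ∈ wd L n, P.rho κ w := Finset.sum_nonneg fun w _ => rho_nonneg _ _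
  have hθs : 0 ≤ ∑ w ∈ wd L n, P.rho κ w ^ s := Finset.sum_nonneg fun w _ => Real.rpow_nonneg (rho_nonneg _ _) _
  set θ := ∑ w ∈ wd L n, P.rho κ w with hθdef
  have hle : ∀ k, ∀ w ∈ wd L (k * n), P.rho κ w ≤ θ ^ k := by
    intro k w hw
    have h1 := sum_rho_pow C one_pos n k
    simp only [Real.rpow_one] at h1
    exact (Finset.single_le_sum (fun v _ => rho_nonneg κ v) hw).trans h1
  -- Hausdorff measure
  have hH : μH[s] (ofC ⁻¹' P.Lam) ≤ ENNReal.ofReal (2 ^ s) := by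
    have := MeasureTheory.Measure.hausdorffMeasure_le_liminf_sum (ι := fun k : ℕ => {w // w ∈ wd L (k * n)}) s (ofC ⁻¹' P.Lam)
      (l := atTop) (fun k => ENNReal.ofReal (2 * θ ^ k)) ?_
      (fun k w => Metric.closedBall (inft (P.Mw w.1)) (P.rho κ w.1)) ?_ ?_
    · refine this.trans ?_
      refine liminf_le_of_frequently_le' (Frequently.of_forall fun k => ?_)
      have hd : ∀ w : {w // w ∈ wd L (k * n)}, Metric.ediam (Metric.closedBall (inft (P.Mw w.1)) (P.rho κ w.1)) ^ s
          ≤ ENNReal.ofReal (2 ^ s * P.rho κ w.1 ^ s) := by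
        intro w
        have h1 : Metric.ediam (Metric.closedBall (inft (P.Mw w.1)) (P.rho κ w.1)) ≤
            ENNReal.ofReal (2 * P.rho κ w.1) := by
          rw [← Metric.emetric_closedBall (rho_nonneg _ _)]
          refine EMetric.diam_closedBall.trans ?_
          rw [ENNReal.ofReal_mul zero_le_two]; simp
        refine (ENNReal.rpow_le_rpow h1 hs0.le).trans ?_
        rw [ENNReal.ofReal_rpow_of_nonneg (by have := rho_nonneg (P := P) κ w.1; positivity) hs0.le,
          Real.mul_rpow zero_le_two (rho_nonneg _ _)]
      calc _ ≤ ∑ w : {w // w ∈ wd L (k * n)}, ENNReal.ofReal (2 ^ s * P.rho κ w.1 ^ s) :=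
            Finset.sum_le_sum fun w _ => hd w
        _ = ∑ w ∈ wd L (k * n), ENNReal.ofReal (2 ^ s * P.rho κ w ^ s) :=
            Finset.sum_coe_sort (wd L (k * n)) fun w => ENNReal.ofReal (2 ^ s * P.rho κ w ^ s)
        _ = ENNReal.ofReal (2 ^ s * ∑ w ∈ wd L (k * n), P.rho κ w ^ s) := by
            rw [← ENNReal.ofReal_sum_of_nonneg, Finset.mul_sum]
            intro w _
            have := Real.rpow_nonneg (rho_nonneg (P := P) κ w) s
            positivity
        _ ≤ _ := by
            apply ENNReal.ofReal_le_ofReal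
            have h1 := sum_rho_pow C hs0 n k
            have h2 : (∑ w ∈ wd L n, P.rho κ w ^ s) ^ k ≤ 1 := pow_le_one₀ hθs hlt.le
            have h3 : (0:ℝ) < 2 ^ s := by positivity
            nlinarith
    · have h1 : Tendsto (fun k : ℕ => 2 * θ ^ k) atTop (𝓝 (2 * 0)) :=
        (tendsto_pow_atTop_nhds_zero_of_lt_one hθ hn).const_mul 2
      have := ENNReal.tendsto_ofReal h1
      simpa using this
    · refine Eventually.of_forall fun k w => ?_
      rw [← Metric.emetric_closedBall (rho_nonneg _ _)]
      refine EMetric.diam_closedBall.trans ?_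
      rw [ENNReal.ofReal_mul zero_le_two]
      have := ENNReal.ofReal_le_ofReal (hle k w.1 w.2)
      simp only [ENNReal.ofReal_ofNat]
      gcongr
    · filter_upwards [eventually_ge_atTop 1] with k hk z hz
      obtain ⟨w, m, hr, hl, hc⟩ := Lam_snoc hz (k * n)
      have hne : w ≠ [] := by
        rintro rfl
        simp at hl
        omega
      have := cyl_ball C hne hr hc
      rw [mem_iUnion]
      refine ⟨⟨w, mem_wd.2 hl⟩, ?_⟩
      rw [Metric.mem_closedBall, dist_eq_norm]; exact this
  have h1 : dimH (ofC ⁻¹' P.Lam) ≤ ((NNReal.mk s hs0.le) : ℝ≥0∞) := by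
    apply dimH_le_of_hausdorffMeasure_ne_top
    show μH[s] _ ≠ _
    exact (hH.trans_lt ENNReal.ofReal_lt_top).ne
  have h2 : dimH P.Lam ≤ dimH (ofC ⁻¹' P.Lam) := by
    rw [← image_preimage_ofC P.inf_nmem_Lam]
    have := lipschitz_ofC.dimH_image_le (ofC ⁻¹' P.Lam)
    rwa [image_preimage_ofC P.inf_nmem_Lam] at this ⊢
  refine (h2.trans h1).trans_lt ?_
  rw [← ENNReal.coe_one, ENNReal.coe_lt_coe]
  exact hs1

/-! The converse -/

lemma word_of_set [Finite L] {κ R : ℝ} (C : P.Cst κ R) {t : Set ℂ} {x : ℂ} (hx : ofC x ∈ P.Lam)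
    {η : ℝ} (h0 : 0 < η) (hd : ∀ y ∈ t, ‖x - y‖ < η) :
    ∃ w, P.Red w ∧ κ ^ 3 / (2 * R) ^ 2 * P.rho κ w ≤ η ∧ ∀ y ∈ t, ofC y ∈ P.Lam → ofC y ∈ P.Cyl w := by
  classical
  have hκ := C.κ_pos
  have hR := C.R_ge
  set c0 := κ ^ 3 / (2 * R) ^ 2 with hc0
  have hc0p : 0 < c0 := by rw [hc0]; positivity
  choose w hwr hwl hwx using hx
  have hex : ∃ n, c0 * P.rho κ (w n) ≤ η := by
    obtain ⟨N, hN⟩ := rho_small (P := P) hκ (ε := η / c0) (by positivity)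
    refine ⟨N, ?_⟩
    have := hN (w N) (hwl N).ge
    rw [lt_div_iff₀ hc0p] at this
    linarith
  refine ⟨w (Nat.find hex), hwr _, Nat.find_spec hex, ?_⟩
  have claim : ∀ k ≤ Nat.find hex, ∀ y ∈ t, ofC y ∈ P.Lam → ofC y ∈ P.Cyl (w k) := by
    intro k
    induction k with
    | zero =>
      intro _ y _ _
      have : w 0 = [] := List.length_eq_zero_iff.1 (hwl 0)
      rw [this]; simp
    | succ k ih =>
      intro hk y hy hyL
      have h1 := Nat.find_min hex (Nat.lt_of_succ_le hk)
      push Not at h1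
      have h2 := ih (by omega) y hy hyL
      obtain ⟨v, m, hr, hl, hc⟩ := Lam_snoc hyL k
      have hvk : v = w k := P.Cyl_unique (hl.trans (hwl k).symm) (by rw [Cyl_append] at hc; exact hc.1) h2
      have hne : w (k + 1) ≠ [] := by
        intro h; have := hwl (k + 1); rw [h] at this; simp at this
      obtain ⟨u, m0, hu⟩ : ∃ u m0, w (k + 1) = u ++ [m0] :=
        ⟨_, _, (List.dropLast_append_getLast hne).symm⟩
      have hxu := hwx (k + 1)
      have hru := hwr (k + 1)
      have hlu := hwl (k + 1)
      rw [hu] at hxu hru hlu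
      have huk : u = w k := P.Cyl_unique (by rw [hwl]; simpa using hlu)
        (by rw [Cyl_append] at hxu; exact hxu.1) (hwx k)
      by_cases hmm : m0 = m
      · rw [hu, hmm, huk, ← hvk]; exact hc
      · exfalso
        rw [huk] at hxu hru
        rw [hvk] at hc hr
        have := cyl_sep C hmm hru hr hxu hc
        have := hd y hy
        linarith
  exact claim _ le_rfl

end PP
end QC
end
end

section
open Filter Set Topology RSphere MeasureTheory
open scoped ENNReal NNReal
noncomputable section
set_option linter.all false
namespace QC

instance sphereCompact : CompactSpace RSphere := by
  refine ⟨isCompact_iff_ultrafilter_le_nhds.2 fun f _ => ?_⟩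
  by_cases h : (f : Filter RSphere) ≤ 𝓝 infty
  · exact ⟨_, mem_univ _, h⟩
  · rw [Filter.le_def] at h
    push Not at h
    obtain ⟨U, hU, hUf⟩ := h
    obtain ⟨R, hR, h'⟩ := nhds_infty hU
    have h1 : Uᶜ ∈ f := Ultrafilter.compl_mem_iff_notMem.2 hUf
    have h2 : ofC '' Metric.closedBall 0 R ∈ f := by
      refine Filter.mem_of_superset h1 fun x hx => ?_
      rcases sph_cases x with rfl | ⟨z, rfl⟩
      · exact absurd (mem_of_mem_nhds hU) hx
      · refine ⟨z, ?_, rfl⟩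
        by_contra hc
        exact hx (h' z (by simpa using hc))
    have hc : IsCompact (ofC '' Metric.closedBall 0 R) := (isCompact_closedBall _ _).image continuous_ofC
    obtain ⟨x, _, hx⟩ := isCompact_iff_ultrafilter_le_nhds.1 hc f (le_principal_iff.2 h2)
    exact ⟨x, mem_univ _, hx⟩

namespace PP
variable {L : Type} {P : PP L}

lemma exists_words [Finite L] {κ R : ℝ} (C : P.Cst κ R) (h : μH[1] (ofC ⁻¹' P.Lam) = 0) :
    ∃ (J : Type) (w : J → List L), (∀ j, P.Red (w j)) ∧ (∑' j, ENNReal.ofReal (P.rho κ (w j)) ≤ 1 / 2) ∧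
      ∀ x, ofC x ∈ P.Lam → ∃ j, ofC x ∈ P.Cyl (w j) := by
  have hκ := C.κ_pos
  have hR := C.R_ge
  have hc0p : 0 < κ ^ 3 / (2 * R) ^ 2 := by positivity
  have hw := fun t x hx η h0 hd => word_of_set (P := P) C (t := t) (x := x) hx (η := η) h0 hd
  generalize κ ^ 3 / (2 * R) ^ 2 = c0 at hc0p hw
  have hpos : ENNReal.ofReal (c0 / 4) ≠ 0 := by
    simp only [ne_eq, ENNReal.ofReal_eq_zero, not_le]; positivity
  obtain ⟨t, hcov, hd1, hsum⟩ : ∃ t : ℕ → Set ℂ, ofC ⁻¹' P.Lam ⊆ ⋃ n, t n ∧ (∀ n, Metric.ediam (t n) ≤ 1) ∧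
      ∑' n, (⨆ _ : (t n).Nonempty, Metric.ediam (t n) ^ (1:ℝ)) < ENNReal.ofReal (c0 / 4) := by
    rw [Measure.hausdorffMeasure_apply] at h
    have h1 : (⨅ (t : ℕ → Set ℂ) (_ : ofC ⁻¹' P.Lam ⊆ ⋃ n, t n) (_ : ∀ n, Metric.ediam (t n) ≤ 1),
        ∑' n, ⨆ _ : (t n).Nonempty, Metric.ediam (t n) ^ (1:ℝ)) < ENNReal.ofReal (c0 / 4) := by
      refine lt_of_le_of_lt ?_ (pos_iff_ne_zero.2 hpos)
      rw [← h]
      exact le_iSup₂_of_le (1:ℝ≥0∞) zero_lt_one le_rfl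
    simp only [iInf_lt_iff] at h1
    obtain ⟨t, a, b, c⟩ := h1
    exact ⟨t, a, b, c⟩
  obtain ⟨δ, hδ, hδs⟩ := ENNReal.exists_pos_sum_of_countable hpos ℕ
  let J := {j : ℕ // (t j ∩ ofC ⁻¹' P.Lam).Nonempty}
  have hex : ∀ j : J, ∃ w, P.Red w ∧ c0 * P.rho κ w ≤ (Metric.ediam (t j.1)).toReal + δ j.1 ∧
      ∀ y ∈ t j.1, ofC y ∈ P.Lam → ofC y ∈ P.Cyl w := by
    rintro ⟨j, x, hx, hxL⟩
    have hfin : Metric.ediam (t j) ≠ ⊤ := ((hd1 j).trans_lt ENNReal.one_lt_top).ne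
    have hδj : (0:ℝ) < δ j := hδ j
    refine hw (t j) x hxL _ (by have := ENNReal.toReal_nonneg (a := Metric.ediam (t j)); linarith) fun y hy => ?_
    have h1 : edist x y ≤ Metric.ediam (t j) := Metric.edist_le_ediam_of_mem hx hy
    have h2 := ENNReal.toReal_mono hfin h1
    rw [← dist_edist, dist_eq_norm] at h2
    linarith
  choose w hwr hwl hwc using hex
  refine ⟨J, w, hwr, ?_, ?_⟩
  · have hle : ∀ j : J, ENNReal.ofReal c0 * ENNReal.ofReal (P.rho κ (w j)) ≤
        (⨆ _ : (t j.1).Nonempty, Metric.ediam (t j.1) ^ (1:ℝ)) + δ j.1 := by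
      intro j
      have hfin : Metric.ediam (t j.1) ≠ ⊤ := ((hd1 j.1).trans_lt ENNReal.one_lt_top).ne
      rw [← ENNReal.ofReal_mul hc0p.le]
      refine (ENNReal.ofReal_le_ofReal (hwl j)).trans ?_
      rw [ENNReal.ofReal_add ENNReal.toReal_nonneg (by positivity), ENNReal.ofReal_toReal hfin,
        ENNReal.ofReal_coe_nnreal]
      gcongr
      rw [ENNReal.rpow_one]
      exact le_iSup_of_le (j.2.mono inter_subset_left) le_rfl
    have h1 : ENNReal.ofReal c0 * ∑' j, ENNReal.ofReal (P.rho κ (w j)) ≤ ENNReal.ofReal c0 * (1 / 2) := by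
      rw [← ENNReal.tsum_mul_left]
      calc _ ≤ ∑' j : J, ((⨆ _ : (t j.1).Nonempty, Metric.ediam (t j.1) ^ (1:ℝ)) + δ j.1) := ENNReal.tsum_le_tsum hle
        _ ≤ ∑' j : ℕ, ((⨆ _ : (t j).Nonempty, Metric.ediam (t j) ^ (1:ℝ)) + δ j) :=
            ENNReal.tsum_comp_le_tsum_of_injective Subtype.val_injective
              (fun j : ℕ => ((⨆ _ : (t j).Nonempty, Metric.ediam (t j) ^ (1:ℝ)) + (δ j : ℝ≥0∞)))
        _ ≤ ENNReal.ofReal (c0 / 4) + ENNReal.ofReal (c0 / 4) := by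
            rw [ENNReal.tsum_add]; exact add_le_add hsum.le hδs.le
        _ = _ := by
            rw [← ENNReal.ofReal_add (by positivity) (by positivity)]
            have : (1/2 : ℝ≥0∞) = ENNReal.ofReal (1/2) := by
              rw [ENNReal.ofReal_div_of_pos two_pos]; simp
            rw [this, ← ENNReal.ofReal_mul hc0p.le]
            congr 1; ring
    have hne : ENNReal.ofReal c0 ≠ 0 := by simp only [ne_eq, ENNReal.ofReal_eq_zero, not_le]; exact hc0p
    exact (ENNReal.mul_le_mul_iff_right hne ENNReal.ofReal_ne_top).1 h1
  · intro x hx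
    obtain ⟨j, hj⟩ := mem_iUnion.1 (hcov hx)
    exact ⟨⟨j, x, hj, hx⟩, hwc _ x hj hx⟩

lemma words_prefix [Finite L] {J : Type} {w : J → List L} (hcov : ∀ x, ofC x ∈ P.Lam → ∃ j, ofC x ∈ P.Cyl (w j)) :
    ∃ N, ∀ v, P.Red v → N ≤ v.length → ∃ j, w j <+: v := by
  let F : ℕ → Set RSphere := fun n => ⋃ v ∈ {v : List L | v.length = n ∧ P.Red v ∧ ∀ j, ¬ w j <+: v}, P.Cyl v
  have hanti : ∀ n, F (n + 1) ⊆ F n := by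
    intro n x hx
    simp only [F, mem_iUnion, mem_setOf_eq, exists_prop] at hx ⊢
    obtain ⟨v, ⟨hl, hr, hp⟩, hv⟩ := hx
    refine ⟨v.take n, ⟨by simp [hl], hr.take n, fun j hj => hp j (hj.trans (List.take_prefix n v))⟩, ?_⟩
    rw [← List.take_append_drop n v, Cyl_append] at hv
    exact hv.1
  have hcl : ∀ n, IsClosed (F n) := fun n =>
    ((List.finite_length_eq L n).subset (fun v hv => hv.1)).isClosed_biUnion fun v _ => P.isClosed_Cyl v
  by_contra hno
  push Not at hno
  have hne : ∀ n, (F n).Nonempty := by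
    intro n
    obtain ⟨v, hr, hl, hp⟩ := hno n
    refine ⟨mobius (P.Mw (v.take n)) infty, ?_⟩
    simp only [F, mem_iUnion, mem_setOf_eq, exists_prop]
    exact ⟨v.take n, ⟨by simp [hl], hr.take n, fun j hj => hp j (hj.trans (List.take_prefix n v))⟩,
      P.Mw_inf_mem (hr.take n)⟩
  obtain ⟨x, hx⟩ := IsCompact.nonempty_iInter_of_sequence_nonempty_isCompact_isClosed F hanti hne
    (hcl 0).isCompact hcl
  rw [mem_iInter] at hx
  have hxL : x ∈ P.Lam := by
    intro n
    have := hx n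
    simp only [F, mem_iUnion, mem_setOf_eq, exists_prop] at this
    obtain ⟨v, ⟨hl, hr, hp⟩, hv⟩ := this
    exact ⟨v, hr, hl, hv⟩
  rcases sph_cases x with rfl | ⟨z, rfl⟩
  · exact P.inf_nmem_Lam hxL
  obtain ⟨j, hj⟩ := hcov z hxL
  have := hx (w j).length
  simp only [F, mem_iUnion, mem_setOf_eq, exists_prop] at this
  obtain ⟨v, ⟨hl, hr, hp⟩, hv⟩ := this
  have e := P.Cyl_unique hl hv hj
  exact hp j (by rw [e])

theorem summable_of_null [Finite L] {κ R : ℝ} (C : P.Cst κ R) (h : μH[1] (ofC ⁻¹' P.Lam) = 0) :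
    Summable (P.rho κ) := by
  classical
  obtain ⟨J, w, hwr, hsum, hcov⟩ := exists_words C h
  obtain ⟨N, hN⟩ := words_prefix hcov
  let f : ℕ → List L → ℝ≥0∞ := fun M v => if v.length < M then ENNReal.ofReal (P.rho κ v) else 0
  have hTfin : ∀ M, ∑' v, f M v ≠ ⊤ := by
    intro M
    rw [tsum_eq_sum (s := (List.finite_length_lt L M).toFinset) (fun v hv => by
      simp only [f]; rw [if_neg]; simpa using hv)]
    refine (ENNReal.sum_lt_top.2 fun v _ => ?_).ne
    simp only [f]; split_ifs <;> simp
  have key : ∀ M, ∑' v, f M v ≤ 2 * ∑' v, f N v := by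
    intro M
    have hex : ∀ v : {v : List L // P.Red v ∧ N ≤ v.length}, ∃ p : J × List L, w p.1 ++ p.2 = v.1 := by
      rintro ⟨v, hr, hl⟩
      obtain ⟨j, u, hu⟩ := hN v hr hl
      exact ⟨(j, u), hu⟩
    choose φ hφ using hex
    have hinj : Function.Injective φ := by
      intro v v' e
      apply Subtype.ext
      rw [← hφ, ← hφ, e]
    have h1 : ∑' v, f M v ≤ ∑' v, f N v + 1 / 2 * ∑' v, f M v := by
      calc ∑' v, f M v ≤ ∑' v, (f N v + if P.Red v ∧ N ≤ v.length then f M v else 0) := by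
            refine ENNReal.tsum_le_tsum fun v => ?_
            by_cases hr : P.Red v
            · by_cases hl : N ≤ v.length
              · rw [if_pos ⟨hr, hl⟩]; exact le_add_self
              · refine le_trans ?_ le_self_add
                simp only [f]; rw [if_pos (not_le.1 hl)]
                split_ifs <;> simp
            · simp only [f, rho_nred hr]; simp
        _ = ∑' v, f N v + ∑' v, (if P.Red v ∧ N ≤ v.length then f M v else 0) := ENNReal.tsum_add
        _ ≤ _ := by
          gcongr
          have e1 : ∑' v, (if P.Red v ∧ N ≤ v.length then f M v else 0) =
              ∑' v : {v : List L // P.Red v ∧ N ≤ v.length}, f M v.1 := by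
            refine Eq.trans ?_ (tsum_subtype {v : List L | P.Red v ∧ N ≤ v.length} (f M)).symm
            refine tsum_congr fun v => ?_
            simp [indicator, mem_setOf_eq]
          rw [e1]
          calc _ ≤ ∑' v : {v : List L // P.Red v ∧ N ≤ v.length},
                (fun p : J × List L => ENNReal.ofReal (P.rho κ (w p.1)) * f M p.2) (φ v) := by
                refine ENNReal.tsum_le_tsum fun v => ?_
                simp only [f]
                have hv := hφ v
                by_cases hl : v.1.length < M
                · rw [if_pos hl, if_pos (by rw [← hv] at hl; simp at hl; omega),
                    ← ENNReal.ofReal_mul (rho_nonneg _ _)]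
                  apply ENNReal.ofReal_le_ofReal
                  rw [← hv]; exact rho_append C _ _
                · rw [if_neg hl]; exact zero_le
            _ ≤ ∑' p : J × List L, ENNReal.ofReal (P.rho κ (w p.1)) * f M p.2 :=
                ENNReal.tsum_comp_le_tsum_of_injective hinj _
            _ = (∑' j, ENNReal.ofReal (P.rho κ (w j))) * ∑' v, f M v := by
                rw [ENNReal.tsum_prod', ← ENNReal.tsum_mul_right]
                refine tsum_congr fun j => ?_
                simp only [ENNReal.tsum_mul_left]
            _ ≤ _ := by gcongr
    have hM := hTfin M
    have hN' := hTfin N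
    generalize ∑' v, f M v = a at *
    generalize ∑' v, f N v = b at *
    lift a to ℝ≥0 using hM
    lift b to ℝ≥0 using hN'
    have h2 : (1/2 : ℝ≥0∞) = ((1/2 : ℝ≥0) : ℝ≥0∞) := by norm_num
    rw [h2] at h1
    norm_cast at h1 ⊢
    rw [← NNReal.coe_le_coe] at h1 ⊢
    push_cast at h1 ⊢
    linarith
  have hfin : ∑' v, ENNReal.ofReal (P.rho κ v) ≤ 2 * ∑' v, f N v := by
    rw [ENNReal.tsum_eq_iSup_sum]
    refine iSup_le fun s => ?_
    obtain ⟨M, hM⟩ := (s.finite_toSet.image List.length).bddAbove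
    refine le_trans ?_ (key (M + 1))
    refine le_trans ?_ (ENNReal.sum_le_tsum s)
    refine Finset.sum_le_sum fun v hv => ?_
    have := hM ⟨v, hv, rfl⟩
    simp only [f]; rw [if_pos (by omega)]
  have hne : ∑' v, ENNReal.ofReal (P.rho κ v) ≠ ⊤ :=
    (hfin.trans_lt (ENNReal.mul_lt_top (by simp) (lt_top_iff_ne_top.2 (hTfin N)))).ne
  have := ENNReal.summable_toReal hne
  refine this.congr fun v => ?_
  rw [ENNReal.toReal_ofReal (rho_nonneg _ _)]

lemma summable_of_rs {κ R : ℝ} (C : P.Cst κ R) (h : ∑' w : List L, rs P 1 w ≠ ⊤) :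
    Summable (P.rho κ) := by
  classical
  have h1 := (ENNReal.summable_toReal h).mul_left ((κ⁻¹) ^ 2)
  have h2 : Summable (fun w : List L => if w = [] then (1:ℝ) else 0) :=
    summable_of_ne_finset_zero (s := {[]}) (by intro w hw; simp at hw; simp [hw])
  refine (h1.add h2).congr fun w => ?_
  by_cases hr : P.Red w
  · by_cases hw : w = []
    · subst hw; rw [rho_nil, rs_neg (by simp)]; simp
    · rw [rho_red hr hw, rs_pos ⟨hr, hw⟩]; simp [hw, rr_nonneg]
  · have hw : w ≠ [] := by rintro rfl; exact hr P.red_nil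
    rw [rho_nred hr, rs_neg (by tauto)]; simp [hw]

end PP
end QC
end
end

section
open Filter Set Topology RSphere MeasureTheory
open scoped ENNReal NNReal
noncomputable section
set_option linter.all false
namespace QC

lemma coe_mem_unit (z : Circle) : (z : ℂ) ∈ unitCircle := by
  simp only [unitCircle, mem_sphere_iff_norm, sub_zero]; exact Circle.norm_coe z
lemma unit_mem {z : ℂ} (h : z ∈ unitCircle) : z ∈ Submonoid.unitSphere ℂ := h

lemma jordan_param {η : Set RSphere} (h : IsJordanCurve η) {T : ℝ} (hT : T ≠ 0) :
    ∃ g : ℝ → RSphere, Continuous g ∧ range g = η ∧ ∀ s t, g s = g t ↔ ∃ n : ℤ, s = t + n * T := by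
  obtain ⟨f, hc, hi, rfl⟩ := h
  let e := AddCircle.homeomorphCircle hT
  have hm : ∀ z : Circle, (z : ℂ) ∈ unitCircle := fun z => coe_mem_unit z
  refine ⟨fun t => f (e (t : AddCircle T)), ?_, ?_, ?_⟩
  · refine hc.comp_continuous ?_ fun t => hm _
    exact continuous_subtype_val.comp (e.continuous.comp (AddCircle.continuous_mk' T))
  · apply Subset.antisymm
    · rintro _ ⟨t, rfl⟩; exact ⟨_, hm _, rfl⟩
    · rintro _ ⟨z, hz, rfl⟩
      obtain ⟨t, ht⟩ := QuotientAddGroup.mk_surjective (e.symm ⟨z, unit_mem hz⟩)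
      refine ⟨t, ?_⟩
      show f (e (t : AddCircle T)) = f z
      have : (t : AddCircle T) = e.symm ⟨z, unit_mem hz⟩ := ht
      rw [this]; erw [e.apply_symm_apply]
  · intro s t
    constructor
    · intro h
      have h1 := hi (hm _) (hm _) h
      have h2 := e.injective (Subtype.ext h1)
      rw [QuotientAddGroup.eq] at h2
      obtain ⟨n, hn⟩ := AddSubgroup.mem_zmultiples_iff.1 h2
      refine ⟨-n, ?_⟩
      rw [zsmul_eq_mul] at hn
      push_cast; linarith
    · rintro ⟨n, rfl⟩
      have : ((t + n * T : ℝ) : AddCircle T) = t := by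
        rw [AddCircle.coe_add, ← zsmul_eq_mul, AddCircle.coe_zsmul, AddCircle.coe_period]; simp
      simp only [this]

lemma jordan_of_param {g : ℝ → RSphere} (hc : Continuous g) {T : ℝ} (hT : T ≠ 0)
    (hp : ∀ t, g (t + T) = g t) (hi : ∀ s t, g s = g t → ∃ n : ℤ, s = t + n * T) : IsJordanCurve (range g) := by
  let e := AddCircle.homeomorphCircle hT
  have hp' : Function.Periodic g T := hp
  let G : AddCircle T → RSphere := hp'.lift
  have hG : ∀ t : ℝ, G t = g t := fun t => hp'.lift_coe t
  have hGc : Continuous G := hc.quotient_lift _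
  have hm : ∀ z : ℂ, z ∈ unitCircle → z ∈ Submonoid.unitSphere ℂ := fun z h => unit_mem h
  let f : ℂ → RSphere := fun z => open Classical in if h : z ∈ unitCircle then G (e.symm ⟨z, hm z h⟩) else infty
  have hf : ∀ z (h : z ∈ unitCircle), f z = G (e.symm ⟨z, hm z h⟩) := fun z h => by simp only [f]; rw [dif_pos h]
  have hf' : ∀ z : Circle, f z = G (e.symm z) := fun z => hf z (coe_mem_unit z)
  refine ⟨f, ?_, ?_, ?_⟩
  · rw [continuousOn_iff_continuous_restrict]
    have : unitCircle.domRestrict f = fun z : unitCircle => G (e.symm ⟨z.1, hm _ z.2⟩) := by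
      ext z; exact hf z.1 z.2
    rw [this]
    exact hGc.comp (e.symm.continuous.comp (Continuous.subtype_mk continuous_subtype_val _))
  · intro z hz w hw h
    rw [hf z hz, hf w hw] at h
    obtain ⟨s, hs⟩ := QuotientAddGroup.mk_surjective (e.symm ⟨z, hm z hz⟩)
    obtain ⟨t, ht⟩ := QuotientAddGroup.mk_surjective (e.symm ⟨w, hm w hw⟩)
    rw [← hs, ← ht] at h
    have h' : g s = g t := by rw [← hG, ← hG]; exact h
    obtain ⟨n, rfl⟩ := hi _ _ h'
    have : ((t + n * T : ℝ) : AddCircle T) = t := by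
      rw [AddCircle.coe_add, ← zsmul_eq_mul, AddCircle.coe_zsmul, AddCircle.coe_period]; simp
    have h3 : e.symm ⟨z, hm z hz⟩ = e.symm ⟨w, hm w hw⟩ := by
      rw [← hs, ← ht]; exact this
    have := e.symm.injective h3
    exact congrArg Subtype.val this
  · apply Subset.antisymm
    · rintro _ ⟨t, rfl⟩
      refine ⟨(e (t : AddCircle T) : Circle), coe_mem_unit _, ?_⟩
      rw [hf', e.symm_apply_apply, hG]
    · rintro _ ⟨z, hz, rfl⟩
      rw [hf z hz]
      obtain ⟨s, hs⟩ := QuotientAddGroup.mk_surjective (e.symm ⟨z, hm z hz⟩)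
      rw [← hs]
      exact ⟨s, (hG s).symm⟩

lemma hausdorff_pos {K : Set ℂ} (hK : IsPreconnected K) {p q : ℂ} (hp : p ∈ K) (hq : q ∈ K) (hpq : p ≠ q) :
    μH[1] K ≠ 0 := by
  intro h0
  have hl : LipschitzWith 1 (fun z : ℂ => dist z p) := LipschitzWith.dist_left p
  have h1 := (hl.lipschitzOnWith (s := K)).hausdorffMeasure_image_le (d := 1) zero_le_one
  rw [h0] at h1
  have h2 : Icc 0 (dist q p) ⊆ (fun z : ℂ => dist z p) '' K := by
    have := (hK.image _ hl.continuous.continuousOn).Icc_subset ⟨p, hp, rfl⟩ ⟨q, hq, rfl⟩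
    simpa using this
  have h3 : μH[1] (Icc 0 (dist q p)) = 0 := by
    refine le_antisymm ((measure_mono h2).trans (h1.trans (by simp))) zero_le
  rw [hausdorffMeasure_real, Real.volume_Icc] at h3
  simp at h3
  exact hpq h3.symm

namespace PP
variable {L : Type} {P : PP L}

lemma Lam_meets (a : L) : ∃ x ∈ P.Lam, x ∈ P.A a := by
  have hr : ∀ n, P.Red (List.replicate n a) := by
    intro n
    induction n with
    | zero => exact P.red_nil
    | succ n ih =>
      cases n with
      | zero => exact P.red_single a
      | succ n =>
        rw [List.replicate_succ, List.replicate_succ, red_cons_cons]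
        exact ⟨fun h => P.inv_ne a h.symm, by rwa [List.replicate_succ] at ih⟩
  have hanti : ∀ n, P.Cyl (List.replicate (n + 1) a) ⊆ P.Cyl (List.replicate n a) := by
    intro n
    rw [List.replicate_succ', Cyl_append]; exact inter_subset_left
  obtain ⟨x, hx⟩ := IsCompact.nonempty_iInter_of_sequence_nonempty_isCompact_isClosed
    (fun n => P.Cyl (List.replicate n a)) hanti (fun n => ⟨_, P.Mw_inf_mem (hr n)⟩)
    (P.isClosed_Cyl _).isCompact (fun n => P.isClosed_Cyl _)
  rw [mem_iInter] at hx
  refine ⟨x, fun n => ⟨_, hr n, by simp, hx n⟩, ?_⟩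
  have := hx 1
  rwa [List.replicate_one, Cyl_single] at this

theorem backward [Finite L] {Γ : Subgroup PSL2C} (h : P.Gen Γ) (a b : L) (hab : a ≠ b) {η : Set RSphere}
    (hq : IsQuasiCircle Γ η) (hrect : Rectifiable η) : dimH P.Lam < 1 := by
  obtain ⟨hj, hL, hinv⟩ := hq
  rw [Lam_eq_limitSet h] at hL
  obtain ⟨g, hgc, hgr, hgi⟩ := jordan_param hj one_ne_zero
  have hclU : IsClosed (⋃ c, P.A c) := isClosed_iUnion_of_finite P.closed
  obtain ⟨t0, ht0⟩ : ∃ t, g t ∉ ⋃ c, P.A c := by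
    by_contra! hall
    have hcon : IsPreconnected η := by rw [← hgr]; exact isPreconnected_range hgc
    rw [isPreconnected_closed_iff] at hcon
    have h2 : IsClosed (⋃ c : {c // c ≠ a}, P.A c.1) := isClosed_iUnion_of_finite fun c => P.closed c.1
    obtain ⟨x, hx, hxa⟩ := P.Lam_meets a
    obtain ⟨y, hy, hyb⟩ := P.Lam_meets b
    obtain ⟨z, hz, hza, hzb⟩ := hcon (P.A a) (⋃ c : {c // c ≠ a}, P.A c.1) (P.closed a) h2 (by
      rw [← hgr]; rintro _ ⟨t, rfl⟩
      obtain ⟨c, hc⟩ := mem_iUnion.1 (hall t)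
      by_cases hca : c = a
      · left; rw [← hca]; exact hc
      · right; exact mem_iUnion.2 ⟨⟨c, hca⟩, hc⟩) ⟨x, hL hx, hxa⟩ ⟨y, hL hy, mem_iUnion.2 ⟨⟨b, hab.symm⟩, hyb⟩⟩
    obtain ⟨⟨c, hc⟩, hzc⟩ := mem_iUnion.1 hzb
    exact (P.disj a c hc.symm).le_bot ⟨hza, hzc⟩
  have hopen : IsOpen {t | g t ∉ ⋃ c, P.A c} := hclU.isOpen_compl.preimage hgc
  have hinj : ∀ s t, s < t → t < s + 1 → g s ≠ g t := by
    intro s t h1 h2 e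
    obtain ⟨n, hn⟩ := (hgi s t).1 e
    have h3 : (n:ℝ) < 0 := by linarith
    have h4 : (-1:ℝ) < n := by linarith
    have h5 : n < 0 := by exact_mod_cast h3
    have h6 : -1 < n := by exact_mod_cast h4
    omega
  obtain ⟨t1, ht1, ht1'⟩ : ∃ t, g t ∉ (⋃ c, P.A c) ∧ g t ≠ infty := by
    by_cases hi : g t0 = infty
    · obtain ⟨ε, hε, hball⟩ := Metric.isOpen_iff.1 hopen t0 ht0
      refine ⟨t0 + min (ε / 2) (1/2), hball ?_, ?_⟩
      · rw [Metric.mem_ball, Real.dist_eq]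
        have : 0 < min (ε / 2) (1/2) := by positivity
        rw [add_sub_cancel_left, abs_of_pos this]
        exact (min_le_left _ _).trans_lt (by linarith)
      · rw [← hi]
        have : 0 < min (ε / 2) (1/2) := by positivity
        have h2 := min_le_right (ε / 2) (1/2)
        exact (hinj _ _ (by linarith) (by linarith)).symm
    · exact ⟨t0, ht0, hi⟩
  have hopen2 : IsOpen {t | g t ∉ (⋃ c, P.A c) ∧ g t ≠ infty} :=
    hopen.inter (isClosed_singleton.isOpen_compl.preimage hgc)
  obtain ⟨ε, hε, hball⟩ := Metric.isOpen_iff.1 hopen2 t1 ⟨ht1, ht1'⟩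
  set δ := min (ε / 2) (1/2) with hδ
  have hδ0 : 0 < δ := by positivity
  have hδ1 : δ ≤ 1/2 := min_le_right _ _
  have hδ2 : δ ≤ ε/2 := min_le_left _ _
  have hI : ∀ t ∈ Icc t1 (t1 + δ), g t ∉ (⋃ c, P.A c) ∧ g t ≠ infty := by
    intro t ht
    apply hball
    rw [Metric.mem_ball, Real.dist_eq, abs_of_nonneg (by linarith [ht.1])]
    linarith [ht.2]
  have hcT : ContinuousOn (fun t => toC (g t)) (Icc t1 (t1 + δ)) :=
    continuousOn_toC.comp hgc.continuousOn fun t ht => (hI t ht).2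
  set K0 := (fun t => toC (g t)) '' Icc t1 (t1 + δ) with hK0
  have hKc : IsCompact K0 := isCompact_Icc.image_of_continuousOn hcT
  have hKconn : IsPreconnected K0 := isPreconnected_Icc.image _ hcT
  have hKη : ∀ z ∈ K0, ofC z ∈ η ∧ ∀ c, ofC z ∉ P.A c := by
    rintro _ ⟨t, ht, rfl⟩
    have := hI t ht
    simp only [ofC_toC this.2]
    exact ⟨hgr ▸ mem_range_self t, fun c hc => this.1 (mem_iUnion.2 ⟨c, hc⟩)⟩
  have hKpos : μH[1] K0 ≠ 0 := by
    have m1 : t1 ∈ Icc t1 (t1 + δ) := ⟨le_rfl, by linarith⟩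
    have m2 : t1 + δ ∈ Icc t1 (t1 + δ) := ⟨by linarith, le_rfl⟩
    refine hausdorff_pos hKconn ⟨t1, m1, rfl⟩ ⟨t1 + δ, m2, rfl⟩ fun e => ?_
    have := congrArg ofC e
    simp only [ofC_toC (hI _ m1).2, ofC_toC (hI _ m2).2] at this
    exact hinj _ _ (by linarith) (by linarith) this
  obtain ⟨κ, R, C⟩ := P.exists_Cst
  set X := ofC ⁻¹' (η ∩ ⋃ c, P.A c) with hX
  have hXfin : μH[1] X ≠ ⊤ := by
    obtain ⟨K, hK⟩ := lipschitzOn_toC R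
    have hsub : (η ∩ ⋃ c, P.A c) ⊆ ofC '' Metric.closedBall 0 R := by
      rintro x ⟨hx, hxA⟩
      obtain ⟨c, hc⟩ := mem_iUnion.1 hxA
      have hne : x ≠ infty := fun e => P.inf_nmem c (e ▸ hc)
      obtain ⟨z, rfl⟩ := (sph_cases x).resolve_left hne
      exact ⟨z, by simpa using C.bd c z hc, rfl⟩
    have h1 := (hK.mono hsub).hausdorffMeasure_image_le (d := 1) zero_le_one
    have h2 : X ⊆ toC '' (η ∩ ⋃ c, P.A c) := fun z hz => ⟨ofC z, hz, toC_ofC z⟩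
    refine ((measure_mono h2).trans h1).trans_lt ?_ |>.ne
    refine ENNReal.mul_lt_top (by simp) ((measure_mono inter_subset_left).trans_lt hrect)
  have hmem : ∀ w, P.Red w → w ≠ [] → ∀ z ∈ K0, mob (P.Mw w) z ∈ X := by
    intro w hr hw z hz
    have h1 := hKη z hz
    have h2 := (mob_of_outside hr hw h1.2).2
    show ofC _ ∈ η ∩ ⋃ c, P.A c
    rw [← h2]
    refine ⟨?_, ?_⟩
    · rw [← hinv _ (h.Mw_mem P w)]; exact ⟨_, h1.1, rfl⟩
    · obtain ⟨c, v, rfl⟩ := List.exists_cons_of_ne_nil hw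
      exact mem_iUnion.2 ⟨c, P.Mw_mem hr fun d _ => h1.2 _⟩
  exact dimH_lt_of_summable C (summable_of_rs C (sumT zero_le_one hKc (fun z hz => (hKη z hz).2) hmem hXfin hKpos))

end PP
end QC
end
end

section
open Filter Set Topology RSphere MeasureTheory
open scoped ENNReal NNReal
noncomputable section
set_option linter.all false
namespace QC

/-- marked points and connecting arcs for a ping-pong system -/
structure Marks {L : Type} (P : PP L) where
  nxt : L → L
  cyc : ∀ a b, ∃ i < Nat.card L, nxt^[i] a = b
  s : L → ℂ
  t : L → ℂ
  hs : ∀ a, ofC (s a) ∈ P.A a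
  ht : ∀ a, ofC (t a) ∈ P.A a
  hst : ∀ a, s a ≠ t a
  hM1 : ∀ a, mobius (P.M a) (ofC (t (P.inv a))) = ofC (s a)
  hM2 : ∀ a, mobius (P.M a) (ofC (s (P.inv a))) = ofC (t a)
  c : L → ℝ → ℂ
  cont : ∀ a, ContinuousOn (c a) (Icc 0 1)
  inj : ∀ a, InjOn (c a) (Icc 0 1)
  c0 : ∀ a, c a 0 = t a
  c1 : ∀ a, c a 1 = s (nxt a)
  cdisj : ∀ a b, a ≠ b → Disjoint (c a '' Icc 0 1) (c b '' Icc 0 1)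
  out : ∀ a, ∀ u ∈ Ioo (0:ℝ) 1, ∀ b, ofC (c a u) ∉ P.A b
  fin : ∀ a, μH[1] (c a '' Icc 0 1) < ⊤

namespace Marks
variable {L : Type} [Finite L] {P : PP L} (D : Marks P)

/-- number of letters -/
def n (D : Marks P) : ℕ := Nat.card L
/-- total length parameter -/
def ell (D : Marks P) : ℝ := 2 * D.n - 1

lemma two_le (a : L) : 2 ≤ D.n := by
  have := Finite.one_lt_card_iff_nontrivial (α := L) |>.2 ⟨a, P.inv a, (P.inv_ne a).symm⟩
  exact this

lemma ell_ge (a : L) : 3 ≤ D.ell := by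
  have : (2:ℝ) ≤ D.n := by exact_mod_cast D.two_le a
  unfold ell; linarith

/-- iterate of the successor map -/
def st (i : ℕ) (a : L) : L := D.nxt^[i] a

@[simp] lemma st_zero (a : L) : D.st 0 a = a := rfl
lemma st_succ (i : ℕ) (a : L) : D.st (i + 1) a = D.nxt (D.st i a) := Function.iterate_succ_apply' _ _ _

lemma st_inj (a : L) {i j : ℕ} (hi : i < D.n) (hj : j < D.n) (h : D.st i a = D.st j a) : i = j := by
  have hsurj : Function.Surjective (fun i : Fin D.n => D.st i a) := by
    intro b
    obtain ⟨i, hi, e⟩ := D.cyc a b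
    exact ⟨⟨i, hi⟩, e⟩
  have hbij := (Nat.bijective_iff_surjective_and_card (fun i : Fin D.n => D.st i a)).2
    ⟨hsurj, by simp [n]⟩
  have := hbij.1 (a₁ := ⟨i, hi⟩) (a₂ := ⟨j, hj⟩) h
  simpa using this

lemma st_n (a : L) : D.st D.n a = a := by
  obtain ⟨i, hi, e⟩ := D.cyc (D.nxt a) a
  rw [← Function.iterate_succ_apply] at e
  have hi' : i < D.n := hi
  rcases Nat.lt_or_ge (i + 1) D.n with h | h
  · have h2 := D.two_le a
    have := D.st_inj a (i := i + 1) (j := 0) h (by omega) e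
    omega
  · have : i + 1 = D.n := by omega
    rw [← this]; exact e

lemma st_ne (a : L) {i : ℕ} (h1 : 1 ≤ i) (hi : i < D.n) : D.st i a ≠ a := fun h => by
  have := D.st_inj a hi (j := 0) (by omega) h
  omega

lemma exists_st (a b : L) : ∃ i < D.n, D.st i a = b := D.cyc a b

lemma exists_st' {a b : L} (h : b ≠ a) : ∃ i, 1 ≤ i ∧ i < D.n ∧ D.st i a = b := by
  obtain ⟨i, hi, e⟩ := D.cyc a b
  refine ⟨i, ?_, hi, e⟩
  rcases Nat.eq_zero_or_pos i with rfl | h'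
  · exact absurd e.symm h
  · exact h'

lemma c_mem_A {a b : L} {u : ℝ} (hu : u ∈ Icc (0:ℝ) 1) (h : ofC (D.c a u) ∈ P.A b) :
    (u = 0 ∧ b = a) ∨ (u = 1 ∧ b = D.nxt a) := by
  rcases eq_or_lt_of_le hu.1 with h0 | h0
  · left
    refine ⟨h0.symm, ?_⟩
    rw [← h0, D.c0] at h
    by_contra hne
    exact (P.disj b a hne).le_bot ⟨h, D.ht a⟩
  rcases eq_or_lt_of_le hu.2 with h1 | h1
  · right
    refine ⟨h1, ?_⟩
    rw [h1, D.c1] at h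
    by_contra hne
    exact (P.disj b _ hne).le_bot ⟨h, D.hs _⟩
  · exact absurd h (D.out a u ⟨h0, h1⟩ b)

lemma inv_s (b : L) : mobius (P.M b)⁻¹ (ofC (D.s b)) = ofC (D.t (P.inv b)) := by
  rw [← D.hM1, mobius_inv_apply]
lemma inv_t (b : L) : mobius (P.M b)⁻¹ (ofC (D.t b)) = ofC (D.s (P.inv b)) := by
  rw [← D.hM2, mobius_inv_apply]

/-- gap type -/
def Gap (a : L) (p : ℝ) (y : RSphere) : Prop :=
  ∃ i : ℕ, i < D.n ∧ p ∈ Icc (2 * i : ℝ) (2 * i + 1) ∧ y = ofC (D.c (D.st i a) (p - 2 * i))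

/-- block type over relation -/
def Blk (G : L → ℝ → RSphere → Prop) (a : L) (p : ℝ) (y : RSphere) : Prop :=
  ∃ i : ℕ, 1 ≤ i ∧ i < D.n ∧ p ∈ Icc (2 * i - 1 : ℝ) (2 * i) ∧ y ∈ P.A (D.st i a) ∧
    G (P.inv (D.st i a)) (D.ell * (p - (2 * i - 1))) (mobius (P.M (D.st i a))⁻¹ y)

/-- approximating relations -/
def Gm : ℕ → L → ℝ → RSphere → Prop
  | 0 => fun a p y => p ∈ Icc 0 D.ell
  | m + 1 => fun a p y => D.Gap a p y ∨ D.Blk (Gm m) a p y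

/-- limit relation -/
def G (a : L) (p : ℝ) (y : RSphere) : Prop := ∀ m, D.Gm m a p y

lemma Gap.icc {a : L} {p : ℝ} {y : RSphere} (h : D.Gap a p y) : p ∈ Icc 0 D.ell := by
  obtain ⟨i, hi, hp, -⟩ := h
  have : ((i + 1 : ℕ):ℝ) ≤ D.n := by exact_mod_cast hi
  push_cast at this
  have h0 : (0:ℝ) ≤ i := by positivity
  unfold ell
  constructor <;> linarith [hp.1, hp.2]

lemma Blk.icc {G : L → ℝ → RSphere → Prop} {a : L} {p : ℝ} {y : RSphere} (h : D.Blk G a p y) : p ∈ Icc 0 D.ell := by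
  obtain ⟨i, h1, hi, hp, -⟩ := h
  have : ((i + 1 : ℕ):ℝ) ≤ D.n := by exact_mod_cast hi
  have h1 : (1:ℝ) ≤ i := by exact_mod_cast h1
  push_cast at this
  unfold ell
  constructor <;> linarith [hp.1, hp.2]

lemma Blk.mono {G G' : L → ℝ → RSphere → Prop} (hG : ∀ a p y, G a p y → G' a p y) {a : L} {p : ℝ} {y : RSphere}
    (h : D.Blk G a p y) : D.Blk G' a p y := by
  obtain ⟨i, h1, hi, hp, hy, hg⟩ := h
  exact ⟨i, h1, hi, hp, hy, hG _ _ _ hg⟩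

lemma Gm_anti (m : ℕ) : ∀ a p y, D.Gm (m + 1) a p y → D.Gm m a p y := by
  induction m with
  | zero =>
    rintro a p y (h | h)
    · exact Gap.icc D h
    · exact Blk.icc D h
  | succ m ih =>
    rintro a p y (h | h)
    · exact Or.inl h
    · exact Or.inr (Blk.mono D ih h)

lemma G_iff (a : L) (p : ℝ) (y : RSphere) : D.G a p y ↔ D.Gap a p y ∨ D.Blk D.G a p y := by
  constructor
  · intro h
    by_cases hg : D.Gap a p y
    · exact Or.inl hg
    right
    have hb : ∀ m, D.Blk (D.Gm m) a p y := fun m => (h (m + 1)).resolve_left hg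
    obtain ⟨i, h1, hi, hp, hy, -⟩ := hb 0
    refine ⟨i, h1, hi, hp, hy, fun m => ?_⟩
    obtain ⟨j, h1', hj, hp', hy', hg'⟩ := hb m
    have hij : j = i := by
      by_contra hne
      exact (P.disj _ _ fun e => hne (D.st_inj a hj hi e)).le_bot ⟨hy', hy⟩
    rw [← hij]; exact hg'
  · rintro (h | h) m
    · cases m with
      | zero => exact Gap.icc D h
      | succ m => exact Or.inl h
    · cases m with
      | zero => exact Blk.icc D h
      | succ m => exact Or.inr (Blk.mono D (fun a p y h => h m) h)

lemma G_icc {a : L} {p : ℝ} {y : RSphere} (h : D.G a p y) : p ∈ Icc 0 D.ell := h 0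

lemma isClosed_Gm (m : ℕ) : ∀ a, IsClosed {q : ℝ × RSphere | D.Gm m a q.1 q.2} := by
  induction m with
  | zero => intro a; exact isClosed_Icc.preimage continuous_fst
  | succ m ih =>
    intro a
    have e : {q : ℝ × RSphere | D.Gm (m + 1) a q.1 q.2} =
        (⋃ i : Fin D.n, (fun u : ℝ => ((2 * (i:ℕ) + u : ℝ), ofC (D.c (D.st i a) u))) '' Icc 0 1) ∪
        ⋃ i : {i : Fin D.n // 1 ≤ (i:ℕ)}, {q : ℝ × RSphere | q.1 ∈ Icc (2 * (i.1:ℕ) - 1 : ℝ) (2 * (i.1:ℕ)) ∧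
          q.2 ∈ P.A (D.st i.1 a) ∧ D.Gm m (P.inv (D.st i.1 a)) (D.ell * (q.1 - (2 * (i.1:ℕ) - 1)))
            (mobius (P.M (D.st i.1 a))⁻¹ q.2)} := by
      ext ⟨p, y⟩
      simp only [mem_union, mem_iUnion, mem_setOf_eq, mem_image, Prod.mk.injEq]
      constructor
      · rintro (⟨i, hi, hp, e⟩ | ⟨i, h1, hi, hp, hy, hg⟩)
        · left
          refine ⟨⟨i, hi⟩, p - 2 * i, ⟨by linarith [hp.1], by linarith [hp.2]⟩, by simp, e.symm⟩
        · right
          exact ⟨⟨⟨i, hi⟩, h1⟩, hp, hy, hg⟩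
      · rintro (⟨i, u, hu, e1, e2⟩ | ⟨⟨⟨i, hi⟩, h1⟩, hp, hy, hg⟩)
        · left
          refine ⟨i, i.2, ⟨by linarith [hu.1], by linarith [hu.2]⟩, ?_⟩
          rw [← e2]; congr 2; linarith
        · right
          exact ⟨i, h1, hi, hp, hy, hg⟩
    rw [e]
    refine IsClosed.union (isClosed_iUnion_of_finite fun i => ?_) (isClosed_iUnion_of_finite fun i => ?_)
    · refine (isCompact_Icc.image_of_continuousOn ?_).isClosed
      refine ContinuousOn.prodMk (by fun_prop) ?_
      exact continuous_ofC.comp_continuousOn (D.cont _)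
    · refine (isClosed_Icc.preimage continuous_fst).inter (((P.closed _).preimage continuous_snd).inter ?_)
      have hc : Continuous fun q : ℝ × RSphere => ((D.ell * (q.1 - (2 * (i.1:ℕ) - 1)) : ℝ),
          mobius (P.M (D.st i.1 a))⁻¹ q.2) :=
        (by fun_prop : Continuous fun q : ℝ × RSphere => (D.ell * (q.1 - (2 * (i.1:ℕ) - 1)) : ℝ)).prodMk
          ((continuous_mobius _).comp continuous_snd)
      exact (ih _).preimage hc

lemma isClosed_G (a : L) : IsClosed {q : ℝ × RSphere | D.G a q.1 q.2} := by
  have : {q : ℝ × RSphere | D.G a q.1 q.2} = ⋂ m, {q : ℝ × RSphere | D.Gm m a q.1 q.2} := by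
    ext q; simp [G]
  rw [this]; exact isClosed_iInter fun m => D.isClosed_Gm m a

lemma isCompact_G (a : L) : IsCompact {q : ℝ × RSphere | D.G a q.1 q.2} :=
  (isCompact_Icc.prod isCompact_univ : IsCompact ((Icc 0 D.ell) ×ˢ (univ : Set RSphere))).of_isClosed_subset
    (D.isClosed_G a) fun q hq => ⟨D.G_icc hq, mem_univ _⟩

/-- location of a parameter -/
lemma locate {p : ℝ} (hp : p ∈ Icc 0 D.ell) : (∃ i : ℕ, i < D.n ∧ p ∈ Icc (2 * i : ℝ) (2 * i + 1)) ∨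
    ∃ i : ℕ, 1 ≤ i ∧ i < D.n ∧ p ∈ Icc (2 * i - 1 : ℝ) (2 * i) := by
  have h0 : 0 ≤ p / 2 := by linarith [hp.1]
  have h1 := Nat.floor_le h0
  have h2 := Nat.lt_floor_add_one (p / 2)
  set k := ⌊p / 2⌋₊
  have h3 : p ≤ 2 * D.n - 1 := hp.2
  have hk : k < D.n := by
    have : (k:ℝ) < D.n := by linarith
    exact_mod_cast this
  rcases le_total p (2 * k + 1) with h | h
  · exact Or.inl ⟨k, hk, by linarith, h⟩
  · rcases Nat.lt_or_ge (k + 1) D.n with h' | h'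
    · right; refine ⟨k + 1, by omega, h', ?_, ?_⟩ <;> push_cast <;> linarith
    · left; refine ⟨k, hk, by linarith, ?_⟩
      have : (D.n : ℝ) ≤ k + 1 := by exact_mod_cast h'
      linarith

lemma blk_arg {p : ℝ} {i : ℕ} (a : L) (hp : p ∈ Icc (2 * i - 1 : ℝ) (2 * i)) : D.ell * (p - (2 * i - 1)) ∈ Icc 0 D.ell := by
  have := D.ell_ge a
  have h1 := hp.1
  have h2 := hp.2
  constructor
  · exact mul_nonneg (by linarith) (by linarith)
  · nlinarith

lemma Gm_exists (m : ℕ) : ∀ a, ∀ p ∈ Icc 0 D.ell, ∃ y, D.Gm m a p y ∧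
    (y ∉ P.A a ∨ y = ofC (D.s a) ∨ y = ofC (D.t a)) := by
  induction m with
  | zero => intro a p hp; exact ⟨infty, hp, Or.inl (P.inf_nmem a)⟩
  | succ m ih =>
    intro a p hp
    rcases D.locate hp with ⟨i, hi, hpi⟩ | ⟨i, h1, hi, hpi⟩
    · refine ⟨_, Or.inl ⟨i, hi, hpi, rfl⟩, ?_⟩
      by_cases h : ofC (D.c (D.st i a) (p - 2 * i)) ∈ P.A a
      · right
        rcases D.c_mem_A ⟨by linarith [hpi.1], by linarith [hpi.2]⟩ h with ⟨h3, h4⟩ | ⟨h3, h4⟩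
        · right; rw [h3, D.c0, ← h4]
        · left; rw [h3, D.c1, ← h4]
      · exact Or.inl h
    · set b := D.st i a
      obtain ⟨z, hz, hzA⟩ := ih (P.inv b) _ (D.blk_arg a hpi)
      have hzb : mobius (P.M b) z ∈ P.A b := by
        rcases hzA with h | rfl | rfl
        · exact P.map b z h
        · rw [D.hM2]; exact D.ht b
        · rw [D.hM1]; exact D.hs b
      refine ⟨mobius (P.M b) z, Or.inr ⟨i, h1, hi, hpi, hzb, ?_⟩, Or.inl fun h => ?_⟩
      · rw [mobius_inv_apply]; exact hz
      · exact (P.disj b a (D.st_ne a h1 hi)).le_bot ⟨hzb, h⟩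

lemma G_exists (a : L) {p : ℝ} (hp : p ∈ Icc 0 D.ell) : ∃ y, D.G a p y := by
  have hcl : ∀ m, IsClosed {y | D.Gm m a p y} := fun m =>
    (D.isClosed_Gm m a).preimage (Continuous.prodMk_right p)
  obtain ⟨y, hy⟩ := IsCompact.nonempty_iInter_of_sequence_nonempty_isCompact_isClosed
    (fun m => {y | D.Gm m a p y}) (fun m y h => D.Gm_anti m a p y h)
    (fun m => by obtain ⟨y, hy, -⟩ := D.Gm_exists m a p hp; exact ⟨y, hy⟩) (hcl 0).isCompact hcl
  rw [mem_iInter] at hy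
  exact ⟨y, hy⟩

lemma G_zero {a : L} {y : RSphere} (h : D.G a 0 y) : y = ofC (D.t a) := by
  rcases (D.G_iff _ _ _).1 h with ⟨i, hi, hp, e⟩ | ⟨i, h1, hi, hp, -⟩
  · have : (i:ℝ) ≤ 0 := by linarith [hp.1]
    have : i = 0 := by exact_mod_cast le_antisymm this (by positivity)
    subst this
    rw [e]; simp [D.c0]
  · have : (1:ℝ) ≤ i := by exact_mod_cast h1
    linarith [hp.1]

lemma G_ell {a : L} {y : RSphere} (h : D.G a D.ell y) : y = ofC (D.s a) := by
  rcases (D.G_iff _ _ _).1 h with ⟨i, hi, hp, e⟩ | ⟨i, h1, hi, hp, -⟩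
  · have h1 : (D.n:ℝ) ≤ i + 1 := by have := hp.2; unfold ell at this; linarith
    have h2 : i + 1 = D.n := le_antisymm hi (by exact_mod_cast h1)
    have h3 : D.ell - 2 * i = 1 := by unfold ell; rw [← h2]; push_cast; ring
    rw [e, h3, D.c1, ← st_succ, h2, D.st_n]
  · have : (i:ℝ) + 1 ≤ D.n := by exact_mod_cast hi
    have := hp.2
    unfold ell at this
    linarith

lemma G_t {a : L} {p : ℝ} (h : D.G a p (ofC (D.t a))) : p = 0 := by
  rcases (D.G_iff _ _ _).1 h with ⟨i, hi, hp, e⟩ | ⟨i, h1, hi, hp, hA, -⟩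
  · have hA := D.ht a
    have hu : p - 2 * i ∈ Icc (0:ℝ) 1 := ⟨by linarith [hp.1], by linarith [hp.2]⟩
    rw [e] at hA
    rcases D.c_mem_A hu hA with ⟨h3, h4⟩ | ⟨h3, h4⟩
    · have : 0 = i := D.st_inj a (by have := D.two_le a; omega) hi h4
      subst this; simpa using h3
    · rw [h3, D.c1, ← h4] at e
      exact absurd (ofC_injective e).symm (D.hst a)
  · exact absurd ⟨D.ht a, hA⟩ (fun h => (P.disj a _ (D.st_ne a h1 hi).symm).le_bot h)

lemma G_s {a : L} {p : ℝ} (h : D.G a p (ofC (D.s a))) : p = D.ell := by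
  rcases (D.G_iff _ _ _).1 h with ⟨i, hi, hp, e⟩ | ⟨i, h1, hi, hp, hA, -⟩
  · have hA := D.hs a
    have hu : p - 2 * i ∈ Icc (0:ℝ) 1 := ⟨by linarith [hp.1], by linarith [hp.2]⟩
    rw [e] at hA
    rcases D.c_mem_A hu hA with ⟨h3, h4⟩ | ⟨h3, h4⟩
    · rw [h3, D.c0, ← h4] at e
      exact absurd (ofC_injective e) (D.hst a)
    · rw [← st_succ] at h4
      rcases Nat.lt_or_ge (i + 1) D.n with h' | h'
      · exact absurd h4.symm (D.st_ne a (by omega) h')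
      · have : D.n = i + 1 := by omega
        unfold ell; rw [this]; push_cast; linarith
  · exact absurd ⟨D.hs a, hA⟩ (fun h => (P.disj a _ (D.st_ne a h1 hi).symm).le_bot h)

end Marks
end QC
end
end

section
open Filter Set Topology RSphere MeasureTheory
open scoped ENNReal NNReal
noncomputable section
set_option linter.all false
namespace QC

lemma jordan_of_Icc {h : ℝ → RSphere} {T : ℝ} (hT : 0 < T) (hc : ContinuousOn h (Icc 0 T)) (he : h 0 = h T)
    (hi : InjOn h (Ico 0 T)) : IsJordanCurve (h '' Icc 0 T) := by
  haveI : Fact (0 < T) := ⟨hT⟩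
  set g : ℝ → RSphere := fun t => AddCircle.liftIco T 0 h (t : AddCircle T) with hg
  have hgc : Continuous g := by
    refine (AddCircle.liftIco_continuous (by simpa using he) (by simpa using hc)).comp ?_
    exact AddCircle.continuous_mk' T
  have hgv : ∀ t ∈ Ico 0 T, g t = h t := fun t ht => AddCircle.liftIco_coe_apply (by simpa using ht)
  have hper : ∀ t, g (t + T) = g t := fun t => by simp [hg]
  have hmod : ∀ t, g (toIcoMod hT 0 t) = g t := fun t => by
    have : ((toIcoMod hT 0 t : ℝ) : AddCircle T) = (t : AddCircle T) := by
      have e := toIcoMod_add_toIcoDiv_zsmul hT 0 t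
      have e2 : ((toIcoMod hT 0 t + toIcoDiv hT 0 t • T : ℝ) : AddCircle T) = (toIcoMod hT 0 t : ℝ) := by
        rw [AddCircle.coe_add, AddCircle.coe_zsmul, AddCircle.coe_period]; simp
      rw [e] at e2
      exact e2.symm
    simp only [hg, this]
  have hmem : ∀ t, toIcoMod hT 0 t ∈ Ico 0 T := fun t => by
    have := toIcoMod_mem_Ico hT 0 t; simpa using this
  have hr : range g = h '' Icc 0 T := by
    ext y; constructor
    · rintro ⟨t, rfl⟩
      exact ⟨_, Ico_subset_Icc_self (hmem t), by rw [← hgv _ (hmem t), hmod]⟩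
    · rintro ⟨t, ht, rfl⟩
      rcases eq_or_lt_of_le ht.2 with rfl | hlt
      · exact ⟨0, by rw [hgv 0 ⟨le_rfl, hT⟩, he]⟩
      · exact ⟨t, hgv t ⟨ht.1, hlt⟩⟩
  rw [← hr]
  refine jordan_of_param hgc hT.ne' hper ?_
  intro s t hst
  rw [← hmod s, ← hmod t, hgv _ (hmem s), hgv _ (hmem t)] at hst
  have := hi (hmem s) (hmem t) hst
  refine ⟨toIcoDiv hT 0 s - toIcoDiv hT 0 t, ?_⟩
  have e1 := toIcoMod_add_toIcoDiv_zsmul hT 0 s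
  have e2 := toIcoMod_add_toIcoDiv_zsmul hT 0 t
  simp only [zsmul_eq_mul] at e1 e2
  push_cast
  linarith

lemma PP.cyl_small {L : Type} [Finite L] (P : PP L) {ε : ℝ} (hε : 0 < ε) : ∃ N, ∀ w, P.Red w → N ≤ w.length →
    ∀ z z', ofC z ∈ P.Cyl w → ofC z' ∈ P.Cyl w → ‖z - z'‖ < ε := by
  obtain ⟨κ, R, C⟩ := P.exists_Cst
  obtain ⟨N, hN⟩ := P.rho_small C.κ_pos (half_pos hε)
  refine ⟨N + 2, fun w hr hw z z' hz hz' => ?_⟩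
  rcases List.eq_nil_or_concat w with rfl | ⟨v, m, rfl⟩
  · simp at hw
  rw [List.concat_eq_append] at *
  have hl : N + 1 ≤ v.length := by simp at hw; omega
  have hv : v ≠ [] := by rintro rfl; simp at hl
  have h1 := P.cyl_ball C hv hr hz
  have h2 := P.cyl_ball C hv hr hz'
  have h3 := hN v (by omega)
  calc ‖z - z'‖ = ‖(z - inft (P.Mw v)) - (z' - inft (P.Mw v))‖ := by congr 1; ring
    _ ≤ _ := norm_sub_le _ _
    _ < ε := by linarith

lemma PP.Cyl_ne_inf {L : Type} (P : PP L) {w : List L} (hw : w ≠ []) {x : RSphere} (hx : x ∈ P.Cyl w) : x ≠ infty := by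
  obtain ⟨a, v, rfl⟩ := List.exists_cons_of_ne_nil hw
  rintro rfl
  exact P.inf_nmem a hx.1

lemma PP.eq_of_cyl {L : Type} [Finite L] (P : PP L) {x y : RSphere}
    (h : ∀ m, ∃ w, P.Red w ∧ w.length = m ∧ x ∈ P.Cyl w ∧ y ∈ P.Cyl w) : x = y := by
  obtain ⟨w, -, hl, hx, hy⟩ := h 1
  have hw : w ≠ [] := by rintro rfl; simp at hl
  have hx' := P.Cyl_ne_inf hw hx
  have hy' := P.Cyl_ne_inf hw hy
  obtain ⟨z, rfl⟩ := (sph_cases x).resolve_left hx'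
  obtain ⟨z', rfl⟩ := (sph_cases y).resolve_left hy'
  congr 1
  by_contra hne
  obtain ⟨N, hN⟩ := P.cyl_small (norm_pos_iff.2 (sub_ne_zero.2 hne))
  obtain ⟨w, hr, hl, hx, hy⟩ := h N
  exact lt_irrefl _ (hN w hr hl.ge z z' hx hy)

lemma PP.red_cons {L : Type} (P : PP L) {a : L} {w : List L} (hr : P.Red w) (h : ∀ b ∈ w.head?, b ≠ P.inv a) :
    P.Red (a :: w) := by
  cases w with
  | nil => exact P.red_single a
  | cons b w => exact P.red_cons_cons.2 ⟨h b (by simp), hr⟩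

namespace Marks
variable {L : Type} [Finite L] {P : PP L} (D : Marks P)

lemma G_uniq_y_aux (m : ℕ) : ∀ a p y y', D.G a p y → D.G a p y' → y = y' ∨
    ∃ w, P.Red w ∧ w.length = m ∧ (∀ b ∈ w.head?, b ≠ a) ∧ y ∈ P.Cyl w ∧ y' ∈ P.Cyl w := by
  induction m with
  | zero => intro a p y y' _ _; exact Or.inr ⟨[], P.red_nil, rfl, by simp, trivial, trivial⟩
  | succ m ih =>
    have mix : ∀ a p y y', D.Gap a p y → D.Blk D.G a p y' → y = y' := by
      rintro a p y y' ⟨i, hi, hp, e⟩ ⟨j, h1, hj, hp', hy, hg⟩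
      have a1 : (2 * i : ℝ) ≤ 2 * j := hp.1.trans hp'.2
      have a2 : (2 * j - 1 : ℝ) ≤ 2 * i + 1 := hp'.1.trans hp.2
      have a1' : i ≤ j := by exact_mod_cast (by linarith : (i:ℝ) ≤ j)
      have a2' : j ≤ i + 1 := by exact_mod_cast (by linarith : (j:ℝ) ≤ i + 1)
      rcases eq_or_lt_of_le a1' with rfl | hlt
      · have hpe : p = 2 * i := le_antisymm hp'.2 hp.1
        subst hpe
        rw [sub_self, D.c0] at e
        have : D.ell * ((2 * i : ℝ) - (2 * i - 1)) = D.ell := by ring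
        rw [this] at hg
        have := D.G_ell hg
        rw [e, ← D.hM2, ← this, mobius_apply_inv]
      · obtain rfl : j = i + 1 := by omega
        push_cast at hp' hg
        have hpe : p = 2 * i + 1 := le_antisymm hp.2 (by linarith [hp'.1])
        subst hpe
        rw [add_sub_cancel_left, D.c1, ← st_succ] at e
        have : D.ell * ((2 * i + 1 : ℝ) - (2 * (i + 1) - 1)) = 0 := by ring
        rw [this] at hg
        have := D.G_zero hg
        rw [e, ← D.hM1, ← this, mobius_apply_inv]
    intro a p y y' h h'
    rcases (D.G_iff _ _ _).1 h with g | g <;> rcases (D.G_iff _ _ _).1 h' with g' | g'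
    · left
      obtain ⟨i, hi, hp, e⟩ := g
      obtain ⟨j, hj, hp', e'⟩ := g'
      have a1 : (2 * i : ℝ) ≤ 2 * j + 1 := hp.1.trans hp'.2
      have a2 : (2 * j : ℝ) ≤ 2 * i + 1 := hp'.1.trans hp.2
      have a1' : 2 * i ≤ 2 * j + 1 := by exact_mod_cast a1
      have a2' : 2 * j ≤ 2 * i + 1 := by exact_mod_cast a2
      obtain rfl : i = j := by omega
      rw [e, e']
    · exact Or.inl (mix a p y y' g g')
    · exact Or.inl (mix a p y' y g' g).symm
    · obtain ⟨i, h1, hi, hp, hy, hg⟩ := g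
      obtain ⟨j, h1', hj, hp', hy', hg'⟩ := g'
      have a1 : (2 * i : ℝ) - 1 ≤ 2 * j := hp.1.trans hp'.2
      have a2 : (2 * j : ℝ) - 1 ≤ 2 * i := hp'.1.trans hp.2
      have a1' : 2 * i ≤ 2 * j + 1 := by exact_mod_cast (by linarith : (2 * i : ℝ) ≤ 2 * j + 1)
      have a2' : 2 * j ≤ 2 * i + 1 := by exact_mod_cast (by linarith : (2 * j : ℝ) ≤ 2 * i + 1)
      obtain rfl : i = j := by omega
      rcases ih _ _ _ _ hg hg' with e | ⟨w, hr, hl, hh, hc, hc'⟩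
      · left
        exact mobius_injective _ e
      · right
        refine ⟨D.st i a :: w, P.red_cons hr hh, by simp [hl], ?_, ⟨hy, hc⟩, ⟨hy', hc'⟩⟩
        intro b hb
        simp at hb
        rw [← hb]; exact D.st_ne a h1 hi

lemma G_uniq_y {a p y y'} (h : D.G a p y) (h' : D.G a p y') : y = y' := by
  by_contra hne
  refine hne (P.eq_of_cyl fun m => ?_)
  obtain ⟨w, h1, h2, -, h3, h4⟩ := (D.G_uniq_y_aux m a p y y' h h').resolve_left hne
  exact ⟨w, h1, h2, h3, h4⟩

lemma G_uniq_p_aux (m : ℕ) : ∀ a p p' y, D.G a p y → D.G a p' y → p = p' ∨ |p - p'| * D.ell ^ m ≤ D.ell := by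
  induction m with
  | zero =>
    intro a p p' y h h'
    right
    have h1 := D.G_icc h
    have h2 := D.G_icc h'
    rw [pow_zero, mul_one, abs_le]
    constructor <;> linarith [h1.1, h1.2, h2.1, h2.2]
  | succ m ih =>
    have mix : ∀ a p p' y, D.Gap a p y → D.Blk D.G a p' y → p = p' := by
      rintro a p p' y ⟨i, hi, hp, e⟩ ⟨j, h1, hj, hp', hy, hg⟩
      have hl := D.ell_ge a
      have hu : p - 2 * i ∈ Icc (0:ℝ) 1 := ⟨by linarith [hp.1], by linarith [hp.2]⟩
      rw [e] at hy
      rcases D.c_mem_A hu hy with ⟨h3, h4⟩ | ⟨h3, h4⟩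
      · obtain rfl := D.st_inj a hj hi h4
        rw [h3, D.c0] at e
        rw [e, D.inv_t] at hg
        have := D.G_s hg
        have h5 : p' - (2 * j - 1) = 1 := by
          have : D.ell * (p' - (2 * j - 1) - 1) = 0 := by linarith
          rcases mul_eq_zero.1 this with h | h <;> linarith
        linarith
      · rw [← st_succ] at h4
        rcases Nat.lt_or_ge (i + 1) D.n with hh | hh
        · obtain rfl := D.st_inj a hj hh h4
          rw [h3, D.c1, ← st_succ] at e
          rw [e, D.inv_s] at hg
          have := D.G_t hg
          push_cast at this
          rcases mul_eq_zero.1 this with h | h <;> linarith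
        · have : i + 1 = D.n := by omega
          rw [this, D.st_n] at h4
          exact absurd h4 (D.st_ne a h1 hj)
    intro a p p' y h h'
    rcases (D.G_iff _ _ _).1 h with g | g <;> rcases (D.G_iff _ _ _).1 h' with g' | g'
    · left
      obtain ⟨i, hi, hp, e⟩ := g
      obtain ⟨j, hj, hp', e'⟩ := g'
      have hu : p - 2 * i ∈ Icc (0:ℝ) 1 := ⟨by linarith [hp.1], by linarith [hp.2]⟩
      have hu' : p' - 2 * j ∈ Icc (0:ℝ) 1 := ⟨by linarith [hp'.1], by linarith [hp'.2]⟩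
      have e2 := ofC_injective (e.symm.trans e')
      by_cases hij : D.st i a = D.st j a
      · obtain rfl := D.st_inj a hi hj hij
        have := D.inj _ hu hu' e2
        linarith
      · exact absurd ⟨⟨_, hu, rfl⟩, ⟨_, hu', e2.symm⟩⟩ fun h => (D.cdisj _ _ hij).le_bot h
    · exact Or.inl (mix a p p' y g g')
    · exact Or.inl (mix a p' p y g' g).symm
    · obtain ⟨i, h1, hi, hp, hy, hg⟩ := g
      obtain ⟨j, h1', hj, hp', hy', hg'⟩ := g'
      have hij : i = j := by
        by_contra hne
        exact (P.disj _ _ fun e => hne (D.st_inj a hi hj e)).le_bot ⟨hy, hy'⟩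
      subst hij
      have hl := D.ell_ge a
      rcases ih _ _ _ _ hg hg' with e | e
      · left
        have := mul_left_cancel₀ (by linarith : D.ell ≠ 0) e
        linarith
      · right
        rw [← mul_sub, abs_mul, abs_of_pos (by linarith : 0 < D.ell)] at e
        calc _ = D.ell * |p - (2 * i - 1) - (p' - (2 * i - 1))| * D.ell ^ m := by
              rw [show p - (2 * i - 1) - (p' - (2 * i - 1)) = p - p' by ring]; ring
          _ ≤ _ := e

lemma G_uniq_p {a p p' y} (h : D.G a p y) (h' : D.G a p' y) : p = p' := by
  by_contra hne
  have hpos : 0 < |p - p'| := abs_pos.2 (sub_ne_zero.2 hne)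
  obtain ⟨m, hm⟩ := pow_unbounded_of_one_lt (D.ell / |p - p'|) (by linarith [D.ell_ge a] : 1 < D.ell)
  have := (D.G_uniq_p_aux m a p p' y h h').resolve_left hne
  rw [div_lt_iff₀ hpos] at hm
  linarith

/-- parametrization -/
def f (a : L) (p : ℝ) : RSphere := open Classical in if h : p ∈ Icc 0 D.ell then (D.G_exists a h).choose else infty

lemma f_spec (a : L) {p : ℝ} (hp : p ∈ Icc 0 D.ell) : D.G a p (D.f a p) := by
  rw [f, dif_pos hp]; exact (D.G_exists a hp).choose_spec

lemma f_eq {a : L} {p : ℝ} {y} (h : D.G a p y) : D.f a p = y := D.G_uniq_y (D.f_spec a (D.G_icc h)) h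

lemma f_cont (a : L) : ContinuousOn (D.f a) (Icc 0 D.ell) := by
  rw [continuousOn_iff_isClosed]
  intro F hF
  refine ⟨Prod.fst '' ({q : ℝ × RSphere | D.G a q.1 q.2} ∩ Prod.snd ⁻¹' F), ?_, ?_⟩
  · exact (((D.isCompact_G a).inter_right (hF.preimage continuous_snd)).image continuous_fst).isClosed
  · ext p; constructor
    · rintro ⟨h1, h2⟩
      exact ⟨⟨(p, D.f a p), ⟨D.f_spec a h2, h1⟩, rfl⟩, h2⟩
    · rintro ⟨⟨⟨q, y⟩, ⟨h1, h3⟩, rfl⟩, h2⟩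
      refine ⟨?_, h2⟩
      show D.f a q ∈ F
      rw [D.f_eq h1]; exact h3

lemma f_inj (a : L) : InjOn (D.f a) (Icc 0 D.ell) := fun p hp q hq e =>
  D.G_uniq_p (D.f_spec a hp) (by rw [e]; exact D.f_spec a hq)

lemma f_zero (a : L) : D.f a 0 = ofC (D.t a) :=
  D.G_zero (D.f_spec a ⟨le_rfl, by linarith [D.ell_ge a]⟩)
lemma f_ell (a : L) : D.f a D.ell = ofC (D.s a) :=
  D.G_ell (D.f_spec a ⟨by linarith [D.ell_ge a], le_rfl⟩)

/-- half of the curve -/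
def X (a : L) : Set RSphere := D.f a '' Icc 0 D.ell

lemma X_iffG {a : L} {y} : y ∈ D.X a ↔ ∃ p, D.G a p y := by
  constructor
  · rintro ⟨p, hp, rfl⟩; exact ⟨p, D.f_spec a hp⟩
  · rintro ⟨p, hp⟩; exact ⟨p, D.G_icc hp, D.f_eq hp⟩

/-- all the arcs -/
def C : Set ℂ := ⋃ b, D.c b '' Icc 0 1

lemma mem_C {z : ℂ} : z ∈ D.C ↔ ∃ b, ∃ u ∈ Icc (0:ℝ) 1, D.c b u = z := by simp [C]

lemma X_iff {a : L} {y} : y ∈ D.X a ↔ (∃ z ∈ D.C, ofC z = y) ∨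
    ∃ b, b ≠ a ∧ y ∈ P.A b ∧ mobius (P.M b)⁻¹ y ∈ D.X (P.inv b) := by
  rw [X_iffG]
  constructor
  · rintro ⟨p, hp⟩
    rcases (D.G_iff _ _ _).1 hp with ⟨i, hi, hp, e⟩ | ⟨i, h1, hi, hp, hy, hg⟩
    · left
      exact ⟨_, D.mem_C.2 ⟨_, _, ⟨by linarith [hp.1], by linarith [hp.2]⟩, rfl⟩, e.symm⟩
    · right
      exact ⟨_, D.st_ne a h1 hi, hy, D.X_iffG.2 ⟨_, hg⟩⟩
  · rintro (⟨z, hz, rfl⟩ | ⟨b, hb, hy, h⟩)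
    · obtain ⟨b, u, hu, rfl⟩ := D.mem_C.1 hz
      obtain ⟨i, hi, rfl⟩ := D.exists_st a b
      refine ⟨2 * i + u, (D.G_iff _ _ _).2 (Or.inl ⟨i, hi, ⟨by linarith [hu.1], by linarith [hu.2]⟩, ?_⟩)⟩
      rw [add_sub_cancel_left]
    · obtain ⟨i, h1, hi, rfl⟩ := D.exists_st' hb
      obtain ⟨q, hq⟩ := D.X_iffG.1 h
      have hl := D.ell_ge a
      have hq' := D.G_icc hq
      refine ⟨2 * i - 1 + q / D.ell, (D.G_iff _ _ _).2 (Or.inr ⟨i, h1, hi, ⟨?_, ?_⟩, hy, ?_⟩)⟩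
      · have := div_nonneg hq'.1 (by linarith : 0 ≤ D.ell); linarith
      · have := div_le_one_of_le₀ hq'.2 (by linarith : 0 ≤ D.ell); linarith
      · rw [add_sub_cancel_left, mul_div_cancel₀ _ (by linarith)]; exact hq

lemma X_A {a : L} {y} (h : y ∈ D.X a) (hA : y ∈ P.A a) : y = ofC (D.s a) ∨ y = ofC (D.t a) := by
  rcases D.X_iff.1 h with ⟨z, hz, rfl⟩ | ⟨b, hb, hy, -⟩
  · obtain ⟨b, u, hu, rfl⟩ := D.mem_C.1 hz
    rcases D.c_mem_A hu hA with ⟨h3, h4⟩ | ⟨h3, h4⟩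
    · right; rw [h3, D.c0, h4]
    · left; rw [h3, D.c1, h4]
  · exact absurd ⟨hy, hA⟩ fun h => (P.disj _ _ hb).le_bot h

lemma X_map {a : L} {y} (h : y ∈ D.X (P.inv a)) : mobius (P.M a) y ∈ P.A a := by
  by_cases hA : y ∈ P.A (P.inv a)
  · rcases D.X_A h hA with rfl | rfl
    · rw [D.hM2]; exact D.ht a
    · rw [D.hM1]; exact D.hs a
  · exact P.map a y hA

/-- the curve -/
def H : Set RSphere := {y | (∃ z ∈ D.C, ofC z = y) ∨ ∃ b, y ∈ P.A b ∧ mobius (P.M b)⁻¹ y ∈ D.X (P.inv b)}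

lemma X_sub_H (a : L) : D.X a ⊆ D.H := by
  intro y hy
  rcases D.X_iff.1 hy with h | ⟨b, hb, h1, h2⟩
  · exact Or.inl h
  · exact Or.inr ⟨b, h1, h2⟩

lemma H_split (a : L) {y} (h : y ∈ D.H) : y ∈ D.X a ∨ (y ∈ P.A a ∧ mobius (P.M a)⁻¹ y ∈ D.X (P.inv a)) := by
  rcases h with h | ⟨b, h1, h2⟩
  · exact Or.inl (D.X_iff.2 (Or.inl h))
  · by_cases hb : b = a
    · subst hb; exact Or.inr ⟨h1, h2⟩
    · exact Or.inl (D.X_iff.2 (Or.inr ⟨b, hb, h1, h2⟩))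

lemma H_sub (a : L) {y} (h : y ∈ D.H) : y ∈ D.X a ∨ y ∈ D.X (P.inv a) := by
  rcases D.H_split a h with h | ⟨h1, h2⟩
  · exact Or.inl h
  · exact Or.inr (D.X_iff.2 (Or.inr ⟨a, (P.inv_ne a).symm, h1, h2⟩))

lemma H_map (a : L) {y} (h : y ∈ D.H) : mobius (P.M a) y ∈ D.H := by
  rcases D.H_split (P.inv a) h with h | ⟨h1, h2⟩
  · exact Or.inr ⟨a, D.X_map h, by rw [mobius_inv_apply]; exact h⟩
  · rw [P.inv_inv, P.M_inv, inv_inv] at h2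
    exact D.X_sub_H a h2

lemma H_mapw (w : List L) {y} (h : y ∈ D.H) : mobius (P.Mw w) y ∈ D.H := by
  induction w with
  | nil => simpa [mobius_one] using h
  | cons a w ih => rw [PP.Mw_cons, mobius_mul]; exact D.H_map a ih

lemma isClosed_X (a : L) : IsClosed (D.X a) := (isCompact_Icc.image_of_continuousOn (D.f_cont a)).isClosed

lemma H_eq (a : L) : D.H = D.X a ∪ D.X (P.inv a) := by
  ext y; constructor
  · exact D.H_sub a
  · rintro (h | h) <;> exact D.X_sub_H _ h

lemma isClosed_H (a : L) : IsClosed D.H := by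
  rw [D.H_eq a]; exact (D.isClosed_X _).union (D.isClosed_X _)

lemma H_jordan (a : L) : IsJordanCurve D.H := by
  have hl := D.ell_ge a
  set h : ℝ → RSphere := fun p => if p ≤ D.ell then D.f a p else mobius (P.M a) (D.f (P.inv a) (p - D.ell)) with hh
  have h1 : ∀ p, p ≤ D.ell → h p = D.f a p := fun p hp => if_pos hp
  have h2 : ∀ p, D.ell ≤ p → h p = mobius (P.M a) (D.f (P.inv a) (p - D.ell)) := by
    intro p hp
    rcases eq_or_lt_of_le hp with rfl | hp
    · rw [h1 _ le_rfl, sub_self, D.f_ell, D.f_zero, D.hM1]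
    · exact if_neg (not_le.2 hp)
  have hc : ContinuousOn h (Icc 0 (2 * D.ell)) := by
    have e : Icc 0 (2 * D.ell) = Icc 0 D.ell ∪ Icc D.ell (2 * D.ell) :=
      (Icc_union_Icc_eq_Icc (by linarith) (by linarith)).symm
    rw [e]
    refine ContinuousOn.union_of_isClosed ?_ ?_ isClosed_Icc isClosed_Icc
    · exact (D.f_cont a).congr fun p hp => h1 p hp.2
    · have : ContinuousOn (fun p => mobius (P.M a) (D.f (P.inv a) (p - D.ell))) (Icc D.ell (2 * D.ell)) := by
        refine (continuous_mobius _).comp_continuousOn ((D.f_cont _).comp (by fun_prop) ?_)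
        intro p hp
        exact ⟨by linarith [hp.1], by linarith [hp.2]⟩
      exact this.congr fun p hp => h2 p hp.1
  have key : ∀ p ∈ Icc 0 D.ell, ∀ q ∈ Ico D.ell (2 * D.ell), h p = h q → p = q := by
    intro p hp q hq e
    rw [h1 p hp.2, h2 q hq.1] at e
    have hq' : q - D.ell ∈ Icc 0 D.ell := ⟨by linarith [hq.1], by linarith [hq.2]⟩
    have hX : D.f (P.inv a) (q - D.ell) ∈ D.X (P.inv a) := ⟨_, hq', rfl⟩
    have hA : D.f a p ∈ P.A a := by rw [e]; exact D.X_map hX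
    rcases D.X_A ⟨_, hp, rfl⟩ hA with e1 | e1
    · have e2 := D.f_spec a hp
      rw [e1] at e2
      have e3 := D.f_spec (P.inv a) hq'
      have : D.f (P.inv a) (q - D.ell) = ofC (D.t (P.inv a)) := by
        apply mobius_injective (P.M a); rw [← e, e1, D.hM1]
      rw [this] at e3
      have := D.G_s e2
      have := D.G_t e3
      linarith
    · have e3 := D.f_spec (P.inv a) hq'
      have : D.f (P.inv a) (q - D.ell) = ofC (D.s (P.inv a)) := by
        apply mobius_injective (P.M a); rw [← e, e1, D.hM2]
      rw [this] at e3
      have := D.G_s e3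
      linarith [hq.2]
  have hi : InjOn h (Ico 0 (2 * D.ell)) := by
    intro p hp q hq e
    rcases le_total p D.ell with hpl | hpl <;> rcases le_total q D.ell with hql | hql
    · rw [h1 p hpl, h1 q hql] at e
      exact D.f_inj a ⟨hp.1, hpl⟩ ⟨hq.1, hql⟩ e
    · exact key p ⟨hp.1, hpl⟩ q ⟨hql, hq.2⟩ e
    · exact (key q ⟨hq.1, hql⟩ p ⟨hpl, hp.2⟩ e.symm).symm
    · rw [h2 p hpl, h2 q hql] at e
      have := D.f_inj _ ⟨by linarith, by linarith [hp.2]⟩ ⟨by linarith, by linarith [hq.2]⟩ (mobius_injective _ e)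
      linarith
  have he : h 0 = h (2 * D.ell) := by
    rw [h1 0 (by linarith), h2 _ (by linarith), show 2 * D.ell - D.ell = D.ell by ring, D.f_ell, D.f_zero, D.hM2]
  have hH : D.H = h '' Icc 0 (2 * D.ell) := by
    ext y; constructor
    · intro hy
      rcases D.H_split a hy with ⟨p, hp, rfl⟩ | ⟨hA, p, hp, e⟩
      · exact ⟨p, ⟨hp.1, by linarith [hp.2]⟩, h1 p hp.2⟩
      · refine ⟨p + D.ell, ⟨by linarith [hp.1], by linarith [hp.2]⟩, ?_⟩
        rw [h2 _ (by linarith [hp.1]), add_sub_cancel_right, e, mobius_apply_inv]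
    · rintro ⟨p, hp, rfl⟩
      rcases le_total p D.ell with hpl | hpl
      · rw [h1 p hpl]; exact D.X_sub_H a ⟨p, ⟨hp.1, hpl⟩, rfl⟩
      · rw [h2 p hpl]
        exact D.H_map a (D.X_sub_H _ ⟨_, ⟨by linarith, by linarith [hp.2]⟩, rfl⟩)
  rw [hH]
  exact jordan_of_Icc (by linarith) hc he hi

lemma Lam_sub_H (a : L) : P.Lam ⊆ D.H := by
  intro y hy
  obtain ⟨z, rfl⟩ := (sph_cases y).resolve_left (fun h => P.inf_nmem_Lam (h ▸ hy))
  have hcl : IsClosed (ofC ⁻¹' D.H) := (D.isClosed_H a).preimage continuous_ofC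
  have : z ∈ closure (ofC ⁻¹' D.H) := by
    rw [Metric.mem_closure_iff]
    intro ε hε
    obtain ⟨N, hN⟩ := P.cyl_small hε
    obtain ⟨w, hr, hl, h⟩ := hy (N + 1)
    rcases List.eq_nil_or_concat w with rfl | ⟨v, m, rfl⟩
    · simp at hl
    rw [List.concat_eq_append] at *
    have h1 := P.mem_Cyl_snoc hr (D.ht m)
    obtain ⟨z', hz'⟩ := (sph_cases (mobius (P.Mw v) (ofC (D.t m)))).resolve_left (P.Cyl_ne_inf (by simp) h1)
    refine ⟨z', ?_, ?_⟩
    · show ofC z' ∈ D.H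
      rw [← hz']
      exact D.H_mapw v (Or.inl ⟨_, D.mem_C.2 ⟨m, 0, ⟨le_rfl, zero_le_one⟩, D.c0 m⟩, rfl⟩)
    · rw [dist_eq_norm]
      exact hN _ hr (by omega) z z' h (hz' ▸ h1)
  rw [hcl.closure_eq] at this
  exact this

lemma H_cases_aux (m : ℕ) : ∀ a, ∀ y ∈ D.X a, (∃ w, P.Red w ∧ ∃ z ∈ D.C, y = mobius (P.Mw w) (ofC z)  ∧ (∀ b ∈ w.head?, b ≠ a)) ∨
    ∃ w, P.Red w ∧ w.length = m ∧ y ∈ P.Cyl w ∧ ∀ b ∈ w.head?, b ≠ a := by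
  induction m with
  | zero => intro a y hy; exact Or.inr ⟨[], P.red_nil, rfl, trivial, by simp⟩
  | succ m ih =>
    intro a y hy
    rcases D.X_iff.1 hy with ⟨z, hz, rfl⟩ | ⟨b, hb, hA, h⟩
    · exact Or.inl ⟨[], P.red_nil, z, hz, by simp [mobius_one], by simp⟩
    · rcases ih _ _ h with ⟨w, hr, z, hz, e, hh⟩ | ⟨w, hr, hl, hc, hh⟩
      · left
        refine ⟨b :: w, P.red_cons hr hh, z, hz, ?_, by simp [hb]⟩
        rw [PP.Mw_cons, mobius_mul, ← e, mobius_apply_inv]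
      · right
        exact ⟨b :: w, P.red_cons hr hh, by simp [hl], ⟨hA, hc⟩, by simp [hb]⟩

lemma H_cases (a : L) {y} (hy : y ∈ D.H) : y ∈ P.Lam ∨ ∃ w, P.Red w ∧ ∃ z ∈ D.C, y = mobius (P.Mw w) (ofC z) := by
  by_contra hcon
  push Not at hcon
  refine hcon.1 fun m => ?_
  have key : ∀ a, y ∈ D.X a → y ∈ P.Lev m := by
    intro a h
    rcases D.H_cases_aux m a y h with ⟨w, hr, z, hz, e, -⟩ | ⟨w, hr, hl, hc, -⟩
    · exact absurd e (hcon.2 w hr z hz)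
    · exact ⟨w, hr, hl, hc⟩
  rcases D.H_sub a hy with h | h <;> exact key _ h

lemma C_map {z : ℂ} (hz : z ∈ D.C) (d : L) : mobius (P.M d) (ofC z) ∈ P.A d :=
  D.X_map (D.X_iff.2 (Or.inl ⟨z, hz, rfl⟩))

lemma isCompact_C : IsCompact D.C := isCompact_iUnion fun b => isCompact_Icc.image_of_continuousOn (D.cont b)

lemma pole_sep : ∃ κ > 0, κ ≤ 1 ∧ ∀ w, P.Red w → w ≠ [] → ∀ z ∈ D.C, κ ≤ ‖z - pole (P.Mw w)‖ := by
  set K : Set ℂ := ⋃ d, ofC ⁻¹' (mobius (P.M d) ⁻¹' ((⋃ b : {b // b ≠ d}, P.A b) ∪ {infty})) with hK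
  have hKc : IsCompact K := by
    refine isCompact_iUnion fun d => isCompact_preimage ?_ ?_
    · exact ((isClosed_iUnion_of_finite fun b => P.closed _).union isClosed_singleton).preimage (continuous_mobius _)
    · intro h
      have hA := P.map d infty (P.inf_nmem _)
      rcases h with h | h
      · obtain ⟨⟨b, hb⟩, h⟩ := mem_iUnion.1 h
        exact (P.disj _ _ hb).le_bot ⟨h, hA⟩
      · rw [mem_singleton_iff.1 h] at hA
        exact P.inf_nmem d hA
  have hdis : Disjoint D.C K := by
    rw [Set.disjoint_left]
    intro z hz hzK
    obtain ⟨d, h⟩ := mem_iUnion.1 hzK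
    have hA := D.C_map hz d
    rcases h with h | h
    · obtain ⟨⟨b, hb⟩, h⟩ := mem_iUnion.1 h
      exact (P.disj _ _ hb).le_bot ⟨h, hA⟩
    · rw [mem_singleton_iff.1 h] at hA
      exact P.inf_nmem d hA
  obtain ⟨r, hr, h⟩ := Metric.exists_pos_forall_lt_edist D.isCompact_C hKc.isClosed hdis
  refine ⟨min r 1, lt_min (by exact_mod_cast hr) one_pos, min_le_right _ _, fun w hw hne z hz => ?_⟩
  refine (min_le_left _ _).trans ?_
  have hpK : pole (P.Mw w) ∈ K := by
    rcases List.eq_nil_or_concat w with rfl | ⟨v, d, rfl⟩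
    · exact absurd rfl hne
    rw [List.concat_eq_append] at *
    refine mem_iUnion.2 ⟨d, ?_⟩
    show mobius (P.M d) (ofC (pole (P.Mw (v ++ [d])))) ∈ ((⋃ b : {b // b ≠ d}, P.A b) ∪ {infty})
    rw [← mobius_inv_inft (P.c_ne hw hne), PP.Mw_append, PP.Mw_single, _root_.mul_inv_rev, mobius_mul, mobius_apply_inv]
    by_cases hv : v = []
    · subst hv; right; simp [mobius_one]
    · left
      obtain ⟨hv1, -, hv3⟩ := P.red_append.1 hw
      obtain ⟨e, he⟩ := PP.last_exists hv
      rw [mobius_inv_inft (P.c_ne hv1 hv)]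
      refine mem_iUnion.2 ⟨⟨P.inv e, ?_⟩, P.pole_mem hv1 he⟩
      exact (hv3 e he d (by simp)).symm
  have := h z hz _ hpK
  rw [edist_dist, dist_eq_norm] at this
  have h2 : (r:ℝ≥0∞) = ENNReal.ofReal r := by simp
  rw [h2] at this
  by_contra hlt
  exact absurd this (not_lt.2 (ENNReal.ofReal_le_ofReal (not_le.1 hlt).le))

lemma rectifiable (a : L) {κ R : ℝ} (Cs : P.Cst κ R) (hsum : Summable (P.rho κ)) : Rectifiable D.H := by
  obtain ⟨κ', hκ', hκ1, hsep⟩ := D.pole_sep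
  have hC : μH[1] D.C < ⊤ := by
    refine (measure_iUnion_le _).trans_lt ?_
    haveI := Fintype.ofFinite L
    rw [tsum_fintype]
    exact ENNReal.sum_lt_top.2 fun b _ => D.fin b
  have hpiece : ∀ w, P.Red w → μH[1] ((fun z => mobius (P.Mw w) (ofC z)) '' D.C) ≤
      ENNReal.ofReal (2 * (κ'⁻¹ ^ 2 * P.rho κ w)) * μH[1] D.C := by
    intro w hw
    have hrho := P.rho_nonneg κ w
    have hL : LipschitzOnWith (NNReal.mk (2 * (κ'⁻¹ ^ 2 * P.rho κ w)) (by positivity))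
        (fun z => mobius (P.Mw w) (ofC z)) D.C := by
      by_cases hne : w = []
      · subst hne
        refine LipschitzOnWith.of_dist_le_mul fun x hx y hy => ?_
        simp only [PP.Mw_nil, mobius_one]
        refine (lipschitz_ofC.dist_le_mul x y).trans ?_
        refine mul_le_mul_of_nonneg_right ?_ dist_nonneg
        show (2:ℝ) ≤ 2 * (κ'⁻¹ ^ 2 * P.rho κ [])
        rw [P.rho_nil, mul_one]
        have : 1 ≤ κ'⁻¹ := (one_le_inv₀ hκ').2 hκ1
        nlinarith
      · refine LipschitzOnWith.of_dist_le_mul fun x hx y hy => ?_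
        have hc := P.c_ne hw hne
        have hx1 := hsep w hw hne x hx
        have hy1 := hsep w hw hne y hy
        have hx2 : x ≠ pole (P.Mw w) := by
          intro h; rw [h, sub_self, norm_zero] at hx1; linarith
        have hy2 : y ≠ pole (P.Mw w) := by
          intro h; rw [h, sub_self, norm_zero] at hy1; linarith
        have h := norm_mob_sub hc hx2 hy2
        beta_reduce
        rw [mobius_ofC_of_ne _ _ (den_ne hc hx2), mobius_ofC_of_ne _ _ (den_ne hc hy2)]
        refine (lipschitz_ofC.dist_le_mul _ _).trans ?_
        show (2:ℝ) * dist (mob _ _) (mob _ _) ≤ 2 * (κ'⁻¹ ^ 2 * P.rho κ w) * dist x y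
        rw [dist_eq_norm, dist_eq_norm, mul_assoc]
        refine mul_le_mul_of_nonneg_left ?_ (by norm_num)
        have hrr : rr (P.Mw w) ≤ P.rho κ w := by
          rw [P.rho_red hw hne]
          have : 1 ≤ κ⁻¹ := (one_le_inv₀ Cs.κ_pos).2 Cs.κ_le
          have h2 : 1 ≤ κ⁻¹ ^ 2 := by nlinarith
          nlinarith [rr_nonneg (P.Mw w)]
        have h3 : κ' ^ 2 ≤ ‖x - pole (P.Mw w)‖ * ‖y - pole (P.Mw w)‖ := by
          rw [sq]; exact mul_le_mul hx1 hy1 hκ'.le (norm_nonneg _)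
        have h4 : ‖mob (P.Mw w) x - mob (P.Mw w) y‖ * κ' ^ 2 ≤ P.rho κ w * ‖x - y‖ := by
          calc _ ≤ ‖mob (P.Mw w) x - mob (P.Mw w) y‖ * (‖x - pole (P.Mw w)‖ * ‖y - pole (P.Mw w)‖) :=
                mul_le_mul_of_nonneg_left h3 (norm_nonneg _)
            _ = rr (P.Mw w) * ‖x - y‖ := h
            _ ≤ _ := mul_le_mul_of_nonneg_right hrr (norm_nonneg _)
        rw [inv_pow, mul_assoc, ← div_eq_inv_mul, le_div_iff₀ (by positivity)]
        exact h4
    have := hL.hausdorffMeasure_image_le (d := 1) zero_le_one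
    rw [ENNReal.rpow_one] at this
    refine this.trans (le_of_eq ?_)
    congr 1
    rw [ENNReal.ofReal]
    congr 1
    ext; simp
    positivity
  have hLam : μH[1] P.Lam = 0 := by
    have := hausdorffMeasure_of_dimH_lt (d := (1 : ℝ≥0)) (s := P.Lam) (by simpa using P.dimH_lt_of_summable Cs hsum)
    simpa using this
  have hsub : D.H ⊆ P.Lam ∪ ⋃ w : List L, {y | P.Red w ∧ y ∈ (fun z => mobius (P.Mw w) (ofC z)) '' D.C} := by
    intro y hy
    rcases D.H_cases a hy with h | ⟨w, hr, z, hz, e⟩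
    · exact Or.inl h
    · exact Or.inr (mem_iUnion.2 ⟨w, hr, z, hz, e.symm⟩)
  unfold Rectifiable
  refine (measure_mono hsub).trans_lt ((measure_union_le _ _).trans_lt ?_)
  rw [hLam, zero_add]
  refine (measure_iUnion_le _).trans_lt ?_
  have hb : ∀ w : List L, μH[1] {y | P.Red w ∧ y ∈ (fun z => mobius (P.Mw w) (ofC z)) '' D.C} ≤
      ENNReal.ofReal (2 * (κ'⁻¹ ^ 2 * P.rho κ w)) * μH[1] D.C := by
    intro w
    by_cases hw : P.Red w
    · refine (measure_mono ?_).trans (hpiece w hw)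
      exact fun y hy => hy.2
    · have : {y | P.Red w ∧ y ∈ (fun z => mobius (P.Mw w) (ofC z)) '' D.C} = ∅ := by
        ext y; simp [hw]
      rw [this]; simp
  refine (ENNReal.tsum_le_tsum hb).trans_lt ?_
  rw [ENNReal.tsum_mul_right]
  refine ENNReal.mul_lt_top ?_ hC
  exact (((hsum.mul_left _).mul_left _).tsum_ofReal_lt_top)

theorem forward (D : Marks P) (a : L) {Γ : Subgroup PSL2C} (h : P.Gen Γ) (hd : dimH P.Lam < 1) :
    ∃ η, IsQuasiCircle Γ η ∧ Rectifiable η := by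
  obtain ⟨κ, R, Cs⟩ := P.exists_Cst
  have hLam : μH[1] P.Lam = 0 := by
    have := hausdorffMeasure_of_dimH_lt (d := (1 : ℝ≥0)) (s := P.Lam) (by simpa using hd)
    simpa using this
  have h0 : μH[1] (ofC ⁻¹' P.Lam) = 0 := by
    obtain ⟨K, hK⟩ := lipschitzOn_toC R
    have hsub : P.Lam ⊆ ofC '' Metric.closedBall 0 R := by
      intro x hx
      obtain ⟨b, hb⟩ := P.Lam_sub_A hx
      obtain ⟨z, rfl⟩ := (sph_cases x).resolve_left (fun h => P.inf_nmem_Lam (h ▸ hx))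
      exact ⟨z, by simpa using Cs.bd b z hb, rfl⟩
    have := (hK.mono hsub).hausdorffMeasure_image_le (d := 1) zero_le_one
    rw [hLam, mul_zero] at this
    refine le_antisymm ((measure_mono ?_).trans this) zero_le
    intro z hz
    exact ⟨ofC z, hz, toC_ofC z⟩
  have hs := P.summable_of_null Cs h0
  refine ⟨D.H, ⟨D.H_jordan a, ?_, ?_⟩, D.rectifiable a Cs hs⟩
  · rw [P.Lam_eq_limitSet h]; exact D.Lam_sub_H a
  · have key : ∀ g : SL2C, (g : PSL2C) ∈ Γ → mobius g '' D.H ⊆ D.H := by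
      rintro g hg _ ⟨x, hx, rfl⟩
      obtain ⟨w, -, hw⟩ := h.2 g hg
      rw [hw]; exact D.H_mapw w hx
    intro g hg
    refine (key g hg).antisymm fun y hy => ?_
    have : ((g⁻¹ : SL2C) : PSL2C) ∈ Γ := by
      rw [QuotientGroup.mk_inv]; exact Γ.inv_mem hg
    exact ⟨mobius g⁻¹ y, key _ this ⟨y, hy, rfl⟩, mobius_apply_inv g y⟩

end Marks
end QC
end
end

section
open Filter Set Topology RSphere MeasureTheory
open scoped ENNReal NNReal
noncomputable section
set_option linter.all false
namespace QC

/-- conjugate subgroups -/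
def Cj (T : SL2C) (Γ Γ' : Subgroup PSL2C) : Prop :=
  ∀ g : SL2C, (g : PSL2C) ∈ Γ' ↔ ((T⁻¹ * g * T : SL2C) : PSL2C) ∈ Γ

lemma Cj.symm {T : SL2C} {Γ Γ' : Subgroup PSL2C} (h : Cj T Γ Γ') : Cj T⁻¹ Γ' Γ := by
  intro g
  rw [h]
  have : T⁻¹ * (T⁻¹⁻¹ * g * T⁻¹) * T = g := by group
  rw [this]

lemma mobius_image_inv (T : SL2C) (s : Set RSphere) : mobius T⁻¹ '' (mobius T '' s) = s := by
  rw [image_image]; simp [mobius_inv_apply]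

lemma mobius_image_inv' (T : SL2C) (s : Set RSphere) : mobius T '' (mobius T⁻¹ '' s) = s := by
  rw [image_image]; simp [mobius_apply_inv]

lemma Cj.limit_sub {T : SL2C} {Γ Γ' : Subgroup PSL2C} (h : Cj T Γ Γ') :
    mobius T '' limitSet Γ ⊆ limitSet Γ' := by
  rintro _ ⟨w, ⟨z, hz⟩, rfl⟩
  refine ⟨mobius T z, ?_⟩
  rw [accPt_iff_nhds] at hz ⊢
  intro U hU
  obtain ⟨y, ⟨hyU, g, hg, rfl⟩, hne⟩ := hz (mobius T ⁻¹' U) ((continuous_mobius T).continuousAt hU)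
  refine ⟨_, ⟨hyU, T * g * T⁻¹, ?_, ?_⟩, fun e => hne (mobius_injective T e)⟩
  · rw [h]
    have : T⁻¹ * (T * g * T⁻¹) * T = g := by group
    rw [this]; exact hg
  · rw [mobius_mul, mobius_mul, mobius_inv_apply]

lemma Cj.limit {T : SL2C} {Γ Γ' : Subgroup PSL2C} (h : Cj T Γ Γ') :
    limitSet Γ' = mobius T '' limitSet Γ := by
  refine subset_antisymm ?_ h.limit_sub
  rw [← mobius_image_inv' T (limitSet Γ')]
  exact image_mono h.symm.limit_sub

lemma dimH_mobius (T : SL2C) (s : Set RSphere) : dimH (mobius T '' s) = dimH s := by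
  have key : ∀ T : SL2C, ∀ s, dimH (mobius T '' s) ≤ dimH s := by
    intro T s
    obtain ⟨K, hK⟩ := lipschitz_mobius T
    exact hK.dimH_image_le s
  refine le_antisymm (key T s) ?_
  conv_lhs => rw [← mobius_image_inv T s]
  exact key _ _

lemma Cj.dim {T : SL2C} {Γ Γ' : Subgroup PSL2C} (h : Cj T Γ Γ') : limitDim Γ' = limitDim Γ := by
  rw [limitDim, h.limit, dimH_mobius]; rfl

lemma jordan_mobius (T : SL2C) {s : Set RSphere} (h : IsJordanCurve s) : IsJordanCurve (mobius T '' s) := by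
  obtain ⟨f, hc, hi, rfl⟩ := h
  refine ⟨fun z => mobius T (f z), (continuous_mobius T).comp_continuousOn hc, 
    fun x hx y hy e => hi hx hy (mobius_injective T e), ?_⟩
  rw [image_image]

lemma Cj.quasi {T : SL2C} {Γ Γ' : Subgroup PSL2C} (h : Cj T Γ Γ')
    (hq : ∃ η, IsQuasiCircle Γ η ∧ Rectifiable η) : ∃ η, IsQuasiCircle Γ' η ∧ Rectifiable η := by
  obtain ⟨η, ⟨hj, hl, hi⟩, hr⟩ := hq
  refine ⟨mobius T '' η, ⟨jordan_mobius T hj, ?_, ?_⟩, ?_⟩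
  · rw [h.limit]; exact image_mono hl
  · intro g hg
    have := hi _ ((h g).1 hg)
    conv_rhs => rw [← this]
    rw [image_image, image_image]
    refine image_congr fun x _ => ?_
    rw [mobius_mul, mobius_mul, mobius_apply_inv]
  · obtain ⟨K, hK⟩ := lipschitz_mobius T
    have := hK.lipschitzOnWith (s := η) |>.hausdorffMeasure_image_le (d := 1) zero_le_one
    exact this.trans_lt (ENNReal.mul_lt_top (by simp) hr)

/-- word reduction -/
lemma PP.reduce {L : Type} (P : PP L) (w : List L) : ∃ v, P.Red v ∧ P.Mw v = P.Mw w := by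
  induction w with
  | nil => exact ⟨[], P.red_nil, rfl⟩
  | cons a w ih =>
    obtain ⟨v, hv, e⟩ := ih
    by_cases h : ∀ b ∈ v.head?, b ≠ P.inv a
    · exact ⟨a :: v, P.red_cons hv h, by rw [PP.Mw_cons, PP.Mw_cons, e]⟩
    · push Not at h
      obtain ⟨b, hb, rfl⟩ := h
      cases v with
      | nil => simp at hb
      | cons c v =>
        simp at hb
        subst hb
        refine ⟨v, hv.tail', ?_⟩
        rw [PP.Mw_cons, ← e, PP.Mw_cons, P.M_inv, mul_inv_cancel_left]

lemma PP.Mw_rev {L : Type} (P : PP L) (w : List L) : ∃ v, P.Mw v = (P.Mw w)⁻¹ := by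
  induction w with
  | nil => exact ⟨[], by simp⟩
  | cons a w ih =>
    obtain ⟨v, e⟩ := ih
    exact ⟨v ++ [P.inv a], by rw [PP.Mw_append, PP.Mw_single, PP.Mw_cons, e, P.M_inv, _root_.mul_inv_rev]⟩

/-- letter matrices -/
def Mat {g : ℕ} (gen : Fin g → SL2C) : Fin g ⊕ Fin g → SL2C := Sum.elim (fun i => (gen i)⁻¹) gen

lemma PP.gen_of {g : ℕ} (gen : Fin g → SL2C) (P : PP (Fin g ⊕ Fin g)) (hM : P.M = Mat gen) :
    P.Gen (Subgroup.closure (Set.range fun i => ((gen i : PSL2C)))) := by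
  have hg : ∀ i, ((gen i : SL2C) : PSL2C) ∈ Subgroup.closure (Set.range fun i => ((gen i : PSL2C))) :=
    fun i => Subgroup.subset_closure ⟨i, rfl⟩
  refine ⟨?_, ?_⟩
  · rintro (i | i)
    · rw [hM]; show (((gen i)⁻¹ : SL2C) : PSL2C) ∈ _
      rw [QuotientGroup.mk_inv]; exact Subgroup.inv_mem _ (hg i)
    · rw [hM]; exact hg i
  · intro h hh
    have : ∃ w, ((P.Mw w : SL2C) : PSL2C) = (h : PSL2C) := by
      refine Subgroup.closure_induction (p := fun x _ => ∃ w, ((P.Mw w : SL2C) : PSL2C) = x) ?_ ?_ ?_ ?_ hh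
      · rintro _ ⟨i, rfl⟩
        exact ⟨[Sum.inr i], by rw [PP.Mw_single, hM]; rfl⟩
      · exact ⟨[], by simp⟩
      · rintro x y _ _ ⟨w, rfl⟩ ⟨v, rfl⟩
        exact ⟨w ++ v, by rw [PP.Mw_append, QuotientGroup.mk_mul]⟩
      · rintro x _ ⟨w, rfl⟩
        obtain ⟨v, e⟩ := P.Mw_rev w
        exact ⟨v, by rw [e, QuotientGroup.mk_inv]⟩
    obtain ⟨w, hw⟩ := this
    obtain ⟨v, hv, e⟩ := P.reduce w
    exact ⟨v, hv, fun x => by rw [e]; exact (mobius_congr hw x).symm⟩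

/-- Schottky data normalized at infinity -/
structure Dat (g : ℕ) where
  gen : Fin g → SL2C
  D : Fin g ⊕ Fin g → Set RSphere
  isOpen : ∀ i, IsOpen (D i)
  nonempty : ∀ i, (D i).Nonempty
  jordan : ∀ i, IsJordanCurve (frontier (D i))
  disj : ∀ i j, i ≠ j → Disjoint (closure (D i)) (closure (D j))
  bdry : ∀ i : Fin g, mobius (gen i) '' frontier (D (Sum.inl i)) = frontier (D (Sum.inr i))
  off : ∀ i : Fin g, Disjoint (mobius (gen i) '' D (Sum.inl i)) (D (Sum.inr i))
  inf : ∀ i, infty ∉ closure (D i)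

lemma exists_to_inf (z : RSphere) : ∃ T : SL2C, mobius T z = infty := by
  rcases sph_cases z with rfl | ⟨z, rfl⟩
  · exact ⟨1, mobius_one _⟩
  · let T : SL2C := ⟨!![0, -1; 1, -z], by simp [Matrix.det_fin_two]⟩
    have h : den T z = 0 := by
      simp [den, T]
    exact ⟨T, by rw [mobius_ofC, if_pos h]⟩

lemma image_closure_mobius (T : SL2C) (s : Set RSphere) : closure (mobius T '' s) = mobius T '' closure s :=
  ((mobiusHomeo T).image_closure s).symm
lemma image_frontier_mobius (T : SL2C) (s : Set RSphere) : frontier (mobius T '' s) = mobius T '' frontier s :=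
  ((mobiusHomeo T).image_frontier s).symm

lemma normalize {g : ℕ} (hg : 0 < g) (S : SchottkyData g) : ∃ (S' : Dat g) (T : SL2C),
    Cj T S.group (Subgroup.closure (Set.range fun i => ((S'.gen i : PSL2C)))) := by
  obtain ⟨z0, hz0⟩ : ∃ z0, ∀ i, z0 ∉ closure (S.D i) := by
    by_contra hcon
    push Not at hcon
    set a : Fin g ⊕ Fin g := Sum.inl ⟨0, hg⟩
    set b : Fin g ⊕ Fin g := Sum.inr ⟨0, hg⟩
    have hab : b ≠ a := by simp [a, b]
    have hc : IsClopen (closure (S.D a)) := by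
      refine ⟨isClosed_closure, ?_⟩
      have : closure (S.D a) = (⋃ i : {i // i ≠ a}, closure (S.D i))ᶜ := by
        ext x; constructor
        · intro hx h
          obtain ⟨⟨i, hi⟩, h⟩ := mem_iUnion.1 h
          have := S.disjointClosures i a hi
          exact (this ▸ (⟨h, hx⟩ : x ∈ closure (S.D i) ∩ closure (S.D a)) : x ∈ (∅ : Set RSphere))
        · intro hx
          obtain ⟨i, hi⟩ := hcon x
          by_cases e : i = a
          · exact e ▸ hi
          · exact absurd (mem_iUnion.2 ⟨⟨i, e⟩, hi⟩) hx
      rw [this]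
      exact (isClosed_iUnion_of_finite fun i => isClosed_closure).isOpen_compl
    have hu := hc.eq_univ ((S.nonempty a).mono subset_closure)
    obtain ⟨x, hx⟩ := S.nonempty b
    have := S.disjointClosures b a hab
    rw [hu, inter_univ] at this
    exact (this ▸ subset_closure hx : x ∈ (∅ : Set RSphere))
  obtain ⟨T, hT⟩ := exists_to_inf z0
  refine ⟨⟨fun i => T * S.gen i * T⁻¹, fun i => mobius T '' S.D i, fun i => ?_, fun i => (S.nonempty i).image _,
    fun i => ?_, fun i j hij => ?_, fun i => ?_, fun i => ?_, fun i => ?_⟩, T, ?_⟩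
  · exact (mobiusHomeo T).isOpenMap _ (S.isOpen i)
  · rw [image_frontier_mobius]; exact jordan_mobius T (S.jordan i)
  · rw [image_closure_mobius, image_closure_mobius, disjoint_image_iff (mobius_injective T)]
    exact disjoint_iff_inter_eq_empty.2 (S.disjointClosures i j hij)
  · rw [image_frontier_mobius, image_frontier_mobius, ← S.maps_boundary, image_image, image_image]
    exact image_congr fun x _ => by rw [mobius_mul, mobius_mul, mobius_inv_apply]
  · have : mobius (T * S.gen i * T⁻¹) '' (mobius T '' S.D (Sum.inl i)) = mobius T '' (mobius (S.gen i) '' S.D (Sum.inl i)) := by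
      rw [image_image, image_image]
      exact image_congr fun x _ => by rw [mobius_mul, mobius_mul, mobius_inv_apply]
    rw [this, disjoint_image_iff (mobius_injective T)]
    exact disjoint_iff_inter_eq_empty.2 (S.maps_off i)
  · rw [image_closure_mobius]
    rintro ⟨x, hx, e⟩
    rw [← hT] at e
    exact hz0 i (mobius_injective T e ▸ hx)
  · have e1 : (Subgroup.closure (Set.range fun i => ((T * S.gen i * T⁻¹ : SL2C) : PSL2C))) =
        S.group.map (MulAut.conj (T : PSL2C)).toMonoidHom := by
      rw [SchottkyData.group, MonoidHom.map_closure, ← range_comp]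
      rfl
    intro g
    simp only [e1, Subgroup.mem_map]
    constructor
    · rintro ⟨x, hx, e⟩
      have : (((T⁻¹ * g * T : SL2C)) : PSL2C) = x := by
        rw [QuotientGroup.mk_mul, QuotientGroup.mk_mul, ← e, QuotientGroup.mk_inv]
        simp [MulAut.conj_apply]; group
      rw [this]; exact hx
    · intro h
      refine ⟨_, h, ?_⟩
      rw [QuotientGroup.mk_mul, QuotientGroup.mk_mul, QuotientGroup.mk_inv]
      simp [MulAut.conj_apply]; group

lemma trivial_case (S : SchottkyData 0) : limitDim S.group < 1 ∧ ∃ η, IsQuasiCircle S.group η ∧ Rectifiable η := by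
  have hbot : S.group = ⊥ := by
    rw [SchottkyData.group, range_eq_empty, Subgroup.closure_empty]
  have hact : ∀ g : SL2C, (g : PSL2C) ∈ S.group → ∀ x, mobius g x = x := by
    intro g hg x
    rw [hbot, Subgroup.mem_bot] at hg
    rw [mobius_congr (h := 1) (by rw [hg]; simp) x, mobius_one]
  have hlim : limitSet S.group = ∅ := by
    rw [eq_empty_iff_forall_notMem]
    rintro w ⟨z, hz⟩
    rw [accPt_iff_nhds] at hz
    have hsub : mobiusOrbit S.group z ⊆ {z} := by
      rintro _ ⟨g, hg, rfl⟩
      exact hact g hg z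
    by_cases e : w = z
    · obtain ⟨y, ⟨-, hy⟩, hne⟩ := hz univ univ_mem
      exact hne ((hsub hy).trans e.symm)
    · obtain ⟨y, ⟨hy1, hy⟩, hne⟩ := hz {z}ᶜ (isOpen_compl_singleton.mem_nhds e)
      exact hy1 (hsub hy)
  refine ⟨by rw [limitDim, hlim, dimH_empty]; exact zero_lt_one, ofC '' unitCircle, ⟨⟨ofC, continuous_ofC.continuousOn, ofC_injective.injOn, rfl⟩, ?_, ?_⟩, ?_⟩
  · rw [hlim]; exact empty_subset _
  · intro g hg
    rw [image_congr fun x _ => hact g hg x, image_id']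
  · have h1 : unitCircle ⊆ (fun t : ℝ => Complex.exp (t * Complex.I)) '' Icc (-Real.pi) Real.pi := by
      intro z hz
      have hz1 : ‖z‖ = 1 := by simpa [unitCircle] using hz
      refine ⟨z.arg, ⟨(Complex.neg_pi_lt_arg z).le, Complex.arg_le_pi z⟩, ?_⟩
      have := Complex.norm_mul_exp_arg_mul_I z
      rw [hz1] at this; simpa using this
    have hL : LipschitzWith 1 (fun t : ℝ => Complex.exp (t * Complex.I)) := by
      refine lipschitzWith_of_nnnorm_deriv_le (fun t => ?_) fun t => ?_
      · fun_prop
      · have : HasDerivAt (fun t : ℝ => Complex.exp (t * Complex.I)) (Complex.exp (t * Complex.I) * (1 * Complex.I)) t := by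
          have h := ((hasDerivAt_id (t:ℂ)).mul_const Complex.I).cexp.comp_ofReal
          simpa using h
        rw [this.deriv]
        rw [← NNReal.coe_le_coe]
        simp [Complex.norm_exp_ofReal_mul_I]
    have h2 : μH[1] (unitCircle) < ⊤ := by
      refine (measure_mono h1).trans_lt ?_
      have := hL.lipschitzOnWith (s := Icc (-Real.pi) Real.pi) |>.hausdorffMeasure_image_le (d := 1) zero_le_one
      refine this.trans_lt ?_
      rw [hausdorffMeasure_real, Real.volume_Icc]
      simp
    have := lipschitz_ofC.lipschitzOnWith (s := unitCircle) |>.hausdorffMeasure_image_le (d := 1) zero_le_one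
    exact this.trans_lt (ENNReal.mul_lt_top (by simp) h2)

end QC
end
end

section
open Filter Set Topology RSphere MeasureTheory
open scoped ENNReal NNReal
noncomputable section
set_option linter.all false
namespace QC

lemma jordan_one_sph {J V1 V2 : Set RSphere} (hJ : IsJordanCurve J) (hJi : infty ∉ J)
    (o1 : IsOpen V1) (o2 : IsOpen V2) (b1 : infty ∉ closure V1) (b2 : infty ∉ closure V2) (n1 : V1.Nonempty) (n2 : V2.Nonempty)
    (hd : Disjoint V1 V2) (f1 : frontier V1 ⊆ J) (f2 : frontier V2 ⊆ J) (h1 : Disjoint V1 J) (h2 : Disjoint V2 J) : False := by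
  obtain ⟨g, hgc, hgr, hg⟩ := jordan_param hJ (one_ne_zero : (1:ℝ) ≠ 0)
  have hne : ∀ t, g t ≠ infty := fun t h => hJi (h ▸ hgr ▸ mem_range_self t)
  set γ : ℝ → ℂ := fun t => toC (g t) with hγ
  have e : ∀ t, ofC (γ t) = g t := fun t => ofC_toC (hne t)
  have hγc : Continuous γ := by
    rw [continuous_iff_continuousAt]
    intro t
    exact (continuousOn_toC.continuousAt (isOpen_compl_singleton.mem_nhds (hne t))).comp hgc.continuousAt
  have him : γ '' Icc 0 1 = ofC ⁻¹' J := by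
    ext z; constructor
    · rintro ⟨t, -, rfl⟩
      show ofC (γ t) ∈ J
      rw [e, ← hgr]; exact mem_range_self t
    · intro hz
      have : ofC z ∈ J := hz
      rw [← hgr] at this
      obtain ⟨t, ht⟩ := this
      refine ⟨Int.fract t, ⟨Int.fract_nonneg t, (Int.fract_lt_one t).le⟩, ofC_injective ?_⟩
      rw [e, ← ht, hg]
      exact ⟨-⌊t⌋, by rw [Int.fract]; push_cast; ring⟩
  have cond : ∀ V : Set RSphere, infty ∉ closure V → V.Nonempty → Bornology.IsBounded (ofC ⁻¹' V) ∧ (ofC ⁻¹' V).Nonempty := by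
    intro V hV ⟨x, hx⟩
    refine ⟨(isCompact_preimage isClosed_closure hV).isBounded.subset (preimage_mono subset_closure), ?_⟩
    obtain ⟨z, rfl⟩ := (sph_cases x).resolve_left (fun h => hV (h ▸ subset_closure hx))
    exact ⟨z, hx⟩
  refine jordan_one (V1 := ofC ⁻¹' V1) (V2 := ofC ⁻¹' V2) hγc.continuousOn ?_ ?_ (o1.preimage continuous_ofC) (o2.preimage continuous_ofC)
    (cond V1 b1 n1).1 (cond V2 b2 n2).1 (cond V1 b1 n1).2 (cond V2 b2 n2).2 (hd.preimage ofC) ?_ ?_ ?_ ?_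
  · apply ofC_injective
    rw [e, e, hg]
    exact ⟨-1, by norm_num⟩
  · intro s hs t ht hst
    have : g s = g t := by rw [← e, ← e, hst]
    obtain ⟨n, hn⟩ := (hg s t).1 this
    rw [mul_one] at hn
    have h1 : (n:ℝ) ≤ 1 := by linarith [hs.2, ht.1]
    have h2 : (-1:ℝ) ≤ n := by linarith [hs.1, ht.2]
    have h1' : n ≤ 1 := by exact_mod_cast h1
    have h2' : -1 ≤ n := by exact_mod_cast h2
    have : n = -1 ∨ n = 0 ∨ n = 1 := by omega
    rcases this with rfl | rfl | rfl
    · right; left; push_cast at hn; constructor <;> linarith [hs.1, ht.2]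
    · left; push_cast at hn; linarith
    · right; right; push_cast at hn; constructor <;> linarith [hs.2, ht.1]
  · rw [him, ← isOpenMap_ofC.preimage_frontier_eq_frontier_preimage continuous_ofC]
    exact preimage_mono f1
  · rw [him, ← isOpenMap_ofC.preimage_frontier_eq_frontier_preimage continuous_ofC]
    exact preimage_mono f2
  · rw [him]; exact h1.preimage ofC
  · rw [him]; exact h2.preimage ofC

lemma jordan_sphere {V : Set RSphere} (hV : IsOpen V) (hn : V.Nonempty) (hi : infty ∉ closure V)
    (hJ : IsJordanCurve (frontier V)) : IsPreconnected V ∧ IsPreconnected (closure V)ᶜ := by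
  have hJi : infty ∉ frontier V := fun h => hi (frontier_subset_closure h)
  have notin : ∀ {A B : Set RSphere} {x}, IsOpen B → Disjoint A B → x ∈ closure A → x ∉ B := by
    intro A B x hB hd hx hxB
    exact (hd.closure_left hB).le_bot ⟨hx, hxB⟩
  constructor
  · rw [isPreconnected_iff_subset_of_disjoint]
    intro u v hu hv hs hd
    by_contra hcon
    push Not at hcon
    obtain ⟨h1, h2⟩ := hcon
    obtain ⟨x, hx, hxu⟩ := not_subset.1 h1
    obtain ⟨y, hy, hyv⟩ := not_subset.1 h2
    have hxv := (hs hx).resolve_left hxu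
    have hyu := (hs hy).resolve_right hyv
    have hdis : Disjoint (V ∩ u) (V ∩ v) := by
      rw [Set.disjoint_left]
      rintro z ⟨h1, h2⟩ ⟨-, h3⟩
      exact (hd ▸ (⟨h1, h2, h3⟩ : z ∈ V ∩ (u ∩ v)) : z ∈ (∅ : Set RSphere))
    have key : ∀ u v, IsOpen u → IsOpen v → V ⊆ u ∪ v → Disjoint (V ∩ u) (V ∩ v) → frontier (V ∩ u) ⊆ frontier V := by
      intro u v hu hv hs hd z hz
      rw [hV.frontier_eq]
      refine ⟨closure_mono inter_subset_left (frontier_subset_closure hz), fun hzV => ?_⟩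
      rcases hs hzV with h | h
      · rw [(hV.inter hu).frontier_eq] at hz
        exact hz.2 ⟨hzV, h⟩
      · exact notin (hV.inter hv) hd (frontier_subset_closure hz) ⟨hzV, h⟩
    refine jordan_one_sph hJ hJi (hV.inter hu) (hV.inter hv) (fun h => hi (closure_mono inter_subset_left h))
      (fun h => hi (closure_mono inter_subset_left h)) ⟨y, hy, hyu⟩ ⟨x, hx, hxv⟩ hdis (key u v hu hv hs hdis)
      (key v u hv hu (by rwa [union_comm]) hdis.symm) ?_ ?_
    · rw [hV.frontier_eq]
      exact disjoint_sdiff_right.mono_left inter_subset_left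
    · rw [hV.frontier_eq]
      exact disjoint_sdiff_right.mono_left inter_subset_left
  · set E := (closure V)ᶜ with hE
    have hEo : IsOpen E := isClosed_closure.isOpen_compl
    have key : ∀ u v, IsOpen u → IsOpen v → E ⊆ u ∪ v → E ∩ (u ∩ v) = ∅ → infty ∈ u → E ⊆ u := by
      intro u v hu hv hs hd hiu
      by_contra hcon
      obtain ⟨x, hx, hxu⟩ := not_subset.1 hcon
      have hxv := (hs hx).resolve_left hxu
      have hdis : Disjoint (E ∩ v) (E ∩ u) := by
        rw [Set.disjoint_left]
        rintro z ⟨h1, h2⟩ ⟨-, h3⟩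
        exact (hd ▸ (⟨h1, h3, h2⟩ : z ∈ E ∩ (u ∩ v)) : z ∈ (∅ : Set RSphere))
      have hVE : Disjoint V E := disjoint_left.2 fun x hx h => h (subset_closure hx)
      have hfE : frontier (E ∩ v) ⊆ frontier V := by
        intro z hz
        have hzc := frontier_subset_closure hz
        rw [hV.frontier_eq]
        have hzE : z ∉ E := by
          intro hzE
          rcases hs hzE with h | h
          · exact notin (hEo.inter hu) hdis hzc ⟨hzE, h⟩
          · rw [(hEo.inter hv).frontier_eq] at hz
            exact hz.2 ⟨hzE, h⟩
        refine ⟨by simpa [hE] using hzE, ?_⟩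
        exact notin hV (hVE.symm.mono_left inter_subset_left) hzc
      refine jordan_one_sph hJ hJi hV (hEo.inter hv) hi ?_ hn ⟨x, hx, hxv⟩ (hVE.mono_right inter_subset_left)
        subset_rfl hfE ?_ ?_
      · exact fun h => notin (hEo.inter hu) hdis h ⟨hi, hiu⟩
      · rw [hV.frontier_eq]; exact disjoint_sdiff_right
      · exact disjoint_left.2 fun z hz h => hz.1 (frontier_subset_closure h)
    rw [isPreconnected_iff_subset_of_disjoint]
    intro u v hu hv hs hd
    rcases hs (show infty ∈ E from hi) with h | h
    · exact Or.inl (key u v hu hv hs hd h)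
    · exact Or.inr (key v u hv hu (by rwa [union_comm]) (by rwa [inter_comm v u]) h)

namespace Dat
variable {g : ℕ} (S : Dat g)

lemma conn (a) : IsPreconnected (S.D a) := (jordan_sphere (S.isOpen a) (S.nonempty a) (S.inf a) (S.jordan a)).1
lemma conn' (a) : IsPreconnected (closure (S.D a))ᶜ := (jordan_sphere (S.isOpen a) (S.nonempty a) (S.inf a) (S.jordan a)).2

lemma im1 (i : Fin g) : mobius (S.gen i) '' S.D (Sum.inl i) = (closure (S.D (Sum.inr i)))ᶜ := by
  set U := mobius (S.gen i) '' S.D (Sum.inl i) with hU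
  set V := S.D (Sum.inr i)
  have hUo : IsOpen U := (mobiusHomeo (S.gen i)).isOpenMap _ (S.isOpen _)
  have hV : IsOpen V := S.isOpen _
  have hfr : frontier U = frontier V := by rw [hU, image_frontier_mobius, S.bdry]
  have hsub : U ⊆ (closure V)ᶜ := by
    intro x hx h
    by_cases hxV : x ∈ V
    · exact (S.off i).le_bot ⟨hx, hxV⟩
    · have : x ∈ frontier U := by rw [hfr, hV.frontier_eq]; exact ⟨h, hxV⟩
      rw [hUo.frontier_eq] at this
      exact this.2 hx
  refine hsub.antisymm ?_
  have hc := S.conn' (Sum.inr i)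
  refine hc.subset_of_closure_inter_subset hUo ?_ ?_
  · obtain ⟨x, hx⟩ := (S.nonempty (Sum.inl i)).image (mobius (S.gen i))
    exact ⟨x, hsub hx, hx⟩
  · rintro x ⟨hx, hxV⟩
    by_contra hxU
    have : x ∈ frontier U := by rw [hUo.frontier_eq]; exact ⟨hx, hxU⟩
    rw [hfr] at this
    exact hxV (frontier_subset_closure this)

lemma im2 (i : Fin g) : mobius (S.gen i) '' closure (S.D (Sum.inl i)) = (S.D (Sum.inr i))ᶜ := by
  rw [closure_eq_self_union_frontier, image_union, S.im1, S.bdry, (S.isOpen (Sum.inr i)).frontier_eq]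
  ext x
  have : x ∈ S.D (Sum.inr i) → x ∈ closure (S.D (Sum.inr i)) := fun h => subset_closure h
  simp only [mem_union, mem_compl_iff, Set.mem_sdiff]
  tauto

lemma map1 {i : Fin g} {x} (h : x ∉ closure (S.D (Sum.inl i))) : mobius (S.gen i) x ∈ S.D (Sum.inr i) := by
  by_contra hcon
  have : mobius (S.gen i) x ∈ (S.D (Sum.inr i))ᶜ := hcon
  rw [← S.im2] at this
  obtain ⟨y, hy, e⟩ := this
  exact h (mobius_injective _ e ▸ hy)

lemma map2 {i : Fin g} {x} (h : x ∉ closure (S.D (Sum.inr i))) : mobius (S.gen i)⁻¹ x ∈ S.D (Sum.inl i) := by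
  have : x ∈ (closure (S.D (Sum.inr i)))ᶜ := h
  rw [← S.im1] at this
  obtain ⟨y, hy, rfl⟩ := this
  rw [mobius_inv_apply]; exact hy

/-- build a ping-pong system -/
def mkPP (A : Fin g ⊕ Fin g → Set RSphere) (hc : ∀ a, IsClosed (A a)) (hi : ∀ a, infty ∉ A a)
    (hd : ∀ a b, a ≠ b → Disjoint (A a) (A b))
    (h1 : ∀ i x, x ∉ A (Sum.inl i) → mobius (S.gen i) x ∈ A (Sum.inr i))
    (h2 : ∀ i x, x ∉ A (Sum.inr i) → mobius (S.gen i)⁻¹ x ∈ A (Sum.inl i)) : PP (Fin g ⊕ Fin g) where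
  inv := Sum.swap
  inv_inv := Sum.swap_swap
  inv_ne := by rintro (i | i) <;> simp
  M := Mat S.gen
  M_inv := by rintro (i | i) <;> simp [Mat]
  A := A
  closed := hc
  inf_nmem := hi
  disj := hd
  map := by
    rintro (i | i) x h
    · exact h2 i x h
    · exact h1 i x h

lemma backward (hg : 0 < g) {η : Set RSphere}
    (hq : IsQuasiCircle (Subgroup.closure (Set.range fun i => ((S.gen i : PSL2C)))) η) (hr : Rectifiable η) :
    limitDim (Subgroup.closure (Set.range fun i => ((S.gen i : PSL2C)))) < 1 := by
  set P := S.mkPP (fun a => closure (S.D a)) (fun a => isClosed_closure) S.inf S.disj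
    (fun i x h => subset_closure (S.map1 h)) (fun i x h => subset_closure (S.map2 h)) with hP
  have hG := P.gen_of S.gen rfl
  rw [limitDim, P.Lam_eq_limitSet hG]
  exact P.backward hG (Sum.inl ⟨0, hg⟩) (Sum.inr ⟨0, hg⟩) (by simp) hq hr

end Dat
end QC
end
end

section
open Filter Set Topology RSphere MeasureTheory
open scoped ENNReal NNReal
noncomputable section
set_option linter.all false
namespace QC

structure Chain (n : ℕ) where
  A : ℕ → Set ℂ
  s : ℕ → ℂ
  t : ℕ → ℂ
  cpt : ∀ k < n, IsCompact (A k)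
  good : ∀ k < n, Good (A k)
  disj : ∀ i < n, ∀ j < n, i ≠ j → Disjoint (A i) (A j)
  hs : ∀ k < n, s k ∈ A k
  ht : ∀ k < n, t k ∈ A k
  hst : ∀ k < n, s k ≠ t k
  accs : ∀ k < n, Acc (A k)ᶜ (s k)
  acct : ∀ k < n, Acc (A k)ᶜ (t k)

namespace Chain
variable {n : ℕ} (C : Chain n)

def U0 : Set ℂ := ⋃ i : Fin n, C.A i
def arcs (c : ℕ → ℝ → ℂ) (k : ℕ) : Set ℂ := ⋃ j : Fin k, c j '' Icc 0 1
def pre (k : ℕ) : Set ℂ := ⋃ i : Fin k, C.A i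

lemma arcs_succ (c : ℕ → ℝ → ℂ) (k : ℕ) : arcs c (k+1) = arcs c k ∪ c k '' Icc 0 1 := by
  ext z
  simp only [arcs, mem_iUnion, mem_union]
  constructor
  · rintro ⟨⟨j, hj⟩, h⟩
    rcases Nat.lt_succ_iff_lt_or_eq.1 hj with h' | rfl
    · exact Or.inl ⟨⟨j, h'⟩, h⟩
    · exact Or.inr h
  · rintro (⟨⟨j, hj⟩, h⟩ | h)
    · exact ⟨⟨j, by omega⟩, h⟩
    · exact ⟨⟨k, by omega⟩, h⟩

lemma pre_succ (k : ℕ) : C.pre (k+1) = C.pre k ∪ C.A k := by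
  ext z
  simp only [pre, mem_iUnion, mem_union]
  constructor
  · rintro ⟨⟨j, hj⟩, h⟩
    rcases Nat.lt_succ_iff_lt_or_eq.1 hj with h' | rfl
    · exact Or.inl ⟨⟨j, h'⟩, h⟩
    · exact Or.inr h
  · rintro (⟨⟨j, hj⟩, h⟩ | h)
    · exact ⟨⟨j, by omega⟩, h⟩
    · exact ⟨⟨k, by omega⟩, h⟩

structure Inv (k : ℕ) (c : ℕ → ℝ → ℂ) : Prop where
  arc : ∀ j < k, IsArcP ((C.pre n)ᶜ ∪ {C.t j, C.s ((j+1) % n)}) (C.t j) (C.s ((j+1) % n)) (c j)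
  cd : ∀ i < k, ∀ j < k, i ≠ j → Disjoint (c i '' Icc 0 1) (c j '' Icc 0 1)
  good : k < n → Good (C.pre (k+1) ∪ arcs c k)

variable {C}

lemma mem_pre {i k : ℕ} (h : i < k) {z : ℂ} (hz : z ∈ C.A i) : z ∈ C.pre k := mem_iUnion.2 ⟨⟨i, h⟩, hz⟩

lemma uniq {i j : ℕ} (hi : i < n) (hj : j < n) {z : ℂ} (h1 : z ∈ C.A i) (h2 : z ∈ C.A j) : i = j := by
  by_contra h
  exact disjoint_left.1 (C.disj i hi j hj h) h1 h2

lemma cpt_pre {k : ℕ} (h : k ≤ n) : IsCompact (C.pre k) :=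
  isCompact_iUnion fun i => C.cpt i (by omega)

/-- points of arcs in the sets -/
lemma Inv.in_arc {k : ℕ} {c} (I : C.Inv k c) {j : ℕ} (hj : j < k) {z : ℂ} (hz : z ∈ c j '' Icc 0 1) (h : z ∈ C.pre n) :
    z = C.t j ∨ z = C.s ((j+1) % n) := by
  obtain ⟨u, hu, rfl⟩ := hz
  rcases (I.arc j hj).sub u hu with h' | h'
  · exact absurd h h'
  · exact h'

lemma Inv.cpt_arcs {k : ℕ} {c} (I : C.Inv k c) : IsCompact (arcs c k) :=
  isCompact_iUnion fun i => isCompact_Icc.image_of_continuousOn (I.arc i i.2).cont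

lemma Inv.t_nmem {k : ℕ} {c} (I : C.Inv k c) (hk : k < n) : C.t k ∉ arcs c k := by
  intro h
  obtain ⟨⟨j, hj⟩, h⟩ := mem_iUnion.1 h
  have hm : (j+1) % n < n := Nat.mod_lt _ (by omega)
  rcases I.in_arc hj h (mem_pre hk (C.ht k hk)) with h' | h'
  · have := uniq hk (by omega) (C.ht k hk) (h' ▸ C.ht j (by omega))
    omega
  · have := uniq hk hm (C.ht k hk) (h' ▸ C.hs _ hm)
    rw [← this] at h'
    exact C.hst k hk h'.symm

lemma Inv.s_nmem {k : ℕ} {c} (I : C.Inv k c) (hk : k < n) : C.s ((k+1)%n) ∉ arcs c k := by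
  intro h
  obtain ⟨⟨j, hj⟩, h⟩ := mem_iUnion.1 h
  have hm : (j+1) % n < n := Nat.mod_lt _ (by omega)
  have hm' : (k+1) % n < n := Nat.mod_lt _ (by omega)
  rcases I.in_arc hj h (mem_pre hm' (C.hs _ hm')) with h' | h'
  · have := uniq hm' (by omega) (C.hs _ hm') (h' ▸ C.ht j (by omega))
    rw [this] at h'
    exact C.hst j (by omega) h'
  · have := uniq hm' hm (C.hs _ hm') (h' ▸ C.hs _ hm)
    rw [Nat.mod_eq_of_lt (by omega : j + 1 < n)] at this
    rcases Nat.lt_or_ge (k+1) n with h1 | h1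
    · rw [Nat.mod_eq_of_lt h1] at this; omega
    · have : k + 1 = n := by omega
      simp_all

lemma Inv.good_mid {k : ℕ} {c} (I : C.Inv k c) (hk : k < n) (m : ℕ) (hm : k + 1 ≤ m) (hmn : m ≤ n) :
    Good (C.pre m ∪ arcs c k) := by
  induction m, hm using Nat.le_induction with
  | base => exact I.good hk
  | succ m hm ih =>
    have ih := ih (by omega)
    have e : C.pre (m+1) ∪ arcs c k = (C.pre m ∪ arcs c k) ∪ C.A m := by
      rw [pre_succ]; ac_rfl
    rw [e]
    apply Good.union ((cpt_pre (by omega)).union I.cpt_arcs).isClosed (C.cpt m (by omega)).isClosed ih (C.good m (by omega))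
    rintro z ⟨h1 | h1, h2⟩
    · obtain ⟨⟨i, hi⟩, h1⟩ := mem_iUnion.1 h1
      have := uniq (by omega) (by omega) h1 h2
      omega
    · obtain ⟨⟨j, hj⟩, h⟩ := mem_iUnion.1 h1
      exfalso
      have hm' : (j+1) % n < n := Nat.mod_lt _ (by omega)
      rcases I.in_arc hj h (mem_pre (by omega) h2) with h' | h'
      · have := uniq (by omega) (by omega) h2 (h' ▸ C.ht j (by omega))
        omega
      · have := uniq (by omega) (by omega) h2 (h' ▸ C.hs _ hm')
        rw [Nat.mod_eq_of_lt (by omega : j + 1 < n)] at this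
        omega

lemma acc_all {k : ℕ} (hk : k < n) {K : Set ℂ} (hK : IsClosed K) {y : ℂ} (hy : y ∈ C.A k) (hyK : y ∉ K)
    (h : Acc (C.A k)ᶜ y) : Acc (C.pre n ∪ K)ᶜ y := by
  let K' : Set ℂ := (⋃ i : {i : Fin n // i.1 ≠ k}, C.A i.1) ∪ K
  have hc : IsClosed K' := (isCompact_iUnion fun i : {i : Fin n // i.1 ≠ k} => C.cpt i.1 i.1.2).isClosed.union hK
  refine (h.diff hc ?_).mono ?_
  · rintro (h | h)
    · obtain ⟨⟨i, hi⟩, h⟩ := mem_iUnion.1 h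
      exact hi (uniq i.2 hk h hy)
    · exact hyK h
  · rintro z ⟨h1, h2⟩ (h3 | h3)
    · obtain ⟨i, hi⟩ := mem_iUnion.1 h3
      by_cases hik : i.1 = k
      · exact h1 (hik ▸ hi)
      · exact h2 (Or.inl (mem_iUnion.2 ⟨⟨i, hik⟩, hi⟩))
    · exact h2 (Or.inr h3)

lemma Inv.step {k : ℕ} {c} (hn : 2 ≤ n) (I : C.Inv k c) (hk : k < n) : ∃ c', C.Inv (k+1) c' := by
  have hm' : (k+1) % n < n := Nat.mod_lt _ (by omega)
  have hne : k ≠ (k+1) % n := by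
    rcases Nat.lt_or_ge (k+1) n with h1 | h1
    · rw [Nat.mod_eq_of_lt h1]; omega
    · have : k + 1 = n := by omega
      rw [this, Nat.mod_self]; omega
  set U := (C.pre n ∪ arcs c k)ᶜ with hU
  have hcpt : IsCompact (C.pre n ∪ arcs c k) := (cpt_pre le_rfl).union I.cpt_arcs
  have hconn : IsPreconnected U := compl_of_good hcpt (I.good_mid hk n hk le_rfl)
  have tne : C.t k ≠ C.s ((k+1)%n) := fun h => hne (uniq hk hm' (C.ht k hk) (h ▸ C.hs _ hm'))
  obtain ⟨f, hf⟩ := Acc.join hcpt.isClosed.isOpen_compl hconn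
    (acc_all hk I.cpt_arcs.isClosed (C.ht k hk) (I.t_nmem hk) (C.acct k hk))
    (acc_all hm' I.cpt_arcs.isClosed (C.hs _ hm') (I.s_nmem hk) (C.accs _ hm'))
    (fun h => h (Or.inl (mem_pre hk (C.ht k hk)))) (fun h => h (Or.inl (mem_pre hm' (C.hs _ hm')))) tne
  have hfd : Disjoint (f '' Icc 0 1) (arcs c k) := by
    rw [disjoint_left]
    rintro _ ⟨u, hu, rfl⟩ h
    rcases hf.sub u hu with h' | h' | h'
    · exact h' (Or.inr h)
    · exact I.t_nmem hk (h' ▸ h)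
    · rw [mem_singleton_iff] at h'
      exact I.s_nmem hk (h' ▸ h)
  let c' : ℕ → ℝ → ℂ := fun j => if j = k then f else c j
  have e1 : c' k = f := if_pos rfl
  have e2 : ∀ j < k, c' j = c j := fun j hj => if_neg (by omega)
  have e3 : arcs c' k = arcs c k := by
    unfold arcs
    exact iUnion_congr fun j => by rw [e2 j j.2]
  refine ⟨c', ⟨?_, ?_, ?_⟩⟩
  · intro j hj
    rcases Nat.lt_succ_iff_lt_or_eq.1 hj with h | rfl
    · rw [e2 j h]; exact I.arc j h
    · rw [e1]
      refine hf.mono (union_subset_union_left _ ?_)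
      intro z hz h
      exact hz (Or.inl h)
  · have key : ∀ i < k, Disjoint (c i '' Icc 0 1) (f '' Icc 0 1) := fun i hi =>
      (hfd.mono_right (subset_iUnion (fun j : Fin k => c j '' Icc 0 1) ⟨i, hi⟩)).symm
    intro i hi j hj hij
    rcases Nat.lt_succ_iff_lt_or_eq.1 hi with h | rfl <;> rcases Nat.lt_succ_iff_lt_or_eq.1 hj with h' | rfl
    · rw [e2 i h, e2 j h']; exact I.cd i h j h' hij
    · rw [e2 i h, e1]; exact key i h
    · rw [e2 j h', e1]; exact (key j h').symm
    · exact absurd rfl hij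
  · intro hk1
    rw [Nat.mod_eq_of_lt hk1] at *
    rw [arcs_succ, e3, e1, pre_succ]
    have e : C.pre (k+1) ∪ C.A (k+1) ∪ (arcs c k ∪ f '' Icc 0 1) = ((C.pre (k+1) ∪ arcs c k) ∪ f '' Icc 0 1) ∪ C.A (k+1) := by
      ac_rfl
    rw [e]
    have hcl := (cpt_pre (C := C) (by omega : k + 1 ≤ n)).union I.cpt_arcs
    have hfc : IsCompact (f '' Icc 0 1) := isCompact_Icc.image_of_continuousOn hf.cont
    have hin : ∀ z ∈ f '' Icc 0 1, z ∈ C.pre n → z = C.t k ∨ z = C.s (k+1) := by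
      rintro _ ⟨u, hu, rfl⟩ h
      rcases hf.sub u hu with h' | h'
      · exact absurd (Or.inl h) h'
      · exact h'
    refine Good.union (hcl.union hfc).isClosed (C.cpt _ hk1).isClosed
      (Good.union hcl.isClosed hfc.isClosed (I.good hk) (arc_good hf.cont hf.inj) ?_) (C.good _ hk1) ?_
    · refine Set.Subsingleton.anti (subsingleton_singleton (a := C.t k)) ?_
      rintro z ⟨h1 | h1, h2⟩
      · obtain ⟨i, h1⟩ := mem_iUnion.1 h1
        have hi : i.1 < n := by omega
        rcases hin z h2 (mem_pre hi h1) with h | h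
        · exact h
        · have := uniq hi hk1 h1 (h ▸ C.hs _ hk1)
          omega
      · exact absurd h1 (disjoint_left.1 hfd h2)
    · refine Set.Subsingleton.anti (subsingleton_singleton (a := C.s (k+1))) ?_
      rintro z ⟨(h1 | h1) | h1, h2⟩
      · obtain ⟨i, h1⟩ := mem_iUnion.1 h1
        have hi : i.1 < n := by omega
        have := uniq hi hk1 h1 h2
        omega
      · obtain ⟨⟨j, hj⟩, h⟩ := mem_iUnion.1 h1
        rcases I.in_arc hj h (mem_pre hk1 h2) with h' | h'
        · have := uniq (by omega) (by omega) h2 (h' ▸ C.ht j (by omega))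
          omega
        · have hjn : j + 1 < n := by omega
          rw [Nat.mod_eq_of_lt hjn] at h'
          have := uniq (by omega) (by omega) h2 (h' ▸ C.hs _ hjn)
          omega
      · rcases hin z h1 (mem_pre hk1 h2) with h | h
        · have := uniq (by omega) (by omega) h2 (h ▸ C.ht k hk)
          omega
        · exact h

lemma exists_inv (hn : 2 ≤ n) (k : ℕ) (hk : k ≤ n) : ∃ c, C.Inv k c := by
  induction k with
  | zero =>
    refine ⟨fun _ _ => 0, ⟨by simp, by simp, fun h => ?_⟩⟩
    have : C.pre (0+1) ∪ arcs (fun _ _ => 0) 0 = C.A 0 := by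
      rw [pre_succ]; simp [pre, arcs]
    rw [this]; exact C.good 0 h
  | succ k ih =>
    obtain ⟨c, I⟩ := ih (by omega)
    exact I.step hn (by omega)

end Chain

/-- ping-pong systems with doubly accessible marks possess arcs -/
lemma PP.exists_marks {L : Type} [Finite L] (P : PP L) (hL : 2 ≤ Nat.card L) (s t : L → ℂ)
    (hs : ∀ a, ofC (s a) ∈ P.A a) (ht : ∀ a, ofC (t a) ∈ P.A a) (hst : ∀ a, s a ≠ t a)
    (hM1 : ∀ a, mobius (P.M a) (ofC (t (P.inv a))) = ofC (s a))
    (hM2 : ∀ a, mobius (P.M a) (ofC (s (P.inv a))) = ofC (t a))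
    (hg : ∀ a, IsPreconnected (ofC ⁻¹' (P.A a))ᶜ)
    (as : ∀ a, Acc (ofC ⁻¹' (P.A a))ᶜ (s a)) (at' : ∀ a, Acc (ofC ⁻¹' (P.A a))ᶜ (t a)) : Nonempty (Marks P) := by
  set n := Nat.card L with hn
  let e : L ≃ Fin n := Finite.equivFin L
  have : NeZero n := ⟨by omega⟩
  let E : ℕ → L := fun k => e.symm (Fin.ofNat n k)
  have eE : ∀ a, E (e a) = a := fun a => by simp [E]
  have Eval : ∀ k < n, (e (E k)).1 = k := fun k hk => by simp [E, Nat.mod_eq_of_lt hk]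
  have cp : ∀ a, IsCompact (ofC ⁻¹' (P.A a)) := fun a => isCompact_preimage (P.closed a) (P.inf_nmem a)
  let C : Chain n :=
    { A := fun k => ofC ⁻¹' (P.A (E k))
      s := fun k => s (E k)
      t := fun k => t (E k)
      cpt := fun k _ => cp _
      good := fun k _ => good_of_compl (cp _) (hg _)
      disj := fun i hi j hj hij => (P.disj _ _ (fun h => hij (by rw [← Eval i hi, ← Eval j hj, h]))).preimage _
      hs := fun k _ => hs _
      ht := fun k _ => ht _
      hst := fun k _ => hst _
      accs := fun k _ => as _
      acct := fun k _ => at' _ }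
  obtain ⟨c, I⟩ := Chain.exists_inv (C := C) hL n le_rfl
  let nxt : L → L := fun a => E ((e a).1 + 1)
  have Emod : ∀ k, E (k % n) = E k := fun k => by
    simp only [E]; congr 1; ext; simp
  have nxt_it : ∀ i a, nxt^[i] a = E ((e a).1 + i) := by
    intro i a
    induction i with
    | zero => simp [eE]
    | succ i ih =>
      rw [Function.iterate_succ_apply', ih]
      show E ((e (E _)).1 + 1) = _
      have : (e (E ((e a).1 + i))).1 = ((e a).1 + i) % n := by simp [E]
      rw [this, ← Emod, Nat.mod_add_mod, Emod]; rfl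
  have arc := fun a => I.arc (e a).1 (e a).2
  refine ⟨{ nxt := nxt, cyc := ?_, s := s, t := t, hs := hs, ht := ht, hst := hst, hM1 := hM1, hM2 := hM2,
            c := fun a => c (e a).1, cont := fun a => (arc a).cont, inj := fun a => (arc a).inj, c0 := ?_, c1 := ?_,
            cdisj := ?_, out := ?_, fin := fun a => (arc a).fin }⟩
  · intro a b
    refine ⟨((e b).1 + (n - (e a).1)) % n, Nat.mod_lt _ (by omega), ?_⟩
    rw [nxt_it, ← Emod, Nat.add_mod_mod, Emod]
    have : (e a).1 + ((e b).1 + (n - (e a).1)) = (e b).1 + n := by have := (e a).2; omega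
    rw [this, ← Emod, Nat.add_mod_right, Emod, eE]
  · intro a
    rw [(arc a).src]
    show t (E _) = _
    rw [eE]
  · intro a
    rw [(arc a).tgt]
    show s (E _) = _
    rw [Emod]
  · intro a b hab
    exact I.cd _ (e a).2 _ (e b).2 (fun h => hab (e.injective (Fin.ext h)))
  · intro a u hu b hb
    have hu' : u ∈ Icc (0:ℝ) 1 := ⟨hu.1.le, hu.2.le⟩
    have hm : c (e a).1 u ∈ C.pre n := Chain.mem_pre (e b).2 (by
      show ofC _ ∈ P.A (E _); rw [eE]; exact hb)
    rcases I.in_arc (e a).2 (mem_image_of_mem _ hu') hm with h | h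
    · rw [← (arc a).src] at h
      have := (arc a).inj hu' (by simp) h
      linarith [hu.1]
    · rw [← (arc a).tgt] at h
      have := (arc a).inj hu' (by simp) h
      linarith [hu.2]

end QC
end
end

section
open Filter Set Topology RSphere MeasureTheory
open scoped ENNReal NNReal
noncomputable section
set_option linter.all false
namespace QC

lemma exists_compact_conn {E C : Set ℂ} (ho : IsOpen E) (hc : IsPreconnected E) {x0 : ℂ} (hx0 : x0 ∈ E)
    (hC : IsCompact C) (hCE : C ⊆ E) : ∃ K, IsCompact K ∧ IsPreconnected K ∧ x0 ∈ K ∧ C ⊆ K ∧ K ⊆ E := by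
  have hp : IsPathConnected E := (ho.isConnected_iff_isPathConnected).1 ⟨⟨x0, hx0⟩, hc⟩
  refine hC.induction_on (p := fun C => ∃ K, IsCompact K ∧ IsPreconnected K ∧ x0 ∈ K ∧ C ⊆ K ∧ K ⊆ E) ?_ ?_ ?_ ?_
  · exact ⟨{x0}, isCompact_singleton, isPreconnected_singleton, rfl, empty_subset _, singleton_subset_iff.2 hx0⟩
  · rintro s t hst ⟨K, h1, h2, h3, h4, h5⟩
    exact ⟨K, h1, h2, h3, hst.trans h4, h5⟩
  · rintro s t ⟨K, h1, h2, h3, h4, h5⟩ ⟨K', h1', h2', h3', h4', h5'⟩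
    exact ⟨K ∪ K', h1.union h1', h2.union x0 h3 h3' h2', Or.inl h3, union_subset_union h4 h4', union_subset h5 h5'⟩
  · intro x hx
    obtain ⟨ε, hε, hb⟩ := Metric.nhds_basis_closedBall.mem_iff.1 (ho.mem_nhds (hCE hx))
    obtain ⟨γ, hγ⟩ := hp.joinedIn x0 hx0 x (hCE hx)
    refine ⟨Metric.closedBall x ε, mem_nhdsWithin_of_mem_nhds (Metric.closedBall_mem_nhds x hε),
      range γ ∪ Metric.closedBall x ε, (isCompact_range γ.continuous).union (isCompact_closedBall x ε),
      (isPreconnected_range γ.continuous).union x ⟨1, by simp⟩ (Metric.mem_closedBall_self hε.le)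
        (convex_closedBall x ε).isPreconnected, Or.inl ⟨0, by simp⟩, subset_union_right, union_subset ?_ hb⟩
    rintro _ ⟨t, rfl⟩
    exact hγ t

lemma carve {E C : Set ℂ} (ho : IsOpen E) (hc : IsPreconnected E) (hn : E.Nonempty)
    (hx : IsPreconnected (closure E)ᶜ) (hxn : (closure E)ᶜ.Nonempty) (hC : IsCompact C) (hCE : C ⊆ E) :
    ∃ (O D : Set ℂ) (y : Bool → ℂ), IsOpen O ∧ IsOpen D ∧ IsPreconnected O ∧ IsPreconnected D ∧ (closure E)ᶜ ⊆ O ∧ C ⊆ D ∧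
      Disjoint O D ∧ y false ≠ y true ∧ (∀ i, y i ∉ O) ∧ (∀ i, y i ∉ D) ∧ (∀ i, Acc O (y i)) ∧ (∀ i, Acc D (y i)) := by
  obtain ⟨x0, hx0⟩ := hn
  obtain ⟨K, hKc, hKp, hx0K, hCK, hKE⟩ := exists_compact_conn ho hc hx0 hC hCE
  obtain ⟨p, hp⟩ : (frontier (closure E)).Nonempty := by
    rw [nonempty_frontier_iff]
    exact ⟨⟨x0, subset_closure hx0⟩, fun h => by rw [h] at hxn; simp at hxn⟩
  have hpE : p ∈ closure E := by
    have := hp.1; rwa [closure_closure] at this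
  have hpE' : p ∉ E := fun h => hp.2 (interior_maximal subset_closure ho h)
  have hpx : p ∈ closure (closure E)ᶜ := by
    rw [closure_compl]; exact hp.2
  obtain ⟨d, hd, hdK⟩ : ∃ d > 0, ∀ z ∈ K, d ≤ dist z p := by
    obtain ⟨d, hd, hb⟩ := Metric.isOpen_iff.1 hKc.isClosed.isOpen_compl p (fun h => hpE' (hKE h))
    exact ⟨d, hd, fun z hz => not_lt.1 fun h => hb h hz⟩
  obtain ⟨b, hb, hbp⟩ := Metric.mem_closure_iff.1 hpx (d/4) (by positivity)
  obtain ⟨q, hq, hqp⟩ := Metric.mem_closure_iff.1 hpE (d/4) (by positivity)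
  set r := d / 2 with hr
  have r0 : 0 < r := by positivity
  have hKb : ∀ z ∈ K, r < dist z b := by
    intro z hz
    have := hdK z hz
    have := dist_triangle_right z p b
    linarith
  have hqb : dist q b < r := by
    have := dist_triangle_left q b p
    linarith
  set F := E \ Metric.closedBall b r with hF
  have hFo : IsOpen F := ho.sdiff Metric.isClosed_closedBall
  have hKF : K ⊆ F := fun z hz => ⟨hKE hz, fun h => absurd (hKb z hz) (not_lt.2 h)⟩
  set D := connectedComponentIn F x0 with hD
  have hDo : IsOpen D := hFo.connectedComponentIn
  have hDp : IsPreconnected D := isPreconnected_connectedComponentIn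
  have hDF : D ⊆ F := connectedComponentIn_subset _ _
  have hKD : K ⊆ D := hKp.subset_connectedComponentIn hx0K hKF
  -- absorbing property
  have absb : ∀ T : Set ℂ, IsPreconnected T → T ⊆ F → (T ∩ D).Nonempty → T ⊆ D := by
    rintro T hT hTF ⟨z, hz, hzD⟩
    have h1 := hT.subset_connectedComponentIn hz hTF
    rwa [← connectedComponentIn_eq hzD] at h1
  obtain ⟨y, hyE, hyD, hyc⟩ : ∃ y ∈ E, y ∉ D ∧ y ∈ closure D := by
    by_contra hcon
    push Not at hcon
    have := hc.subset_of_closure_inter_subset hDo ⟨x0, hx0, hKD hx0K⟩ (fun z hz => by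
      by_contra h; exact hcon z hz.2 h hz.1)
    exact (hDF (this hq)).2 hqb.le
  have hyr : dist y b = r := by
    apply le_antisymm
    · by_contra h
      push Not at h
      have hyF : y ∈ F := ⟨hyE, fun h' => absurd h (not_lt.2 h')⟩
      obtain ⟨ε, hε, hbF⟩ := Metric.isOpen_iff.1 hFo y hyF
      obtain ⟨z, hz, hyz⟩ := Metric.mem_closure_iff.1 hyc ε hε
      exact hyD (absb _ (convex_ball y ε).isPreconnected hbF ⟨z, by rw [Metric.mem_ball, dist_comm]; exact hyz, hz⟩
        (Metric.mem_ball_self hε))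
    · by_contra h
      push Not at h
      obtain ⟨z, hz, hyz⟩ := Metric.mem_closure_iff.1 hyc (r - dist y b) (by linarith)
      have h1 := (hDF hz).2
      rw [Metric.mem_closedBall] at h1
      push Not at h1
      have := dist_triangle_left z b y
      linarith
  have hyb : y - b ≠ 0 := by
    rw [← norm_pos_iff, ← dist_eq_norm, hyr]; exact r0
  set φ : ℂ → ℂ := fun w => b + (y - b) * Complex.exp w with hφ
  have φc : Continuous φ := by fun_prop
  have φ0 : φ 0 = y := by simp [hφ]
  have φn : ∀ w, dist (φ w) b = r * Real.exp w.re := by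
    intro w
    rw [dist_eq_norm]
    simp only [hφ, add_sub_cancel_left, norm_mul, Complex.norm_exp]
    rw [← dist_eq_norm, hyr]
  obtain ⟨δ', hδ', hδE'⟩ := Metric.isOpen_iff.1 (ho.preimage φc) 0 (by show φ 0 ∈ E; rwa [φ0])
  obtain ⟨δ, hδ, hδE, hδ1⟩ : ∃ δ > 0, Metric.ball (0:ℂ) δ ⊆ φ ⁻¹' E ∧ δ ≤ 1 :=
    ⟨min δ' 1, lt_min hδ' one_pos, (Metric.ball_subset_ball (min_le_left _ _)).trans hδE', min_le_right _ _⟩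
  set H : Set ℂ := Metric.ball 0 δ ∩ {w | 0 < w.re} with hH
  have hHc : Convex ℝ H := (convex_ball _ _).inter (convex_halfSpace_re_gt 0)
  have hHD : φ '' H ⊆ D := by
    apply absb
    · exact hHc.isPreconnected.image _ φc.continuousOn
    · rintro _ ⟨w, hw, rfl⟩
      refine ⟨hδE hw.1, fun h => ?_⟩
      rw [Metric.mem_closedBall, φn] at h
      have : 1 < Real.exp w.re := Real.one_lt_exp_iff.2 hw.2
      nlinarith
    · have hl : ContinuousAt (fun z => Complex.log ((z - b) / (y - b))) y := by
        apply ContinuousAt.clog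
        · fun_prop
        · rw [div_self hyb]; simp
      have h0 : Complex.log ((y - b) / (y - b)) = 0 := by rw [div_self hyb]; simp
      have hev : ∀ᶠ z in 𝓝 y, Complex.log ((z - b) / (y - b)) ∈ Metric.ball (0:ℂ) δ := by
        apply hl
        simp only [h0]
        exact Metric.ball_mem_nhds _ hδ
      obtain ⟨z, hz, hzD⟩ := mem_closure_iff_nhds.1 hyc _ hev
      have hzb := (hDF hzD).2
      rw [Metric.mem_closedBall] at hzb
      push Not at hzb
      have hz0 : z - b ≠ 0 := by
        rw [← norm_pos_iff, ← dist_eq_norm]; linarith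
      have e : φ (Complex.log ((z - b) / (y - b))) = z := by
        simp only [hφ]
        rw [Complex.exp_log (div_ne_zero hz0 hyb)]
        field_simp
        ring
      refine ⟨z, ⟨_, ⟨hz, ?_⟩, e⟩, hzD⟩
      have h2 := φn (Complex.log ((z - b) / (y - b)))
      rw [e] at h2
      rw [h2] at hzb
      have : 1 < Real.exp (Complex.log ((z - b) / (y - b))).re := by
        by_contra h; push Not at h; nlinarith
      exact Real.one_lt_exp_iff.1 this
  -- marks
  let th : Bool → ℝ := fun i => if i then δ / 2 else 0
  have th0 : ∀ i, 0 ≤ th i ∧ th i ≤ δ / 2 := by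
    intro i; cases i <;> simp [th] <;> positivity
  let Y : Bool → ℂ := fun i => φ ((th i : ℂ) * Complex.I)
  have Yr : ∀ i, dist (Y i) b = r := fun i => by simp [Y, φn]
  have YE : ∀ i, Y i ∈ E := fun i => by
    apply hδE
    rw [mem_ball_zero_iff, norm_mul, Complex.norm_I, mul_one, Complex.norm_real, Real.norm_of_nonneg (th0 i).1]
    linarith [(th0 i).2]
  have Yb : ∀ i, Y i - b ≠ 0 := fun i => by
    rw [← norm_pos_iff, ← dist_eq_norm, Yr]; exact r0
  refine ⟨(closure E)ᶜ ∪ Metric.ball b r, D, Y, isClosed_closure.isOpen_compl.union Metric.isOpen_ball, hDo,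
    hx.union b hb (Metric.mem_ball_self r0) (convex_ball b r).isPreconnected, hDp, subset_union_left, hCK.trans hKD, ?_, ?_, ?_, ?_, ?_, ?_⟩
  · rw [disjoint_left]
    rintro z (h | h) hz
    · exact h (subset_closure (hDF hz).1)
    · exact (hDF hz).2 (Metric.ball_subset_closedBall h)
  · intro h
    simp only [Y, hφ, th] at h
    have h1 := mul_left_cancel₀ hyb (add_left_cancel h)
    rw [Complex.exp_eq_exp_iff_exists_int] at h1
    obtain ⟨n, hn⟩ := h1
    have h2 := congrArg Complex.im hn
    simp at h2
    have hπ := Real.pi_gt_three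
    have hn0 : (n:ℝ) = 0 ∨ (1:ℝ) ≤ |(n:ℝ)| := by
      by_cases h : n = 0
      · left; simp [h]
      · right; exact_mod_cast Int.one_le_abs h
    rcases hn0 with h | h
    · rw [h] at h2; linarith
    · have h3 : |(n:ℝ) * (2 * Real.pi)| = δ / 2 := by
        rw [show (n:ℝ) * (2 * Real.pi) = -(δ/2) by linarith, abs_neg, abs_of_pos (by positivity)]
      rw [abs_mul, abs_of_pos (by positivity : (0:ℝ) < 2 * Real.pi)] at h3
      nlinarith
  · rintro i (h | h)
    · exact h (subset_closure (YE i))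
    · rw [Metric.mem_ball, Yr] at h; exact lt_irrefl _ h
  · intro i h
    exact (hDF h).2 (Yr i).le
  · intro i
    refine Acc.of_segment (v := -(Y i - b)) (neg_ne_zero.2 (Yb i)) one_pos (fun t ht ht1 => Or.inr ?_)
    rw [Metric.mem_ball, dist_eq_norm]
    have : Y i + t * -(Y i - b) - b = ((1 - t : ℝ) : ℂ) * (Y i - b) := by push_cast; ring
    rw [this, norm_mul, ← dist_eq_norm, Yr, Complex.norm_real, Real.norm_of_nonneg (by linarith)]
    nlinarith
  · intro i
    refine Acc.of_segment (v := Y i - b) (Yb i) (δ := δ / 2) (by positivity) (fun t ht ht1 => hHD ?_)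
    refine ⟨(Real.log (1 + t) : ℂ) + (th i : ℂ) * Complex.I, ⟨?_, ?_⟩, ?_⟩
    · rw [mem_ball_zero_iff]
      refine (norm_add_le _ _).trans_lt ?_
      rw [norm_mul, Complex.norm_I, mul_one, Complex.norm_real, Complex.norm_real, Real.norm_of_nonneg (th0 i).1,
        Real.norm_of_nonneg (Real.log_nonneg (by linarith))]
      have := Real.log_le_sub_one_of_pos (by linarith : 0 < 1 + t)
      linarith [(th0 i).2]
    · show 0 < Complex.re _
      simp
      exact Real.log_pos (by linarith)
    · simp only [Y, hφ]
      rw [Complex.exp_add, ← Complex.ofReal_exp, Real.exp_log (by linarith)]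
      push_cast
      ring

lemma sph_pre {U : Set RSphere} (ho : IsOpen U) (hc : IsPreconnected U) {q : RSphere} (hq : q ∉ U) :
    IsPreconnected (ofC ⁻¹' U) := by
  by_cases hiU : infty ∈ U
  swap
  · refine hc.preimage_of_isOpenMap ofC_injective isOpenMap_ofC ?_
    intro x hx
    rcases sph_cases x with rfl | ⟨z, rfl⟩
    · exact absurd hx hiU
    · exact ⟨z, rfl⟩
  obtain ⟨T, hT⟩ := exists_to_inf q
  have hi : mobius T infty ≠ infty := by
    intro h
    have h' : mobius T infty = mobius T q := by rw [h, hT]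
    exact hq (mobius_injective T h' ▸ hiU)
  have hTo : IsOpen (mobius T '' U) := (mobiusHomeo T).isOpenMap _ ho
  have hTi : infty ∉ mobius T '' U := by
    rintro ⟨x, hx, h⟩
    rw [← hT] at h
    exact hq (mobius_injective T h ▸ hx)
  have h1 : IsPreconnected (ofC ⁻¹' (mobius T '' U)) := by
    refine (hc.image _ (continuous_mobius T).continuousOn).preimage_of_isOpenMap ofC_injective isOpenMap_ofC ?_
    intro x hx
    rcases sph_cases x with rfl | ⟨z, rfl⟩
    · exact absurd hx hTi
    · exact ⟨z, rfl⟩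
  have h2 := preconnected_diff_singleton (hTo.preimage continuous_ofC) h1 (toC (mobius T infty))
  have key : ∀ z ∈ (ofC ⁻¹' (mobius T '' U)) \ {toC (mobius T infty)}, mobius T⁻¹ (ofC z) ≠ infty := by
    rintro z ⟨hz, hz'⟩ h
    apply hz'
    have : ofC z = mobius T infty := by rw [← h, mobius_apply_inv]
    rw [← this]; simp [toC_ofC]
  have h3 := h2.image (fun z => toC (mobius T⁻¹ (ofC z))) (by
    refine continuousOn_toC.comp ((continuous_mobius _).comp continuous_ofC).continuousOn ?_
    intro z hz
    exact key z hz)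
  convert h3 using 1
  ext w; constructor
  · intro hw
    have hw' : mobius T (ofC w) ∈ mobius T '' U := mem_image_of_mem _ hw
    have hne : mobius T (ofC w) ≠ infty := fun h => hTi (h ▸ hw')
    refine ⟨toC (mobius T (ofC w)), ⟨?_, ?_⟩, ?_⟩
    · show ofC (toC _) ∈ mobius T '' U
      rw [ofC_toC hne]; exact hw'
    · intro h
      rw [mem_singleton_iff] at h
      have h5 := congrArg ofC h
      rw [ofC_toC hne, ofC_toC hi] at h5
      exact ofC_ne_infty w (mobius_injective T h5)
    · show toC (mobius T⁻¹ (ofC (toC (mobius T (ofC w))))) = w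
      rw [ofC_toC hne, mobius_inv_apply, toC_ofC]
  · rintro ⟨z, hz, rfl⟩
    show ofC (toC _) ∈ U
    rw [ofC_toC (key z hz)]
    obtain ⟨x, hx, h⟩ := hz.1
    rw [← h, mobius_inv_apply]; exact hx

end QC
end
end

section
open Filter Set Topology RSphere MeasureTheory
open scoped ENNReal NNReal
noncomputable section
set_option linter.all false
namespace QC
namespace Dat
variable {g : ℕ} (S : Dat g)

/-- data for one generator -/
structure Piece (i : Fin g) (W : Set RSphere) where
  O : Set ℂ
  D : Set ℂ
  y : Bool → ℂ
  Oo : IsOpen O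
  Do : IsOpen D
  Oc : IsPreconnected O
  Dc : IsPreconnected D
  ext : (closure (ofC ⁻¹' S.D (Sum.inl i)))ᶜ ⊆ O
  ne : O.Nonempty
  CD : ∀ x, mobius (S.gen i) x ∉ W → x ∈ ofC '' D
  disj : Disjoint O D
  yne : y false ≠ y true
  yO : ∀ i, y i ∉ O
  yD : ∀ i, y i ∉ D
  aO : ∀ i, Acc O (y i)
  aD : ∀ i, Acc D (y i)

lemma exists_piece (i : Fin g) {W : Set RSphere} (hW : IsOpen W) (hDW : closure (S.D (Sum.inr i)) ⊆ W) :
    Nonempty (S.Piece i W) := by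
  set V := S.D (Sum.inl i) with hV
  have hVo := S.isOpen (Sum.inl i)
  have hVi := S.inf (Sum.inl i)
  have ecl : closure (ofC ⁻¹' V) = ofC ⁻¹' closure V :=
    (isOpenMap_ofC.preimage_closure_eq_closure_preimage continuous_ofC V).symm
  have hVi' : infty ∉ V := fun h => hVi (subset_closure h)
  have hn : (ofC ⁻¹' V).Nonempty := by
    obtain ⟨x, hx⟩ := S.nonempty (Sum.inl i)
    rcases sph_cases x with rfl | ⟨z, rfl⟩
    · exact absurd hx hVi'
    · exact ⟨z, hx⟩
  have hx : IsPreconnected (closure (ofC ⁻¹' V))ᶜ := by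
    rw [ecl, ← preimage_compl]
    obtain ⟨z, hz⟩ := hn
    exact sph_pre isClosed_closure.isOpen_compl (S.conn' _) (q := ofC z) (fun h => h (subset_closure hz))
  have hcptV : IsCompact (closure (ofC ⁻¹' V)) := by
    rw [ecl]; exact isCompact_preimage isClosed_closure hVi
  have hxn : (closure (ofC ⁻¹' V))ᶜ.Nonempty := by
    rw [nonempty_compl]
    intro h
    rw [h] at hcptV
    exact noncompact_univ ℂ hcptV
  set C : Set RSphere := (mobius (S.gen i)) ⁻¹' Wᶜ with hC
  have hCc : IsClosed C := hW.isClosed_compl.preimage (continuous_mobius _)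
  have hCV : C ⊆ V := by
    intro x hx
    have h1 : mobius (S.gen i) x ∉ closure (S.D (Sum.inr i)) := fun h => hx (hDW h)
    have := S.map2 h1
    rwa [mobius_inv_apply] at this
  have hCi : infty ∉ C := fun h => hVi' (hCV h)
  obtain ⟨O, D, y, h1, h2, h3, h4, h5, h6, h7, h8, h9, h10, h11, h12⟩ :=
    carve (hVo.preimage continuous_ofC) (sph_pre hVo (S.conn _) hVi') hn hx hxn (isCompact_preimage hCc hCi)
      (preimage_mono hCV)
  refine ⟨⟨O, D, y, h1, h2, h3, h4, h5, hxn.mono h5, ?_, h7, h8, h9, h10, h11, h12⟩⟩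
  intro x hx
  have hxC : x ∈ C := hx
  rcases sph_cases x with rfl | ⟨z, rfl⟩
  · exact absurd hxC hCi
  · exact ⟨z, h6 hxC, rfl⟩

lemma acc_mobius (G : SL2C) {U U' : Set ℂ} {y : ℂ} (h : Acc U y) (hy : y ∉ U) (hne : mobius G (ofC y) ≠ infty)
    (hm : ∀ x ∈ U, ∀ w, mobius G (ofC x) = ofC w → w ∈ U') : Acc U' (toC (mobius G (ofC y))) := by
  set R := ‖toC (mobius G (ofC y))‖ + 1 with hR
  obtain ⟨K, hK⟩ := lipschitzOn_toC R
  obtain ⟨K', hK'⟩ := lipschitz_mobius G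
  set N : Set ℂ := (fun z => mobius G (ofC z)) ⁻¹' (ofC '' Metric.ball 0 R) with hN
  have hNo : IsOpen N := (isOpenMap_ofC _ Metric.isOpen_ball).preimage ((continuous_mobius G).comp continuous_ofC)
  have hyN : y ∈ N := ⟨toC (mobius G (ofC y)), by simp [hR], ofC_toC hne⟩
  have hL : LipschitzOnWith (K * (K' * 2)) (fun z => toC (mobius G (ofC z))) N := by
    have := hK.comp (((hK'.comp lipschitz_ofC).lipschitzOnWith (s := N))) (by
      rintro z ⟨w, hw, h⟩
      exact ⟨w, Metric.ball_subset_closedBall hw, h⟩)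
    exact this
  have hNe : ∀ z ∈ N, mobius G (ofC z) ≠ infty := by
    rintro z ⟨w, _, h⟩
    have h' : ofC w = mobius G (ofC z) := h
    rw [← h']; exact ofC_ne_infty w
  refine Acc.map (φ := fun z => toC (mobius G (ofC z))) (N := N) h (hNo.mem_nhds hyN) ?_ hL ?_ hy
  · intro a ha b hb hab
    have := congrArg ofC hab
    simp only at this
    rw [ofC_toC (hNe a ha), ofC_toC (hNe b hb)] at this
    exact ofC_injective (mobius_injective G this)
  · rintro x ⟨hx, hxN⟩
    exact hm x hx _ (ofC_toC (hNe x hxN)).symm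

lemma exists_W : ∃ W : Fin g ⊕ Fin g → Set RSphere, (∀ a, IsOpen (W a)) ∧ (∀ a, closure (S.D a) ⊆ W a) ∧
    (∀ a, infty ∉ W a) ∧ ∀ a b, a ≠ b → Disjoint (W a) (W b) := by
  have key : ∀ s t : Set RSphere, IsClosed s → IsClosed t → Disjoint s t →
      ∀ᶠ δ in 𝓝[>] (0:ℝ), Disjoint (Metric.thickening δ s) (Metric.thickening δ t) := by
    intro s t hs ht h
    obtain ⟨δ, hδ, hd⟩ := h.exists_thickenings hs.isCompact ht
    filter_upwards [Ioo_mem_nhdsGT hδ] with δ' hδ'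
    exact hd.mono (Metric.thickening_mono hδ'.2.le _) (Metric.thickening_mono hδ'.2.le _)
  have h1 : ∀ᶠ δ in 𝓝[>] (0:ℝ), ∀ a b, a ≠ b → Disjoint (Metric.thickening δ (closure (S.D a))) (Metric.thickening δ (closure (S.D b))) := by
    rw [eventually_all]; intro a
    rw [eventually_all]; intro b
    rw [eventually_imp_distrib_left]
    exact fun h => key _ _ isClosed_closure isClosed_closure (S.disj a b h)
  have h2 : ∀ᶠ δ in 𝓝[>] (0:ℝ), ∀ a, Disjoint (Metric.thickening δ (closure (S.D a))) (Metric.thickening δ {infty}) := by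
    rw [eventually_all]; intro a
    exact key _ _ isClosed_closure isClosed_singleton (by simpa using S.inf a)
  obtain ⟨δ, ⟨h1, h2⟩, hδ⟩ := ((h1.and h2).and self_mem_nhdsWithin).exists
  exact ⟨fun a => Metric.thickening δ (closure (S.D a)), fun a => Metric.isOpen_thickening,
    fun a => Metric.self_subset_thickening hδ _,
    fun a h => disjoint_left.1 (h2 a) h (Metric.self_subset_thickening hδ _ rfl), h1⟩

lemma forward (hg : 0 < g)
    (hd : limitDim (Subgroup.closure (Set.range fun i => ((S.gen i : PSL2C)))) < 1) :
    ∃ η, IsQuasiCircle (Subgroup.closure (Set.range fun i => ((S.gen i : PSL2C)))) η ∧ Rectifiable η := by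
  obtain ⟨W, hWo, hDW, hWi, hWd⟩ := S.exists_W
  let p : ∀ i, S.Piece i (W (Sum.inr i)) := fun i => (S.exists_piece i (hWo _) (hDW _)).some
  let A : Fin g ⊕ Fin g → Set RSphere := Sum.elim (fun i => ofC '' (p i).Oᶜ)
    (fun i => (mobius (S.gen i) '' (ofC '' (p i).D))ᶜ)
  have hOcl : ∀ i, (p i).Oᶜ ⊆ ofC ⁻¹' closure (S.D (Sum.inl i)) := by
    intro i z hz
    by_contra h
    apply hz
    apply (p i).ext
    rw [← isOpenMap_ofC.preimage_closure_eq_closure_preimage continuous_ofC]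
    exact h
  have hOk : ∀ i, IsCompact (p i).Oᶜ := fun i =>
    (isCompact_preimage isClosed_closure (S.inf (Sum.inl i))).of_isClosed_subset (p i).Oo.isClosed_compl (hOcl i)
  have hGo : ∀ i, IsOpen (mobius (S.gen i) '' (ofC '' (p i).D)) := fun i =>
    (mobiusHomeo (S.gen i)).isOpenMap _ (isOpenMap_ofC _ (p i).Do)
  have hc : ∀ a, IsClosed (A a) := by
    rintro (i | i)
    · exact isClosedEmb_compact (hOk i)
    · exact (hGo i).isClosed_compl
  have hAW : ∀ a, A a ⊆ W a := by
    rintro (i | i) x hx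
    · obtain ⟨z, hz, rfl⟩ := hx
      exact hDW _ (hOcl i hz)
    · by_contra h
      apply hx
      refine ⟨mobius (S.gen i)⁻¹ x, (p i).CD _ ?_, mobius_apply_inv _ _⟩
      rwa [mobius_apply_inv]
  have hi : ∀ a, infty ∉ A a := fun a h => hWi a (hAW a h)
  have h1 : ∀ i x, x ∉ A (Sum.inl i) → mobius (S.gen i) x ∈ A (Sum.inr i) := by
    rintro i x hx ⟨_, ⟨z, hz, rfl⟩, h⟩
    have := mobius_injective _ h
    apply hx
    exact ⟨z, fun h => disjoint_left.1 (p i).disj h hz, this⟩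
  have h2 : ∀ i x, x ∉ A (Sum.inr i) → mobius (S.gen i)⁻¹ x ∈ A (Sum.inl i) := by
    intro i x hx
    have hx' : x ∈ mobius (S.gen i) '' (ofC '' (p i).D) := not_not.1 hx
    obtain ⟨_, ⟨z, hz, rfl⟩, rfl⟩ := hx'
    rw [mobius_inv_apply]
    exact ⟨z, fun h => disjoint_left.1 (p i).disj h hz, rfl⟩
  set P := S.mkPP A hc hi (fun a b hab => (hWd a b hab).mono (hAW a) (hAW b)) h1 h2 with hP
  have hG := P.gen_of S.gen rfl
  have hyr : ∀ i j, mobius (S.gen i) (ofC ((p i).y j)) ∈ A (Sum.inr i) := by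
    rintro i j ⟨_, ⟨z, hz, rfl⟩, h⟩
    have := ofC_injective (mobius_injective _ h)
    exact (p i).yD j (this ▸ hz)
  have hyi : ∀ i j, mobius (S.gen i) (ofC ((p i).y j)) ≠ infty := fun i j h => hi _ (h ▸ hyr i j)
  let mk : Bool → Fin g ⊕ Fin g → ℂ := fun j => Sum.elim (fun i => (p i).y j)
    (fun i => toC (mobius (S.gen i) (ofC ((p i).y (!j)))))
  have mkmem : ∀ j a, ofC (mk j a) ∈ A a := by
    rintro j (i | i)
    · exact ⟨_, (p i).yO j, rfl⟩
    · show ofC (toC _) ∈ _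
      rw [ofC_toC (hyi i _)]
      exact hyr i _
  have mkM : ∀ j a, mobius (P.M a) (ofC (mk (!j) (P.inv a))) = ofC (mk j a) := by
    rintro j (i | i)
    · show mobius (S.gen i)⁻¹ (ofC (toC (mobius (S.gen i) (ofC ((p i).y (!!j)))))) = ofC ((p i).y j)
      rw [ofC_toC (hyi i _), mobius_inv_apply, Bool.not_not]
    · show mobius (S.gen i) (ofC ((p i).y (!j))) = ofC (toC (mobius (S.gen i) (ofC ((p i).y (!j)))))
      rw [ofC_toC (hyi i _)]
  have preA : ∀ i, (ofC ⁻¹' A (Sum.inl i))ᶜ = (p i).O := by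
    intro i
    show (ofC ⁻¹' (ofC '' (p i).Oᶜ))ᶜ = _
    rw [preimage_image_eq _ ofC_injective, compl_compl]
  have preB : ∀ i, (ofC ⁻¹' A (Sum.inr i))ᶜ = ofC ⁻¹' (mobius (S.gen i) '' (ofC '' (p i).D)) := by
    intro i
    show (ofC ⁻¹' (mobius (S.gen i) '' (ofC '' (p i).D))ᶜ)ᶜ = _
    rw [preimage_compl, compl_compl]
  have mkacc : ∀ j a, Acc (ofC ⁻¹' A a)ᶜ (mk j a) := by
    rintro j (i | i)
    · rw [preA]; exact (p i).aO j
    · rw [preB]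
      refine acc_mobius (S.gen i) ((p i).aD (!j)) ((p i).yD _) (hyi i _) ?_
      intro x hx w hw
      exact ⟨ofC x, ⟨x, hx, rfl⟩, hw⟩
  have hcard : 2 ≤ Nat.card (Fin g ⊕ Fin g) := by
    rw [Nat.card_eq_fintype_card, Fintype.card_sum, Fintype.card_fin]; omega
  have hst : ∀ a, mk false a ≠ mk true a := by
    rintro (i | i)
    · exact (p i).yne
    · intro h
      have := congrArg ofC h
      simp only [mk, Sum.elim_inr] at this
      rw [ofC_toC (hyi i _), ofC_toC (hyi i _)] at this
      exact (p i).yne (ofC_injective (mobius_injective _ this)).symm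
  have hpc : ∀ a, IsPreconnected (ofC ⁻¹' (P.A a))ᶜ := by
    rintro (i | i)
    · show IsPreconnected (ofC ⁻¹' A (Sum.inl i))ᶜ
      rw [preA]; exact (p i).Oc
    · show IsPreconnected (ofC ⁻¹' A (Sum.inr i))ᶜ
      rw [preB]
      refine sph_pre (hGo i) (((p i).Dc.image _ continuous_ofC.continuousOn).image _ (continuous_mobius _).continuousOn)
        (q := mobius (S.gen i) (ofC ((p i).y true))) ?_
      exact hyr i true
  obtain ⟨Dm⟩ := P.exists_marks hcard (mk false) (mk true) (mkmem false) (mkmem true) hst (mkM false) (mkM true) hpc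
    (mkacc false) (mkacc true)
  refine Dm.forward (Sum.inl ⟨0, hg⟩) hG ?_
  rw [← P.Lam_eq_limitSet hG]; exact hd

end Dat
end QC
end
end

/-- **Bowen.** For a Schottky group `Γ`, the Hausdorff dimension of the limit
set is `< 1` iff there exists a rectifiable quasi-circle for `Γ`. -/
theorem dimH_lt_one_iff_exists_rectifiable_quasicircle
    (Γ : Subgroup PSL2C) (hS : IsSchottky Γ) :
    limitDim Γ < 1 ↔ ∃ η : Set RSphere, IsQuasiCircle Γ η ∧ Rectifiable η := by
  obtain ⟨g, S, rfl, -, -, -⟩ := hS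
  rcases Nat.eq_zero_or_pos g with rfl | hg
  · exact ⟨fun _ => (QC.trivial_case S).2, fun _ => (QC.trivial_case S).1⟩
  · obtain ⟨S', T, hC⟩ := QC.normalize hg S
    constructor
    · intro h
      exact hC.symm.quasi (S'.forward hg (by rw [hC.dim]; exact h))
    · intro h
      obtain ⟨η, hq, hr⟩ := hC.quasi h
      rw [← hC.dim]
      exact S'.backward hg hq hr
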